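/- Fix a dominant integral weight λ = Σ_i c_i ω_i (ω_i the fundamental weights) and let I_λ = Σ_{i∈I} U_q^-(𝔤)·F_i^{c_i+1}, so that V_λ = U_q^-(𝔤)/I_λ is the irreducible highest weight module. Then the intersection B ∩ I_λ of the canonical basis with I_λ spans I_λ; equivalently, the non-zero images { b + I_λ : b ∈ B, b ∉ I_λ } form a basis of V_λ. -/

import Mathlib

/-!
Common setup: the quantized universal enveloping algebra `U_q(𝔤)` of a simple
complex Lie algebra of type ADE, presented by the Chevalley generators
`E i`, `F i`, `K i`, `K i⁻¹` over `ℚ(q)`, together with the combinatorics of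
words in the Weyl group, PBW root vectors and monomials, Lusztig's braid group
automorphisms, the bar involution, lattices, and partial orders on Lusztig data.
-/

noncomputable section

open scoped BigOperators

/-- The base field `ℚ(q)`. -/
abbrev 𝕂 : Type := RatFunc ℚ

/-- The indeterminate `q ∈ ℚ(q)`. -/
noncomputable def qq : 𝕂 := RatFunc.X

/-- The Cartan matrix attached to an adjacency function: `2` on the diagonal,
`-1` for adjacent vertices, `0` otherwise. -/
def cartanOf {I : Type} [DecidableEq I] (adj : I → I → Bool) (i j : I) : ℤ :=
  if i = j then 2 else if adj i j then -1 else 0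

/-- The datum of a simply laced (ADE) Dynkin diagram of a simple Lie algebra:
a finite nonempty vertex set with a symmetric irreflexive adjacency relation,
connected (simple `𝔤`), whose Cartan matrix is positive definite (finite type;
together with simply-lacedness this characterizes types A, D, E). -/
structure ADEData (I : Type) [Fintype I] [DecidableEq I] : Type where
  nonE : Nonempty I
  adj : I → I → Bool
  symm : ∀ i j, adj i j = adj j i
  irrefl : ∀ i, adj i i = false
  conn : ∀ i j : I, Relation.ReflTransGen (fun a b => adj a b = true) i j
  posdef : ∀ v : I → ℚ, v ≠ 0 → 0 < ∑ i, ∑ j, (cartanOf adj i j : ℚ) * v i * v j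

variable {I : Type} [Fintype I] [DecidableEq I]

/-- Generators `E i`, `F i`, `K i`, `K i⁻¹` of `U_q(𝔤)`. -/
inductive Gen (I : Type) : Type
  | E : I → Gen I
  | F : I → Gen I
  | K : I → Gen I
  | Kinv : I → Gen I

/-- The free `ℚ(q)`-algebra on the generators. -/
abbrev FA (I : Type) := FreeAlgebra 𝕂 (Gen I)

def gE (i : I) : FA I := FreeAlgebra.ι 𝕂 (Gen.E i)
def gF (i : I) : FA I := FreeAlgebra.ι 𝕂 (Gen.F i)
def gK (i : I) : FA I := FreeAlgebra.ι 𝕂 (Gen.K i)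
def gKinv (i : I) : FA I := FreeAlgebra.ι 𝕂 (Gen.Kinv i)

/-- The defining relations of `U_q(𝔤)` (type ADE). -/
inductive QRel (D : ADEData I) : FA I → FA I → Prop
  | KKinv (i : I) : QRel D (gK i * gKinv i) 1
  | KinvK (i : I) : QRel D (gKinv i * gK i) 1
  | KcommK (i j : I) : QRel D (gK i * gK j) (gK j * gK i)
  | KEself (i : I) : QRel D (gK i * gE i * gKinv i) ((qq ^ 2) • gE i)
  | KFself (i : I) : QRel D (gK i * gF i * gKinv i) ((qq ^ 2)⁻¹ • gF i)
  | EFdiff (i j : I) (h : i ≠ j) : QRel D (gE i * gF j - gF j * gE i) 0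
  | EFself (i : I) :
      QRel D (gE i * gF i - gF i * gE i) ((qq - qq⁻¹)⁻¹ • (gK i - gKinv i))
  | serreE (i j : I) (h : D.adj i j = true) :
      QRel D (gE i ^ 2 * gE j + gE j * gE i ^ 2) ((qq + qq⁻¹) • (gE i * gE j * gE i))
  | serreF (i j : I) (h : D.adj i j = true) :
      QRel D (gF i ^ 2 * gF j + gF j * gF i ^ 2) ((qq + qq⁻¹) • (gF i * gF j * gF i))
  | KEadj (i j : I) (h : D.adj i j = true) :
      QRel D (gK i * gE j * gKinv i) (qq⁻¹ • gE j)
  | KFadj (i j : I) (h : D.adj i j = true) :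
      QRel D (gK i * gF j * gKinv i) (qq • gF j)
  | EEfar (i j : I) (h : i ≠ j) (h' : D.adj i j = false) :
      QRel D (gE i * gE j) (gE j * gE i)
  | FFfar (i j : I) (h : i ≠ j) (h' : D.adj i j = false) :
      QRel D (gF i * gF j) (gF j * gF i)
  | KEfar (i j : I) (h : i ≠ j) (h' : D.adj i j = false) :
      QRel D (gK i * gE j * gKinv i) (gE j)
  | KFfar (i j : I) (h : i ≠ j) (h' : D.adj i j = false) :
      QRel D (gK i * gF j * gKinv i) (gF j)

/-- The quantized universal enveloping algebra `U_q(𝔤)`. -/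
abbrev Uq (D : ADEData I) := RingQuot (QRel D)

/-- The generator `E i` of `U_q(𝔤)`. -/
def EE (D : ADEData I) (i : I) : Uq D := RingQuot.mkAlgHom 𝕂 (QRel D) (gE i)
/-- The generator `F i` of `U_q(𝔤)`. -/
def FF (D : ADEData I) (i : I) : Uq D := RingQuot.mkAlgHom 𝕂 (QRel D) (gF i)
/-- The generator `K i` of `U_q(𝔤)`. -/
def KK (D : ADEData I) (i : I) : Uq D := RingQuot.mkAlgHom 𝕂 (QRel D) (gK i)
/-- The generator `K i ⁻¹` of `U_q(𝔤)`. -/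
def KKinv (D : ADEData I) (i : I) : Uq D := RingQuot.mkAlgHom 𝕂 (QRel D) (gKinv i)

/-- The quantum integer `[n] = q^{n-1} + q^{n-3} + ⋯ + q^{-n+1}`. -/
def qInt (n : ℕ) : 𝕂 := ∑ t ∈ Finset.range n, qq ^ ((n : ℤ) - 1 - 2 * (t : ℤ))

/-- The quantum factorial `[n]! = [n][n-1]⋯[2][1]`. -/
def qFact (n : ℕ) : 𝕂 := ∏ t ∈ Finset.range n, qInt (t + 1)

/-- The `q`-divided power `X^{(n)} = X^n / [n]!`. -/
def dp {D : ADEData I} (x : Uq D) (n : ℕ) : Uq D := (qFact n)⁻¹ • x ^ n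

/-- `U_q^-(𝔤)`: the subalgebra generated by the `F i`. -/
def Uminus (D : ADEData I) : Subalgebra 𝕂 (Uq D) :=
  Algebra.adjoin 𝕂 (Set.range (FF D))

/-- `U_q^{≥0}(𝔤)`: the subalgebra generated by the `E i` and `K i^{±1}`. -/
def Ugeq0 (D : ADEData I) : Subalgebra 𝕂 (Uq D) :=
  Algebra.adjoin 𝕂 (Set.range (EE D) ∪ Set.range (KK D) ∪ Set.range (KKinv D))

/-- A family of algebra automorphisms `T i` is the family of Lusztig braid
automorphisms if it takes the prescribed values on all generators. -/
def IsLusztigAuts (D : ADEData I) (T : I → (Uq D ≃ₐ[𝕂] Uq D)) : Prop :=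
  ∀ i j : I,
    (T i (FF D i) = -(KKinv D i * EE D i)) ∧
    (D.adj i j = true → T i (FF D j) = FF D j * FF D i - qq • (FF D i * FF D j)) ∧
    (i ≠ j → D.adj i j = false → T i (FF D j) = FF D j) ∧
    (T i (EE D i) = -(FF D i * KK D i)) ∧
    (D.adj i j = true → T i (EE D j) = EE D i * EE D j - qq⁻¹ • (EE D j * EE D i)) ∧
    (i ≠ j → D.adj i j = false → T i (EE D j) = EE D j) ∧
    (T i (KK D i) = KKinv D i) ∧
    (D.adj i j = true → T i (KK D j) = KK D i * KK D j) ∧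
    (i ≠ j → D.adj i j = false → T i (KK D j) = KK D j)

/-- The Cartan matrix of the diagram. -/
def cartan (D : ADEData I) : I → I → ℤ := cartanOf D.adj

/-- The simple root `α i`, as a vector in the root lattice `ℤ^I`. -/
def simpleRoot (i : I) : I → ℤ := fun j => if j = i then 1 else 0

/-- The standard pairing `(v, α i)` on the root lattice. -/
def pairing (D : ADEData I) (v : I → ℤ) (i : I) : ℤ := ∑ j, v j * cartan D j i

/-- The simple reflection `s i` acting on the root lattice. -/
def sref (D : ADEData I) (i : I) (v : I → ℤ) : I → ℤ :=
  fun j => v j - pairing D v i * simpleRoot i j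

/-- Action of a word `(i₁, …, i_N)` on the root lattice: `s_{i₁} ∘ ⋯ ∘ s_{i_N}`. -/
def wordAct (D : ADEData I) : List I → (I → ℤ) → (I → ℤ)
  | [] => fun v => v
  | i :: l => fun v => sref D i (wordAct D l v)

/-- A word in the generators of the Weyl group is reduced if no shorter word
defines the same element (i.e., the same action on the root lattice). -/
def IsReducedWord (D : ADEData I) (w : List I) : Prop :=
  ∀ w' : List I, wordAct D w' = wordAct D w → w.length ≤ w'.length

/-- `w` is a reduced expression of the longest element `w₀` of the Weyl group. -/
def IsRedW0 (D : ADEData I) (w : List I) : Prop :=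
  IsReducedWord D w ∧ ∀ w' : List I, IsReducedWord D w' → w'.length ≤ w.length

/-- The root `β_k = s_{i₁} ⋯ s_{i_{k-1}} (α_{i_k})` attached to the `k`-th letter
of the word `w` (here `k` is 0-indexed). -/
def beta (D : ADEData I) (w : List I) (k : Fin w.length) : I → ℤ :=
  wordAct D (w.take k) (simpleRoot (w.get k))

/-- `v` is a root: it lies in the Weyl group orbit of a simple root. -/
def IsRoot (D : ADEData I) (v : I → ℤ) : Prop :=
  ∃ (l : List I) (i : I), v = wordAct D l (simpleRoot i)

/-- `v` is a positive root. -/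
def IsPosRoot (D : ADEData I) (v : I → ℤ) : Prop :=
  IsRoot D v ∧ ∀ j, 0 ≤ v j

/-- Apply `T_{i₁} ∘ T_{i₂} ∘ ⋯ ∘ T_{i_m}` for a word `(i₁, …, i_m)`. -/
def applyT {D : ADEData I} (T : I → (Uq D ≃ₐ[𝕂] Uq D)) : List I → Uq D → Uq D
  | [], x => x
  | i :: l, x => T i (applyT T l x)

/-- Apply `T_{i_m}^{-1} ∘ ⋯ ∘ T_{i₁}^{-1}` for a word `(i₁, …, i_m)`. -/
def applyTinv {D : ADEData I} (T : I → (Uq D ≃ₐ[𝕂] Uq D)) : List I → Uq D → Uq D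
  | [], x => x
  | i :: l, x => applyTinv T l ((T i).symm x)

/-- The PBW root vector `F_{i;β_k} = T_{i₁} ⋯ T_{i_{k-1}} (F_{i_k})`
(`k` is 0-indexed). -/
def rootVec {D : ADEData I} (T : I → (Uq D ≃ₐ[𝕂] Uq D)) (w : List I)
    (k : Fin w.length) : Uq D :=
  applyT T (w.take k) (FF D (w.get k))

/-- The PBW monomial `F^a = F_{β₁}^{(a₁)} F_{β₂}^{(a₂)} ⋯ F_{β_N}^{(a_N)}`
attached to the Lusztig datum `a`. -/
def pbw {D : ADEData I} (T : I → (Uq D ≃ₐ[𝕂] Uq D)) (w : List I)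
    (a : Fin w.length → ℕ) : Uq D :=
  ((List.finRange w.length).map (fun k => dp (rootVec T w k) (a k))).prod

/-- `u` is a homogeneous element of weight `μ` for the root-lattice grading of
`U_q(𝔤)`: conjugation by `K i` multiplies it by `q^{(μ, α_i)}`. -/
def HasWeight (D : ADEData I) (u : Uq D) (μ : I → ℤ) : Prop :=
  ∀ i, KK D i * u * KKinv D i = (qq ^ pairing D μ i) • u

/-- The weight `Σ_k a_k β_k` of a Lusztig datum. -/
def wtData (D : ADEData I) (w : List I) (a : Fin w.length → ℕ) : I → ℤ :=
  ∑ k, (a k : ℤ) • beta D w k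

/-- `a` is less than `b` in the left lexicographic order on Lusztig data:
at the first index where they differ, `a` is **bigger**. -/
def LtLeft {N : ℕ} (a b : Fin N → ℕ) : Prop :=
  ∃ k, b k < a k ∧ ∀ l, l < k → a l = b l

/-- `a` is less than `b` in the right lexicographic order on Lusztig data:
at the last index where they differ, `a` is **bigger**. -/
def LtRight {N : ℕ} (a b : Fin N → ℕ) : Prop :=
  ∃ k, b k < a k ∧ ∀ l, k < l → a l = b l

/-- The partial order `≺` on Lusztig data: same weight, and strictly smaller in
both lexicographic orders. -/
def Prec (D : ADEData I) (w : List I) (a b : Fin w.length → ℕ) : Prop :=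
  wtData D w a = wtData D w b ∧ LtLeft a b ∧ LtRight a b

/-- Two words are related by a single braid move. -/
def BraidMove (D : ADEData I) (w w' : List I) : Prop :=
  (∃ (w₁ w₂ : List I) (a b : I), a ≠ b ∧ D.adj a b = false ∧
      w = w₁ ++ a :: b :: w₂ ∧ w' = w₁ ++ b :: a :: w₂) ∨
  (∃ (w₁ w₂ : List I) (a b : I), D.adj a b = true ∧
      w = w₁ ++ a :: b :: a :: w₂ ∧ w' = w₁ ++ b :: a :: b :: w₂)

instance : Algebra (Polynomial ℤ) 𝕂 :=
  ((Polynomial.aeval qq : Polynomial ℤ →ₐ[ℤ] 𝕂)).toRingHom.toAlgebra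

instance (D : ADEData I) : Module (Polynomial ℤ) (Uq D) :=
  Module.compHom _ (algebraMap (Polynomial ℤ) 𝕂)

/-- The `ℤ[q]`-lattice `𝓛` spanned by the PBW monomials of `B_i`. -/
def latt {D : ADEData I} (T : I → (Uq D ≃ₐ[𝕂] Uq D)) (w : List I) :
    Submodule (Polynomial ℤ) (Uq D) :=
  Submodule.span (Polynomial ℤ) (Set.range (pbw T w))

/-- The sublattice `q𝓛`. -/
def qlatt {D : ADEData I} (T : I → (Uq D ≃ₐ[𝕂] Uq D)) (w : List I) :
    Submodule (Polynomial ℤ) (Uq D) :=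
  Submodule.span (Polynomial ℤ) ((fun x => qq • x) '' ((latt T w : Submodule (Polynomial ℤ) (Uq D)) : Set (Uq D)))

/-- `bar` is the bar involution: the `ℚ`-algebra involution fixing `E i` and
`F i`, sending `K i` to `K i⁻¹` and `q` to `q⁻¹`. -/
def IsBar (D : ADEData I) (bar : Uq D →+* Uq D) : Prop :=
  (∀ i, bar (EE D i) = EE D i) ∧ (∀ i, bar (FF D i) = FF D i) ∧
  (∀ i, bar (KK D i) = KKinv D i) ∧
  bar (algebraMap 𝕂 (Uq D) qq) = algebraMap 𝕂 (Uq D) qq⁻¹ ∧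
  ∀ x, bar (bar x) = x

/-- `c ∈ ℚ(q)` is a Laurent polynomial in `q`. -/
def IsLaurent (c : 𝕂) : Prop :=
  ∃ (f : Polynomial ℚ) (m : ℕ), c = qq⁻¹ ^ m * Polynomial.aeval qq f

/-- `b` is (an indexing of) the canonical basis: it lies in the lattice `𝓛`,
its residues mod `q𝓛` are the residues of the PBW monomials, and it is
bar-invariant. -/
def IsCanBasis {D : ADEData I} (T : I → (Uq D ≃ₐ[𝕂] Uq D)) (w : List I)
    (bar : Uq D →+* Uq D) (b : (Fin w.length → ℕ) → Uq D) : Prop :=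
  (∀ a, b a ∈ latt T w) ∧ (∀ a, b a - pbw T w a ∈ qlatt T w) ∧ (∀ a, bar (b a) = b a)

/-- The braid move from `w` to `w'` does not change the relative position of the
roots `u` and `v` in the enumerations of positive roots attached to `w`, `w'`. -/
def SameRelPos (D : ADEData I) (w w' : List I) (u v : I → ℤ) : Prop :=
  ∀ (k l : Fin w.length) (k' l' : Fin w'.length),
    beta D w k = u → beta D w l = v → beta D w' k' = u → beta D w' l' = v →
    ((k : ℕ) < (l : ℕ) ↔ (k' : ℕ) < (l' : ℕ))

/-- The subring `ℚ[q]₀ ⊆ ℚ(q)` of rational functions regular at `q = 0`. -/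
def Reg0 : Subring 𝕂 where
  carrier := {x | ∃ f g : Polynomial ℚ, Polynomial.eval 0 g ≠ 0 ∧
    x * algebraMap (Polynomial ℚ) 𝕂 g = algebraMap (Polynomial ℚ) 𝕂 f}
  zero_mem' := ⟨0, 1, by simp, by simp⟩
  one_mem' := ⟨1, 1, by simp, by simp⟩
  add_mem' := by
    rintro x y ⟨f1, g1, h1, e1⟩ ⟨f2, g2, h2, e2⟩
    refine ⟨f1 * g2 + f2 * g1, g1 * g2, by simpa using mul_ne_zero h1 h2, ?_⟩
    rw [map_mul, map_add, map_mul, map_mul, ← e1, ← e2]; ring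
  mul_mem' := by
    rintro x y ⟨f1, g1, h1, e1⟩ ⟨f2, g2, h2, e2⟩
    refine ⟨f1 * f2, g1 * g2, by simpa using mul_ne_zero h1 h2, ?_⟩
    rw [map_mul, map_mul, ← e1, ← e2]; ring
  neg_mem' := by
    rintro x ⟨f, g, h, e⟩
    exact ⟨-f, g, h, by rw [map_neg, ← e]; ring⟩

instance (D : ADEData I) : Module ↥Reg0 (Uq D) :=
  Module.compHom _ (Reg0.subtype)

/-- Iterated application of a family of operators along a word. -/
def applyOps {D : ADEData I} (Ft : I → Uq D → Uq D) : List I → Uq D → Uq D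
  | [], x => x
  | i :: l, x => Ft i (applyOps Ft l x)

/-- Kashiwara's lattice `𝓛(∞)`: the `ℚ[q]₀`-span of all elements obtained from
`1` by applying sequences of the Kashiwara operators. -/
def lattInf {D : ADEData I} (Ft : I → Uq D → Uq D) : Submodule ↥Reg0 (Uq D) :=
  Submodule.span ↥Reg0 {x : Uq D | ∃ l : List I, x = applyOps Ft l 1}

/-- The sublattice `q𝓛(∞)`. -/
def qlattInf {D : ADEData I} (Ft : I → Uq D → Uq D) : Submodule ↥Reg0 (Uq D) :=
  Submodule.span ↥Reg0 ((fun x => qq • x) '' ((lattInf Ft : Submodule ↥Reg0 (Uq D)) : Set (Uq D)))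

end

set_option linter.unusedSectionVars false

namespace CB

variable {I : Type} [Fintype I] [DecidableEq I] (D : ADEData I)

theorem cartan_symm (i j : I) : cartan D i j = cartan D j i := by
  unfold cartan cartanOf
  rw [D.symm i j]
  by_cases h : i = j
  · subst h; simp
  · rw [if_neg h, if_neg (Ne.symm h)]

theorem cartan_self (i : I) : cartan D i i = 2 := by
  simp [cartan, cartanOf]

theorem cartan_adj {i j : I} (h : D.adj i j = true) : cartan D i j = -1 := by
  have : i ≠ j := by rintro rfl; simp [D.irrefl] at h
  simp [cartan, cartanOf, this, h]

theorem cartan_far {i j : I} (h : i ≠ j) (h' : D.adj i j = false) : cartan D i j = 0 := by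
  simp [cartan, cartanOf, h, h']

/-- the symmetric form -/
def frm (u v : I → ℤ) : ℤ := ∑ i, ∑ j, cartan D i j * u i * v j

theorem frm_comm (u v : I → ℤ) : frm D u v = frm D v u := by
  unfold frm
  rw [Finset.sum_comm]
  refine Finset.sum_congr rfl fun i _ => Finset.sum_congr rfl fun j _ => ?_
  rw [cartan_symm D j i]; ring

theorem frm_add_left (u u' v : I → ℤ) : frm D (u + u') v = frm D u v + frm D u' v := by
  simp only [frm, ← Finset.sum_add_distrib, Pi.add_apply]
  refine Finset.sum_congr rfl fun i _ => Finset.sum_congr rfl fun j _ => ?_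
  ring

theorem frm_smul_left (t : ℤ) (u v : I → ℤ) : frm D (t • u) v = t * frm D u v := by
  simp only [frm, Finset.mul_sum, Pi.smul_apply, smul_eq_mul]
  refine Finset.sum_congr rfl fun i _ => Finset.sum_congr rfl fun j _ => ?_
  ring

theorem frm_sub_left (u u' v : I → ℤ) : frm D (u - u') v = frm D u v - frm D u' v := by
  simp only [frm, ← Finset.sum_sub_distrib, Pi.sub_apply]
  refine Finset.sum_congr rfl fun i _ => Finset.sum_congr rfl fun j _ => ?_
  ring

theorem frm_sub_right (u v v' : I → ℤ) : frm D u (v - v') = frm D u v - frm D u v' := by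
  rw [frm_comm, frm_sub_left, frm_comm D v, frm_comm D v']

theorem frm_smul_right (t : ℤ) (u v : I → ℤ) : frm D u (t • v) = t * frm D u v := by
  rw [frm_comm, frm_smul_left, frm_comm]

theorem pairing_eq (v : I → ℤ) (i : I) : pairing D v i = frm D v (simpleRoot i) := by
  simp only [pairing, frm, simpleRoot, mul_ite, mul_one, mul_zero, Finset.sum_ite_eq',
    Finset.mem_univ, if_true]
  refine Finset.sum_congr rfl fun i _ => ?_
  ring

theorem frm_simple (i j : I) : frm D (simpleRoot i) (simpleRoot j) = cartan D i j := by
  rw [← pairing_eq]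
  simp [pairing, simpleRoot]

theorem sref_eq (i : I) (v : I → ℤ) :
    sref D i v = v - frm D v (simpleRoot i) • simpleRoot i := by
  funext j; simp [sref, pairing_eq]

theorem frm_sref (i : I) (u v : I → ℤ) : frm D (sref D i u) (sref D i v) = frm D u v := by
  rw [sref_eq, sref_eq, frm_sub_left, frm_sub_right, frm_sub_right, frm_smul_left,
    frm_smul_right, frm_smul_left, frm_smul_right, frm_simple, cartan_self,
    frm_comm D (simpleRoot i) v]
  ring

theorem sref_sref (i : I) (v : I → ℤ) : sref D i (sref D i v) = v := by
  rw [sref_eq, sref_eq, frm_sub_left, frm_smul_left, frm_simple, cartan_self]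
  funext j; simp; ring

/-- reflection as a linear map -/
def srefL (i : I) : (I → ℤ) →ₗ[ℤ] (I → ℤ) where
  toFun := sref D i
  map_add' u v := by
    simp only [sref_eq, frm_add_left]; funext j; simp; ring
  map_smul' t v := by
    simp only [sref_eq, frm_smul_left]; funext j; simp; ring

/-- action as a linear map -/
def actL : List I → (I → ℤ) →ₗ[ℤ] (I → ℤ)
  | [] => LinearMap.id
  | i :: l => (srefL D i).comp (actL l)

theorem actL_eq (l : List I) (v : I → ℤ) : actL D l v = wordAct D l v := by
  induction l with
  | nil => rfl
  | cons i l ih => simp only [actL, wordAct, LinearMap.comp_apply, ih]; rfl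

theorem wordAct_eq_iff (l l' : List I) : wordAct D l = wordAct D l' ↔ actL D l = actL D l' := by
  constructor
  · intro h; apply LinearMap.ext; intro v; rw [actL_eq, actL_eq, h]
  · intro h; funext v; rw [← actL_eq, ← actL_eq, h]

theorem actL_cons (i : I) (l : List I) (v : I → ℤ) : actL D (i :: l) v = sref D i (actL D l v) := rfl

theorem actL_append (l l' : List I) : actL D (l ++ l') = (actL D l).comp (actL D l') := by
  induction l with
  | nil => rfl
  | cons i l ih => simp only [List.cons_append, actL, ih]; rfl

theorem actL_reverse (l : List I) : (actL D l.reverse).comp (actL D l) = LinearMap.id := by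
  induction l with
  | nil => rfl
  | cons i l ih =>
    rw [List.reverse_cons, actL_append]
    apply LinearMap.ext; intro v
    have := LinearMap.congr_fun ih v
    simp only [LinearMap.comp_apply, actL, srefL, LinearMap.coe_mk, AddHom.coe_mk, LinearMap.id_apply,
      sref_sref] at *
    exact this

theorem actL_reverse' (l : List I) : (actL D l).comp (actL D l.reverse) = LinearMap.id := by
  have := actL_reverse D l.reverse
  rwa [List.reverse_reverse] at this

theorem frm_actL (l : List I) (u v : I → ℤ) : frm D (actL D l u) (actL D l v) = frm D u v := by
  induction l with
  | nil => rfl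
  | cons i l ih => rw [actL_cons, actL_cons, frm_sref, ih]

theorem frm_pos {v : I → ℤ} (hv : v ≠ 0) : 0 < frm D v v := by
  have h := D.posdef (fun i => (v i : ℚ)) (by
    intro h; apply hv; funext i; have := congrFun h i; simpa using this)
  have e : ((frm D v v : ℤ) : ℚ) = ∑ i, ∑ j, (cartanOf D.adj i j : ℚ) * v i * v j := by
    simp [frm, cartan]
  rw [← e] at h
  exact_mod_cast h

theorem frm_even (v : I → ℤ) : (2 : ℤ) ∣ frm D v v := by
  suffices key : ((frm D v v : ℤ) : ZMod 2) = 0 from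
    (ZMod.intCast_zmod_eq_zero_iff_dvd (frm D v v) 2).1 key
  unfold frm
  rw [← Finset.sum_product', Int.cast_sum]
  refine Finset.sum_involution (fun p _ => p.swap) ?_ ?_ ?_ ?_
  · rintro ⟨i, j⟩ -
    simp only [Prod.swap, cartan_symm D j i]
    have : ∀ x : ZMod 2, x + x = 0 := by decide
    rw [show cartan D i j * v j * v i = cartan D i j * v i * v j by ring]
    exact this _
  · rintro ⟨i, j⟩ - h e
    simp only [Prod.swap, Prod.mk.injEq] at e
    obtain ⟨rfl, -⟩ := e
    apply h
    simp only [cartan_self]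
    rw [ZMod.intCast_zmod_eq_zero_iff_dvd]
    exact ⟨v j * v j, by push_cast; ring⟩
  · simp
  · simp

theorem frm_ge {v : I → ℤ} (hv : v ≠ 0) : 2 ≤ frm D v v := by
  have h1 := frm_pos D hv
  obtain ⟨k, hk⟩ := frm_even D v
  omega

theorem sign_coh {v : I → ℤ} (hv : frm D v v = 2) : 0 ≤ v ∨ v ≤ 0 := by
  by_contra hcon
  push Not at hcon
  obtain ⟨h1, h2⟩ := hcon
  set p : I → ℤ := fun i => max (v i) 0
  set m : I → ℤ := fun i => max (-v i) 0
  have hvpm : v = p - m := by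
    funext i; simp only [p, m, Pi.sub_apply]; omega
  have hp : p ≠ 0 := by
    intro h; apply h2; intro i
    have := congrFun h i
    simp only [p, Pi.zero_apply] at *; omega
  have hm : m ≠ 0 := by
    intro h; apply h1; intro i
    have := congrFun h i
    simp only [m, Pi.zero_apply] at *; omega
  have hpm : frm D p m ≤ 0 := by
    unfold frm
    refine Finset.sum_nonpos fun i _ => Finset.sum_nonpos fun j _ => ?_
    have hpi : 0 ≤ p i := le_max_right _ _
    have hmj : 0 ≤ m j := le_max_right _ _
    by_cases hij : i = j
    · subst hij
      have : p i * m i = 0 := by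
        simp only [p, m]
        rcases le_total (v i) 0 with h | h
        · rw [max_eq_right h]; simp
        · rw [max_eq_right (a := -v i) (by omega)]; simp
      rw [mul_assoc, this]; simp
    · have hc : cartan D i j ≤ 0 := by
        simp only [cartan, cartanOf, if_neg hij]; split <;> omega
      rw [mul_assoc]
      exact mul_nonpos_of_nonpos_of_nonneg hc (mul_nonneg hpi hmj)
  have e : frm D v v = frm D p p + frm D m m - 2 * frm D p m := by
    rw [hvpm, frm_sub_left, frm_sub_right, frm_sub_right, frm_comm D m p]; ring
  have := frm_ge D hp
  have := frm_ge D hm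
  omega

theorem simple_nonneg (k : I) : 0 ≤ (simpleRoot k : I → ℤ) := by
  intro j; simp only [simpleRoot]; split <;> simp

theorem simple_ne (k : I) : (simpleRoot k : I → ℤ) ≠ 0 := by
  intro h; have := congrFun h k; simp [simpleRoot] at this

theorem root_frm (l : List I) (k : I) :
    frm D (actL D l (simpleRoot k)) (actL D l (simpleRoot k)) = 2 := by
  rw [frm_actL, frm_simple, cartan_self]

theorem root_ne (l : List I) (k : I) : actL D l (simpleRoot k) ≠ 0 := by
  intro h
  have := root_frm D l k
  rw [h] at this
  simp [frm] at this

theorem root_sign (l : List I) (k : I) :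
    0 ≤ actL D l (simpleRoot k) ∨ actL D l (simpleRoot k) ≤ 0 := sign_coh D (root_frm D l k)

theorem root_not_both {l : List I} {k : I} (h : 0 ≤ actL D l (simpleRoot k))
    (h' : actL D l (simpleRoot k) ≤ 0) : False := root_ne D l k (le_antisymm h' h)

theorem sref_neg {v : I → ℤ} (hv : frm D v v = 2) (h0 : 0 ≤ v) {m : I} (h : sref D m v ≤ 0) :
    v = simpleRoot m := by
  have hj : ∀ j, j ≠ m → v j = 0 := by
    intro j hj
    have := h j
    simp only [sref, simpleRoot, if_neg hj, mul_zero, sub_zero, Pi.zero_apply] at this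
    exact le_antisymm this (h0 j)
  have e : v = v m • simpleRoot m := by
    funext j
    by_cases h : j = m
    · subst h; simp [simpleRoot]
    · simp [simpleRoot, h, hj j h]
  have h2 : v m * (v m * 2) = 2 := by
    rw [e, frm_smul_left, frm_smul_right, frm_simple, cartan_self] at hv
    exact hv
  have h3 : v m = 1 := by
    have := h0 m
    simp only [Pi.zero_apply] at this
    nlinarith
  rw [e, h3, one_smul]

theorem conj_refl {l : List I} {k m : I} (h : actL D l (simpleRoot k) = simpleRoot m) :
    actL D (m :: l) = actL D (l ++ [k]) := by
  rw [actL_append]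
  apply LinearMap.ext; intro v
  rw [actL_cons, LinearMap.comp_apply, actL_cons, sref_eq, ← h, frm_actL, sref_eq, map_sub, map_smul]
  rfl

theorem exch {l : List I} {k : I} (h : actL D l (simpleRoot k) ≤ 0) :
    ∃ l', l'.length + 1 = l.length ∧ actL D (l' ++ [k]) = actL D l := by
  induction l with
  | nil =>
    exact (root_not_both D (l := []) (k := k) (simple_nonneg k) h).elim
  | cons m l ih =>
    rcases root_sign D l k with h1 | h1
    · have h2 := sref_neg D (root_frm D l k) h1 (m := m) h
      exact ⟨l, rfl, (conj_refl D h2).symm⟩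
    · obtain ⟨l', h2, h3⟩ := ih h1
      refine ⟨m :: l', by simp [h2], ?_⟩
      rw [List.cons_append]
      simp only [actL, h3]

theorem actL_snoc_snoc (l : List I) (k : I) : actL D (l ++ [k] ++ [k]) = actL D l := by
  rw [actL_append, actL_append]
  apply LinearMap.ext; intro v
  simp only [LinearMap.comp_apply, actL, LinearMap.id_apply, srefL, LinearMap.coe_mk, AddHom.coe_mk,
    sref_sref]

theorem actL_snoc_simple (l : List I) (k : I) :
    actL D (l ++ [k]) (simpleRoot k) = - actL D l (simpleRoot k) := by
  rw [actL_append, LinearMap.comp_apply, actL_cons, ← map_neg]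
  congr 1
  simp only [actL, LinearMap.id_apply]
  rw [sref_eq, frm_simple, cartan_self]
  funext j; simp; ring

/-- reduced in terms of `actL` -/
def Red (l : List I) : Prop := ∀ l', actL D l' = actL D l → l.length ≤ l'.length

theorem red_iff (l : List I) : IsReducedWord D l ↔ Red D l := by
  unfold IsReducedWord Red
  simp only [wordAct_eq_iff]

theorem Red.prefix {l l' : List I} (h : Red D (l ++ l')) : Red D l := by
  intro m hm
  have := h (m ++ l') (by rw [actL_append, actL_append, hm])
  simpa using this

theorem Red.suffix {l l' : List I} (h : Red D (l ++ l')) : Red D l' := by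
  intro m hm
  have := h (l ++ m) (by rw [actL_append, actL_append, hm])
  simpa using this

theorem red_congr {l l' : List I} (h : Red D l) (e : actL D l' = actL D l)
    (hl : l'.length = l.length) : Red D l' := by
  intro m hm; rw [hl]; exact h m (hm.trans e)

theorem actL_rev_congr {l l' : List I} (h : actL D l = actL D l') :
    actL D l.reverse = actL D l'.reverse := by
  calc actL D l.reverse = (actL D l.reverse).comp ((actL D l').comp (actL D l'.reverse)) := by
        rw [actL_reverse', LinearMap.comp_id]
    _ = actL D l'.reverse := by
        rw [← h, ← LinearMap.comp_assoc, actL_reverse, LinearMap.id_comp]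

theorem Red.reverse {l : List I} (h : Red D l) : Red D l.reverse := by
  intro m hm
  have := h m.reverse (by rw [actL_rev_congr D hm, List.reverse_reverse])
  simpa using this

theorem red_snoc_pos {l : List I} {k : I} (h : Red D (l ++ [k])) : 0 ≤ actL D l (simpleRoot k) := by
  rcases root_sign D l k with h1 | h1
  · exact h1
  · obtain ⟨l', h2, h3⟩ := exch D h1
    have := h l' (by rw [actL_append D l, ← h3, ← actL_append, actL_snoc_snoc])
    simp at this; omega

theorem red_snoc {l : List I} {k : I} (h : Red D l) (hp : 0 ≤ actL D l (simpleRoot k)) :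
    Red D (l ++ [k]) := by
  intro l' hl'
  by_contra hlt
  have hn : actL D l' (simpleRoot k) ≤ 0 := by
    rw [hl', actL_snoc_simple]; simpa using hp
  obtain ⟨l'', h2, h3⟩ := exch D hn
  have := h l'' (by
    rw [← actL_snoc_snoc D l'' k, actL_append, h3, hl', ← actL_append, actL_snoc_snoc])
  simp at hlt; omega

/-- reduced expression of the longest element -/
def RedM (w : List I) : Prop := Red D w ∧ ∀ w', Red D w' → w'.length ≤ w.length

theorem redM_iff (w : List I) : IsRedW0 D w ↔ RedM D w := by
  unfold IsRedW0 RedM; simp only [red_iff]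

theorem RedM.reverse {w : List I} (h : RedM D w) : RedM D w.reverse :=
  ⟨h.1.reverse, fun w' hw' => by rw [List.length_reverse]; exact h.2 w' hw'⟩

theorem redM_congr {l l' : List I} (h : RedM D l) (e : actL D l' = actL D l)
    (hl : l'.length = l.length) : RedM D l' :=
  ⟨red_congr D h.1 e hl, fun w' hw' => by rw [hl]; exact h.2 w' hw'⟩

theorem RedM.neg {w : List I} (h : RedM D w) (k : I) : actL D w (simpleRoot k) ≤ 0 := by
  rcases root_sign D w k with h1 | h1
  · have := h.2 _ (red_snoc D h.1 h1)
    simp at this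
  · exact h1

theorem vec_expand (v : I → ℤ) : v = ∑ k, v k • (simpleRoot k : I → ℤ) := by
  funext j; simp [simpleRoot]

theorem act_expand (l : List I) (v : I → ℤ) : actL D l v = ∑ k, v k • actL D l (simpleRoot k) := by
  conv_lhs => rw [vec_expand v]
  rw [map_sum]
  exact Finset.sum_congr rfl fun k _ => map_smul _ _ _

theorem act_neg_of {l : List I} (h : ∀ k, actL D l (simpleRoot k) ≤ 0) {v : I → ℤ} (hv : 0 ≤ v) :
    actL D l v ≤ 0 := by
  rw [act_expand]
  refine Finset.sum_nonpos fun k _ => ?_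
  intro j
  have h1 := h k j
  have h2 := hv k
  simp only [Pi.zero_apply, Pi.smul_apply, smul_eq_mul] at *
  exact mul_nonpos_of_nonneg_of_nonpos h2 h1

theorem redM_rotate {i : I} {l : List I} (h : RedM D (i :: l)) :
    ∃ k, actL D l (simpleRoot k) = simpleRoot i ∧ RedM D (l ++ [k]) := by
  have hl : Red D l := Red.suffix D (l := [i]) h.1
  have hk : ∃ k, ¬ actL D l (simpleRoot k) ≤ 0 := by
    by_contra hc
    push Not at hc
    have hb : 0 ≤ actL D l.reverse (simpleRoot i) := by
      apply red_snoc_pos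
      have := h.1.reverse
      simpa using this
    have h1 := act_neg_of D hc hb
    have h2 := LinearMap.congr_fun (actL_reverse' D l) (simpleRoot i)
    rw [LinearMap.comp_apply, LinearMap.id_apply] at h2
    rw [h2] at h1
    exact simple_ne i (le_antisymm h1 (simple_nonneg i))
  obtain ⟨k, hk⟩ := hk
  have hp : 0 ≤ actL D l (simpleRoot k) := (root_sign D l k).resolve_right hk
  refine ⟨k, sref_neg D (root_frm D l k) hp (h.neg D k), red_snoc D hl hp, fun w' hw' => ?_⟩
  have := h.2 w' hw'
  simpa using this

theorem exists_red (l : List I) : ∃ t, Red D t ∧ actL D t = actL D l := by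
  classical
  have hex : ∃ n, ∃ t : List I, t.length = n ∧ actL D t = actL D l := ⟨_, l, rfl, rfl⟩
  obtain ⟨t, h1, h2⟩ := Nat.find_spec hex
  refine ⟨t, fun t' ht' => ?_, h2⟩
  rw [h1]
  exact Nat.find_min' hex ⟨t', rfl, ht'.trans h2⟩

theorem redM_unique {w w' : List I} (h : RedM D w) (h' : RedM D w') : actL D w = actL D w' := by
  obtain ⟨t, ht, e⟩ := exists_red D (w.reverse ++ w')
  have hpos : ∀ k, 0 ≤ actL D t (simpleRoot k) := by
    intro k
    rw [e, actL_append, LinearMap.comp_apply]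
    have h1 : 0 ≤ - actL D w' (simpleRoot k) := by simpa using h'.neg D k
    have := act_neg_of D (h.reverse D |>.neg D) h1
    simpa using this
  rcases List.eq_nil_or_concat t with rfl | ⟨t', k, rfl⟩
  · have e' : LinearMap.id = (actL D w.reverse).comp (actL D w') := by rw [← actL_append, ← e]; rfl
    calc actL D w = (actL D w).comp ((actL D w.reverse).comp (actL D w')) := by
          rw [← e', LinearMap.comp_id]
      _ = _ := by rw [← LinearMap.comp_assoc, actL_reverse', LinearMap.id_comp]
  · exfalso
    have h1 := hpos k
    rw [List.concat_eq_append] at h1 ht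
    rw [actL_snoc_simple] at h1
    exact root_not_both D (red_snoc_pos D ht) (by simpa using h1)

theorem redM_start {w : List I} (h : RedM D w) (i : I) : ∃ l, RedM D (i :: l) := by
  obtain ⟨l', h1, h2⟩ := exch D ((h.reverse D).neg D i)
  have := redM_congr D (h.reverse D) h2 (by simpa using h1)
  refine ⟨l'.reverse, ?_⟩
  simpa using this.reverse D

theorem exch_red {l : List I} {k : I} (hl : Red D l) (h : actL D l (simpleRoot k) ≤ 0) :
    ∃ l', l'.length + 1 = l.length ∧ actL D (l' ++ [k]) = actL D l ∧ Red D (l' ++ [k]) := by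
  obtain ⟨l', h1, h2⟩ := exch D h
  exact ⟨l', h1, h2, red_congr D hl h2 (by simpa using h1)⟩

theorem BraidMove.symm {w w' : List I} (h : BraidMove D w w') : BraidMove D w' w := by
  rcases h with ⟨w1, w2, a, b, h1, h2, h3, h4⟩ | ⟨w1, w2, a, b, h2, h3, h4⟩
  · exact Or.inl ⟨w1, w2, b, a, h1.symm, by rw [D.symm, h2], h4, h3⟩
  · exact Or.inr ⟨w1, w2, b, a, by rw [D.symm, h2], h4, h3⟩

theorem BraidMove.append {w w' : List I} (h : BraidMove D w w') (v : List I) :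
    BraidMove D (w ++ v) (w' ++ v) := by
  rcases h with ⟨w1, w2, a, b, h1, h2, rfl, rfl⟩ | ⟨w1, w2, a, b, h2, rfl, rfl⟩
  · exact Or.inl ⟨w1, w2 ++ v, a, b, h1, h2, by simp, by simp⟩
  · exact Or.inr ⟨w1, w2 ++ v, a, b, h2, by simp, by simp⟩

theorem braids_append {w w' : List I} (h : Relation.ReflTransGen (BraidMove D) w w') (v : List I) :
    Relation.ReflTransGen (BraidMove D) (w ++ v) (w' ++ v) := by
  induction h with
  | refl => exact Relation.ReflTransGen.refl
  | tail _ h ih => exact ih.tail (BraidMove.append D h v)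

theorem actL_inj_snoc {u v : List I} {k : I} (h : actL D (u ++ [k]) = actL D (v ++ [k])) :
    actL D u = actL D v := by
  rw [← actL_snoc_snoc D u k, actL_append, h, ← actL_append, actL_snoc_snoc]

theorem actL_far (t : List I) {j k : I} (hjk : j ≠ k) (h : D.adj j k = false) :
    actL D (t ++ [k, j]) = actL D (t ++ [j, k]) := by
  rw [actL_append, actL_append]
  congr 1
  apply LinearMap.ext; intro v
  simp only [actL_cons]
  simp only [actL, LinearMap.id_apply]
  simp only [sref_eq, frm_sub_left, frm_smul_left, frm_simple, cartan_far D hjk h,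
    cartan_symm D k j]
  funext x; simp; ring

theorem actL_adj (t : List I) {j k : I} (h : D.adj j k = true) :
    actL D (t ++ [j, k, j]) = actL D (t ++ [k, j, k]) := by
  rw [actL_append, actL_append]
  congr 1
  apply LinearMap.ext; intro v
  simp only [actL_cons]
  simp only [actL, LinearMap.id_apply]
  simp only [sref_eq, frm_sub_left, frm_smul_left, frm_simple, cartan_adj D h,
    cartan_symm D k j, cartan_self]
  funext x; simp; ring

theorem sref_far {j k : I} (hjk : j ≠ k) (h : D.adj j k = false) :
    sref D j (simpleRoot k) = simpleRoot k := by
  rw [sref_eq, frm_simple, cartan_symm, cartan_far D hjk h]; simp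

theorem sref_adj {j k : I} (h : D.adj j k = true) :
    sref D j (simpleRoot k) = simpleRoot j + simpleRoot k := by
  rw [sref_eq, frm_simple, cartan_symm, cartan_adj D h]; funext x; simp; ring

theorem actL_snoc (u : List I) (j : I) (v : I → ℤ) :
    actL D (u ++ [j]) v = actL D u (sref D j v) := by
  rw [actL_append, LinearMap.comp_apply]; rfl

theorem matsumoto (n : ℕ) : ∀ w w' : List I, w.length = n → Red D w → Red D w' →
    actL D w = actL D w' → Relation.ReflTransGen (BraidMove D) w w' := by
  induction n with
  | zero =>
    intro w w' hn hw hw' e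
    have h1 := hw' w e
    have : w = [] := List.length_eq_zero_iff.1 hn
    have : w' = [] := List.length_eq_zero_iff.1 (by omega)
    subst_vars; exact Relation.ReflTransGen.refl
  | succ n IH =>
    intro w w' hn hw hw' e
    have hlen : w'.length = n + 1 := by
      have h1 := hw' w e
      have h2 := hw w' e.symm
      omega
    rcases List.eq_nil_or_concat w with rfl | ⟨u, j, rfl⟩
    · simp at hn
    rcases List.eq_nil_or_concat w' with rfl | ⟨v, k, rfl⟩
    · simp at hlen
    rw [List.concat_eq_append] at *
    rw [List.concat_eq_append] at *
    have hu : u.length = n := by simpa using hn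
    have hv : v.length = n := by simpa using hlen
    have hru := hw.prefix D
    have hrv := hw'.prefix D
    by_cases hjk : j = k
    · subst hjk
      exact braids_append D (IH u v hu hru hrv (actL_inj_snoc D e)) [j]
    have xk : actL D (u ++ [j]) (simpleRoot k) ≤ 0 := by
      rw [e, actL_snoc_simple]; simpa using red_snoc_pos D hw'
    have xj : actL D (u ++ [j]) (simpleRoot j) ≤ 0 := by
      rw [actL_snoc_simple]; simpa using red_snoc_pos D hw
    rcases hadj : D.adj j k with _ | _
    · have h1 : actL D u (simpleRoot k) ≤ 0 := by
        rw [actL_snoc, sref_far D hjk hadj] at xk; exact xk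
      obtain ⟨t, ht1, ht2, ht3⟩ := exch_red D hru h1
      have a1 : Relation.ReflTransGen (BraidMove D) (u ++ [j]) (t ++ [k] ++ [j]) :=
        braids_append D (IH u _ hu hru ht3 ht2.symm) [j]
      have a2 : BraidMove D (t ++ [k] ++ [j]) (t ++ [j] ++ [k]) :=
        Or.inl ⟨t, [], k, j, Ne.symm hjk, by rw [D.symm, hadj], by simp, by simp⟩
      have e2 : actL D (t ++ [j] ++ [k]) = actL D (v ++ [k]) := by
        rw [← e, List.append_assoc, actL_append D u, ← ht2, ← actL_append, List.append_assoc]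
        exact (actL_far D t hjk hadj).symm
      have r2 : Red D (t ++ [j] ++ [k]) := red_congr D hw' e2 (by simp; omega)
      have a3 : Relation.ReflTransGen (BraidMove D) (t ++ [j] ++ [k]) (v ++ [k]) :=
        braids_append D (IH _ v (by simp; omega) (r2.prefix D) hrv (actL_inj_snoc D e2)) [k]
      exact (a1.tail a2).trans a3
    · have h1 : actL D u (simpleRoot k) ≤ 0 := by
        have : actL D u (simpleRoot k) =
            actL D (u ++ [j]) (simpleRoot j) + actL D (u ++ [j]) (simpleRoot k) := by
          rw [← map_add, actL_snoc, ← sref_adj D hadj, sref_sref]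
        rw [this]; exact add_nonpos xj xk
      obtain ⟨t1, ht1, ht2, ht3⟩ := exch_red D hru h1
      have h2 : actL D t1 (simpleRoot j) ≤ 0 := by
        have hkj : D.adj k j = true := by rw [D.symm, hadj]
        have : actL D t1 (simpleRoot j) = actL D (u ++ [j]) (simpleRoot k) := by
          rw [actL_snoc, ← ht2, actL_snoc, sref_adj D hadj, add_comm, ← sref_adj D hkj, sref_sref]
        rw [this]; exact xk
      obtain ⟨t, hs1, hs2, hs3⟩ := exch_red D (ht3.prefix D) h2
      have e1 : actL D (t ++ [j] ++ [k]) = actL D u := by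
        rw [actL_append, hs2, ← actL_append, ht2]
      have r1 : Red D (t ++ [j] ++ [k]) := red_congr D hru e1 (by simp; omega)
      have a1 : Relation.ReflTransGen (BraidMove D) (u ++ [j]) (t ++ [j] ++ [k] ++ [j]) :=
        braids_append D (IH u _ hu hru r1 e1.symm) [j]
      have a2 : BraidMove D (t ++ [j] ++ [k] ++ [j]) (t ++ [k] ++ [j] ++ [k]) :=
        Or.inr ⟨t, [], j, k, hadj, by simp, by simp⟩
      have e2 : actL D (t ++ [k] ++ [j] ++ [k]) = actL D (v ++ [k]) := by
        rw [← e, actL_append D u, ← e1, ← actL_append]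
        have := actL_adj D t hadj
        simpa using this.symm
      have r2 : Red D (t ++ [k] ++ [j] ++ [k]) := red_congr D hw' e2 (by simp; omega)
      have a3 : Relation.ReflTransGen (BraidMove D) (t ++ [k] ++ [j] ++ [k]) (v ++ [k]) :=
        braids_append D (IH _ v (by simp; omega) (r2.prefix D) hrv (actL_inj_snoc D e2)) [k]
      exact (a1.tail a2).trans a3

end CB

namespace CB

theorem qq_ne : qq ≠ 0 := RatFunc.X_ne_zero

theorem qq_pow_ne {n : ℕ} (hn : n ≠ 0) : qq ^ n ≠ 1 := by
  intro h
  have h1 : (algebraMap (Polynomial ℚ) 𝕂) (Polynomial.X ^ n) = algebraMap (Polynomial ℚ) 𝕂 1 := by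
    rw [map_pow, RatFunc.algebraMap_X, map_one]; exact h
  have h2 := RatFunc.algebraMap_injective ℚ h1
  have h3 := congrArg Polynomial.natDegree h2
  simp at h3
  exact hn h3

theorem qq_zpow_inj {m n : ℤ} (h : qq ^ m = qq ^ n) : m = n := by
  wlog hmn : m ≤ n generalizing m n
  · exact (this h.symm (by omega)).symm
  by_contra hne
  obtain ⟨k, rfl⟩ : ∃ k : ℕ, n = m + k := ⟨(n - m).toNat, by omega⟩
  rw [zpow_add₀ qq_ne, zpow_natCast] at h
  have hk : k ≠ 0 := by rintro rfl; simp at hne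
  apply qq_pow_ne hk
  have := zpow_ne_zero m qq_ne
  field_simp at h
  exact h.symm

theorem qdiff_ne : qq - qq⁻¹ ≠ 0 := by
  intro h
  have := qq_zpow_inj (m := 1) (n := -1) (by simpa [sub_eq_zero] using h)
  omega

/-- quantum integer with integer argument -/
noncomputable def qI (n : ℤ) : 𝕂 := (qq ^ n - qq ^ (-n)) / (qq - qq⁻¹)

theorem qI_zero : qI 0 = 0 := by simp [qI]

theorem qI_ne {n : ℤ} (hn : n ≠ 0) : qI n ≠ 0 := by
  refine div_ne_zero (fun h => hn ?_) qdiff_ne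
  have := qq_zpow_inj (sub_eq_zero.1 h)
  omega

theorem qI_add (x y : ℤ) : qI (x + y) = qq ^ y * qI x + qq ^ (-x) * qI y := by
  unfold qI
  have := qq_ne
  rw [mul_div_assoc', mul_div_assoc', ← add_div]
  congr 1
  rw [mul_sub, mul_sub, ← zpow_add₀ this, ← zpow_add₀ this, ← zpow_add₀ this, ← zpow_add₀ this]
  ring_nf

theorem qI_one : qI 1 = 1 := by
  have := qdiff_ne
  simp only [qI, zpow_one, zpow_neg]
  exact div_self this

theorem qInt_eq (n : ℕ) : qInt n = qI n := by
  have key : ∀ m : ℕ, ∀ s : ℤ, (∑ t ∈ Finset.range m, qq ^ (s - 2 * (t : ℤ))) * (qq - qq⁻¹)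
      = qq ^ (s + 1) - qq ^ (s + 1 - 2 * (m : ℤ)) := by
    intro m s
    induction m with
    | zero => simp
    | succ m ih =>
      rw [Finset.sum_range_succ, add_mul, ih, mul_sub]
      have h1 : qq ^ (s - 2 * (m : ℤ)) * qq = qq ^ (s + 1 - 2 * (m : ℤ)) := by
        rw [← zpow_add_one₀ qq_ne]; congr 1; ring
      have h2 : qq ^ (s - 2 * (m : ℤ)) * qq⁻¹ = qq ^ (s + 1 - 2 * ((m + 1 : ℕ) : ℤ)) := by
        rw [← zpow_sub_one₀ qq_ne]; congr 1; push_cast; ring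
      rw [h1, h2]; ring
  unfold qI
  rw [eq_div_iff qdiff_ne, qInt, key]
  congr 2 <;> ring_nf

theorem qFact_succ (n : ℕ) : qFact (n + 1) = qFact n * qI (n + 1 : ℤ) := by
  unfold qFact
  rw [Finset.prod_range_succ, qInt_eq]; push_cast; rfl

theorem qFact_zero : qFact 0 = 1 := rfl

theorem qFact_ne (n : ℕ) : qFact n ≠ 0 := by
  induction n with
  | zero => rw [qFact_zero]; exact one_ne_zero
  | succ n ih => rw [qFact_succ]; exact mul_ne_zero ih (qI_ne (by omega))

/-- the subring `ℤ[q]` -/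
noncomputable def OO : Subring 𝕂 := (Polynomial.aeval qq : Polynomial ℤ →ₐ[ℤ] 𝕂).toRingHom.range

theorem qq_mem : qq ∈ OO := ⟨Polynomial.X, by simp⟩

theorem qq_zpow_mem {n : ℤ} (hn : 0 ≤ n) : qq ^ n ∈ OO := by
  obtain ⟨k, rfl⟩ := Int.eq_ofNat_of_zero_le hn
  rw [zpow_natCast]
  exact OO.pow_mem qq_mem k

/-- normalized Gaussian binomial -/
noncomputable def gb (a m : ℕ) : 𝕂 := qq ^ (a * m) * (qFact (a + m) / (qFact a * qFact m))

theorem gb_zero_right (a : ℕ) : gb a 0 = 1 := by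
  have := qFact_ne a
  simp [gb, qFact_zero, this]

theorem gb_zero_left (a : ℕ) : gb 0 a = 1 := by
  have := qFact_ne a
  simp [gb, qFact_zero, this]

theorem gb_rec (x y : ℕ) : gb (x + 1) (y + 1) = qq ^ (2 * (y + 1)) * gb x (y + 1) + gb (x + 1) y := by
  unfold gb
  have h1 := qFact_ne x
  have h2 := qFact_ne y
  have h3 : qI (x + 1 : ℤ) ≠ 0 := qI_ne (by omega)
  have h4 : qI (y + 1 : ℤ) ≠ 0 := qI_ne (by omega)
  have h5 := qq_ne
  have e := qI_add (x + 1) (y + 1)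
  rw [show x + 1 + (y + 1) = (x + y + 1) + 1 by ring, qFact_succ (x + y + 1),
    show x + (y + 1) = x + y + 1 by ring, show x + 1 + y = x + y + 1 by ring,
    qFact_succ x, qFact_succ y,
    show (((x + y + 1 : ℕ) : ℤ) + 1) = (x + 1) + (y + 1) by push_cast; ring, e]
  rw [show (-((x : ℤ) + 1)) = -((x + 1 : ℕ) : ℤ) by push_cast; ring,
    show ((y : ℤ) + 1) = ((y + 1 : ℕ) : ℤ) by push_cast; ring, zpow_natCast, zpow_neg, zpow_natCast]
  push_cast
  have h6 : qq ^ (x + 1) ≠ 0 := pow_ne_zero _ h5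
  field_simp
  ring

theorem gb_mem (a m : ℕ) : gb a m ∈ OO := by
  induction a generalizing m with
  | zero => rw [gb_zero_left]; exact OO.one_mem
  | succ a iha =>
    induction m with
    | zero => rw [gb_zero_right]; exact OO.one_mem
    | succ m ihm =>
      rw [gb_rec]
      exact OO.add_mem (OO.mul_mem (OO.pow_mem qq_mem _) (iha _)) ihm

section alg
variable {A : Type*} [Ring A] [Algebra 𝕂 A]

/-- divided power -/
noncomputable def dn (x : A) (n : ℕ) : A := (qFact n)⁻¹ • x ^ n

/-- divided power with integer exponent -/
noncomputable def dz (x : A) (n : ℤ) : A := if 0 ≤ n then dn x n.toNat else 0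

theorem dz_nat (x : A) (n : ℕ) : dz x (n : ℤ) = dn x n := by simp [dz]

theorem dn_zero (x : A) : dn x 0 = 1 := by simp [dn, qFact_zero]

theorem dn_succ (x : A) (n : ℕ) : x * dn x n = qI (n + 1 : ℤ) • dn x (n + 1) := by
  have h1 := qFact_ne n
  have h3 : qI (n + 1 : ℤ) ≠ 0 := qI_ne (by omega)
  unfold dn
  rw [qFact_succ, mul_smul_comm, smul_smul, pow_succ']
  congr 1
  field_simp

theorem dn_mul (x : A) (a m : ℕ) :
    dn x a * dn x m = (qFact (a + m) / (qFact a * qFact m)) • dn x (a + m) := by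
  have h1 := qFact_ne a
  have h2 := qFact_ne m
  have h3 := qFact_ne (a + m)
  unfold dn
  rw [smul_mul_smul_comm, smul_smul, ← pow_add]
  congr 1
  field_simp

theorem dz_succ (x : A) (n : ℤ) : x * dz x n = qI (n + 1) • dz x (n + 1) := by
  rcases lt_trichotomy n (-1) with h | rfl | h
  · rw [dz, dz, if_neg (by omega), if_neg (by omega)]; simp
  · simp [dz, qI_zero]
  · obtain ⟨k, rfl⟩ := Int.eq_ofNat_of_zero_le (show 0 ≤ n by omega)
    have := dn_succ x k
    rw [dz_nat, this, show (k : ℤ) + 1 = ((k + 1 : ℕ) : ℤ) by push_cast; ring, dz_nat]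

variable {f1 f2 g : A}

theorem comm_dn {x y : A} {s : ℤ} (h : y * x = qq ^ s • (x * y)) (n : ℕ) :
    y * dn x n = qq ^ (s * n) • (dn x n * y) := by
  have key : y * x ^ n = qq ^ (s * n) • (x ^ n * y) := by
    induction n with
    | zero => simp
    | succ n ih =>
      rw [pow_succ, ← mul_assoc, ih, smul_mul_assoc, mul_assoc, h, mul_smul_comm, smul_smul,
        ← zpow_add₀ qq_ne, mul_assoc]
      congr 2; push_cast; ring
  unfold dn
  rw [mul_smul_comm, key, smul_mul_assoc, smul_comm]

theorem comm_dz {x y : A} {s : ℤ} (h : y * x = qq ^ s • (x * y)) (n : ℤ) :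
    y * dz x n = qq ^ (s * n) • (dz x n * y) := by
  unfold dz
  split
  · rename_i h0
    rw [comm_dn h]; congr 3; omega
  · simp

theorem f2_dn (hg : f2 * f1 = qq • (f1 * f2) + g) (h1 : g * f1 = qq⁻¹ • (f1 * g)) (n : ℕ) :
    f2 * f1 ^ (n + 1) = qq ^ (n + 1 : ℤ) • (f1 ^ (n + 1) * f2) + qI (n + 1 : ℤ) • (f1 ^ n * g) := by
  induction n with
  | zero => simp [hg, qI_one]
  | succ n ih =>
    have hc : g * f1 = qq ^ (-1 : ℤ) • (f1 * g) := by simpa using h1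
    have e := qI_add (n + 1) 1
    rw [qI_one, mul_one, zpow_one] at e
    rw [pow_succ, ← mul_assoc, ih, add_mul, smul_mul_assoc, smul_mul_assoc, mul_assoc, hg,
      mul_assoc _ g, h1, mul_add, mul_smul_comm, mul_smul_comm, ← mul_assoc, ← mul_assoc, ← pow_succ,
      ← pow_succ, smul_add, smul_smul, smul_smul, add_assoc, ← add_smul]
    congr 2
    · push_cast; rw [e]
      have : qq ^ (n + 1 : ℤ) - qI (n + 1 : ℤ) * qq + qI (n + 1 : ℤ) * qq⁻¹ = qq ^ (-(n + 1 : ℤ)) := by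
        have h4 : qI (n + 1 : ℤ) * (qq - qq⁻¹) = qq ^ (n + 1 : ℤ) - qq ^ (-(n + 1 : ℤ)) := by
          unfold qI; exact div_mul_cancel₀ _ qdiff_ne
        linear_combination -h4
      rw [← this]; ring

theorem f2_dz (hg : f2 * f1 = qq • (f1 * f2) + g) (h1 : g * f1 = qq⁻¹ • (f1 * g)) (c : ℤ) :
    f2 * dz f1 c = qq ^ c • (dz f1 c * f2) + dz f1 (c - 1) * g := by
  rcases lt_trichotomy c 0 with h | rfl | h
  · rw [dz, dz, if_neg (by omega), if_neg (by omega)]; simp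
  · simp [dz, dn_zero]
  · obtain ⟨k, rfl⟩ : ∃ k : ℕ, c = ((k + 1 : ℕ) : ℤ) := ⟨(c - 1).toNat, by omega⟩
    have := f2_dn hg h1 k
    rw [dz_nat, show ((k + 1 : ℕ) : ℤ) - 1 = (k : ℤ) by push_cast; ring, dz_nat]
    have h1 := qFact_ne k
    have h3 : qI (k + 1 : ℤ) ≠ 0 := qI_ne (by omega)
    unfold dn
    rw [mul_smul_comm, this, smul_add, smul_mul_assoc, smul_mul_assoc, smul_smul, smul_smul, smul_smul,
      qFact_succ]
    congr 2
    · push_cast; ring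
    · field_simp

/-- the expansion -/
noncomputable def SS (f1 g f2 : A) (b : ℕ) (c : ℤ) : A :=
  ∑ k ∈ Finset.range (b + 1), qq ^ (((b : ℤ) - k) * (c - k)) •
    (dz f1 (c - k) * dz g k * dz f2 ((b : ℤ) - k))

theorem SS_step (hg : f2 * f1 = qq • (f1 * f2) + g) (h1 : g * f1 = qq⁻¹ • (f1 * g))
    (h2 : f2 * g = qq⁻¹ • (g * f2)) (b : ℕ) (c : ℤ) :
    f2 * SS f1 g f2 b c = qI (b + 1 : ℤ) • SS f1 g f2 (b + 1) c := by
  have h2' : f2 * g = qq ^ (-1 : ℤ) • (g * f2) := by simpa using h2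
  set t : ℕ → A := fun k => dz f1 (c - k) * dz g k * dz f2 ((b : ℤ) + 1 - k) with ht
  set α : ℕ → 𝕂 := fun k => qq ^ (((b : ℤ) - k) * (c - k) + (c - 2 * k)) * qI ((b : ℤ) - k + 1) with hα
  set β : ℕ → 𝕂 := fun k => qq ^ (((b : ℤ) - k + 1) * (c - k + 1)) * qI (k : ℤ) with hβ
  have hL : f2 * SS f1 g f2 b c =
      ∑ k ∈ Finset.range (b + 1), (α k • t k + β (k + 1) • t (k + 1)) := by
    unfold SS
    rw [Finset.mul_sum]
    refine Finset.sum_congr rfl fun k _ => ?_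
    have e1 : f2 * (dz f1 (c - k) * dz g k * dz f2 ((b : ℤ) - k)) =
        (qq ^ (c - 2 * k : ℤ) * qI ((b : ℤ) - k + 1)) • t k + qI ((k : ℤ) + 1) • t (k + 1) := by
      rw [← mul_assoc, ← mul_assoc, f2_dz hg h1, add_mul, add_mul, smul_mul_assoc, smul_mul_assoc,
        mul_assoc (dz f1 (c - k)) f2, comm_dz h2', mul_smul_comm, smul_mul_assoc,
        ← mul_assoc (dz f1 (c - k)), mul_assoc _ f2, dz_succ, mul_smul_comm,
        mul_assoc (dz f1 (c - k - 1)) g, dz_succ, mul_smul_comm, smul_mul_assoc, smul_smul, smul_smul]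
      simp only [ht]
      congr 1
      · congr 1
        · rw [← zpow_add₀ qq_ne]; congr 2; ring
        · congr 2; ring
      · congr 2
        · congr 1
          · congr 1; push_cast; ring
        · congr 1; push_cast; ring
    rw [mul_smul_comm, e1, smul_add, smul_smul, smul_smul]
    simp only [hα, hβ]
    congr 2
    · rw [← mul_assoc, ← zpow_add₀ qq_ne]
    · push_cast
      congr 2; ring
  rw [hL, Finset.sum_add_distrib]
  have e2 : ∑ k ∈ Finset.range (b + 1), α k • t k = ∑ k ∈ Finset.range (b + 2), α k • t k := by
    rw [Finset.sum_range_succ _ (b + 1)]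
    have : α (b + 1) = 0 := by
      simp only [hα]
      rw [show ((b : ℤ) - ((b + 1 : ℕ) : ℤ) + 1) = 0 by push_cast; ring, qI_zero, mul_zero]
    rw [this, zero_smul, add_zero]
  have e3 : ∑ k ∈ Finset.range (b + 1), β (k + 1) • t (k + 1) =
      ∑ k ∈ Finset.range (b + 2), β k • t k := by
    rw [Finset.sum_range_succ' _ (b + 1)]
    have : β 0 = 0 := by simp [hβ, qI_zero]
    rw [this, zero_smul, add_zero]
  rw [e2, e3, ← Finset.sum_add_distrib, SS, Finset.smul_sum]
  refine Finset.sum_congr rfl fun k _ => ?_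
  rw [← add_smul, smul_smul]
  simp only [ht]
  push_cast
  congr 1
  have e := qI_add ((b : ℤ) - k + 1) k
  rw [show (b : ℤ) - k + 1 + k = b + 1 by ring] at e
  have e' := qI_add (k : ℤ) ((b : ℤ) - k + 1)
  rw [show (k : ℤ) + ((b : ℤ) - k + 1) = b + 1 by ring] at e'
  rw [e']
  simp only [hα, hβ]
  have a1 : qq ^ (((b : ℤ) - k) * (c - k) + (c - 2 * k)) =
      qq ^ (((b : ℤ) + 1 - k) * (c - k)) * qq ^ (-(k : ℤ)) := by
    rw [← zpow_add₀ qq_ne]; congr 1; ring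
  have a2 : qq ^ (((b : ℤ) - k + 1) * (c - k + 1)) =
      qq ^ (((b : ℤ) + 1 - k) * (c - k)) * qq ^ ((b : ℤ) - k + 1) := by
    rw [← zpow_add₀ qq_ne]; congr 1; ring
  rw [a1, a2]; ring

theorem dn_dn_expand (hg : f2 * f1 = qq • (f1 * f2) + g) (h1 : g * f1 = qq⁻¹ • (f1 * g))
    (h2 : f2 * g = qq⁻¹ • (g * f2)) (b : ℕ) (c : ℤ) : dn f2 b * dz f1 c = SS f1 g f2 b c := by
  induction b with
  | zero => simp [SS, dn_zero, dz]
  | succ b ih =>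
    have h3 : qI (b + 1 : ℤ) ≠ 0 := qI_ne (by omega)
    have e : qI (b + 1 : ℤ) • (dn f2 (b + 1) * dz f1 c) = qI (b + 1 : ℤ) • SS f1 g f2 (b + 1) c := by
      rw [← SS_step hg h1 h2, ← ih, ← mul_assoc, dn_succ, smul_mul_assoc]
    exact smul_right_injective A h3 e

end alg
end CB

namespace CB

section alg
variable {A : Type*} [Ring A] [Algebra 𝕂 A]

theorem tri {ι : Type*} (p m : ι → A) (μ : ι → ℕ)
    (h : ∀ t, ∃ z ∈ Submodule.span OO (p '' {s | μ s < μ t}), m t = p t + qq • z) :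
    ∀ t, ∃ z ∈ Submodule.span OO (Set.range m), p t = m t + qq • z := by
  suffices H : ∀ n, ∀ t, μ t = n → ∃ z ∈ Submodule.span OO (Set.range m), p t = m t + qq • z from
    fun t => H _ t rfl
  intro n
  induction n using Nat.strong_induction_on with
  | _ n ih =>
    rintro t rfl
    obtain ⟨z, hz, e⟩ := h t
    refine ⟨-z, Submodule.neg_mem _ (Submodule.span_le.2 ?_ hz), by rw [e, smul_neg]; abel⟩
    rintro _ ⟨s, hs, rfl⟩
    obtain ⟨z', hz', e'⟩ := ih _ hs s rfl
    show p s ∈ Submodule.span OO (Set.range m)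
    rw [e']
    exact Submodule.add_mem _ (Submodule.subset_span ⟨s, rfl⟩)
      (Submodule.smul_mem _ (⟨qq, qq_mem⟩ : OO) hz')

/-- rank two PBW monomial -/
noncomputable def PP (f1 g f2 : A) (t : ℕ × ℕ × ℕ) : A := dn f1 t.1 * dn g t.2.1 * dn f2 t.2.2

variable {f1 f2 g : A}

theorem coef_mem (x z j : ℕ) (hj : 1 ≤ j) (hxz : x ≤ z) :
    ∃ c ∈ OO, qq ^ (((j : ℤ) + z) * j) * (qFact (x + j) / (qFact x * qFact j)) = qq * c := by
  refine ⟨qq ^ ((j : ℤ) * (z + j - x) - 1) * gb x j, OO.mul_mem (qq_zpow_mem ?_) (gb_mem _ _), ?_⟩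
  · have h1 : (1 : ℤ) ≤ j := by exact_mod_cast hj
    have h2 : (x : ℤ) ≤ z := by exact_mod_cast hxz
    nlinarith
  · rw [gb, ← zpow_natCast qq (x * j), ← mul_assoc, ← mul_assoc, ← zpow_one_add₀ qq_ne,
      ← zpow_add₀ qq_ne]
    congr 2; push_cast; ring

/-- expansions in common -/
theorem SS_expand (y s : ℕ) : SS f1 g f2 (y + s) y =
    ∑ k ∈ Finset.range y, (qq ^ ((((y - k : ℕ) : ℤ) + s) * ((y - k : ℕ) : ℤ)) •
      (dn f1 (y - k) * dn g k * dn f2 (y - k + s))) + dn g y * dn f2 s := by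
  unfold SS
  rw [← Finset.sum_subset (s₁ := Finset.range (y + 1))]
  · rw [Finset.sum_range_succ]
    congr 1
    · refine Finset.sum_congr rfl fun k hk => ?_
      have hk := Finset.mem_range.1 hk
      rw [show (y : ℤ) - k = ((y - k : ℕ) : ℤ) by omega,
        show ((y + s : ℕ) : ℤ) - k = ((y - k + s : ℕ) : ℤ) by omega, dz_nat, dz_nat, dz_nat]
      push_cast; rfl
    · rw [show ((y + s : ℕ) : ℤ) - y = (s : ℕ) by push_cast; ring, sub_self, dz_nat, dz_nat]
      simp [dz, dn_zero]
  · intro k hk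
    simp only [Finset.mem_range] at *
    omega
  · intro k _ hk
    simp only [Finset.mem_range] at hk
    have : dz f1 ((y : ℤ) - k) = 0 := by rw [dz, if_neg (by omega)]
    rw [this]; simp

theorem SS_expand2 (y s : ℕ) : SS f1 g f2 y (y + s : ℕ) =
    ∑ k ∈ Finset.range y, (qq ^ ((((y - k : ℕ) : ℤ) + s) * ((y - k : ℕ) : ℤ)) •
      (dn f1 (y - k + s) * dn g k * dn f2 (y - k))) + dn f1 s * dn g y := by
  unfold SS
  rw [Finset.sum_range_succ]
  congr 1
  · refine Finset.sum_congr rfl fun k hk => ?_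
    have hk := Finset.mem_range.1 hk
    rw [show (y : ℤ) - k = ((y - k : ℕ) : ℤ) by omega,
      show ((y + s : ℕ) : ℤ) - k = ((y - k + s : ℕ) : ℤ) by omega, dz_nat, dz_nat, dz_nat]
    push_cast; rw [mul_comm]
  · rw [show ((y + s : ℕ) : ℤ) - y = (s : ℕ) by push_cast; ring, sub_self, dz_nat, dz_nat]
    simp [dz, dn_zero]

theorem sum_q_mem (S : Submodule OO A) (y : ℕ) (f : ℕ → A)
    (h : ∀ k < y, ∃ z ∈ S, f k = qq • z) : ∃ z ∈ S, ∑ k ∈ Finset.range y, f k = qq • z := by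
  choose z hz hf using h
  refine ⟨∑ k ∈ (Finset.range y).attach, z k.1 (Finset.mem_range.1 k.2),
    Submodule.sum_mem _ fun k _ => hz _ _, ?_⟩
  rw [← Finset.sum_attach, Finset.smul_sum]
  exact Finset.sum_congr rfl fun k _ => hf _ _

theorem mono1 (hg : f2 * f1 = qq • (f1 * f2) + g) (h1 : g * f1 = qq⁻¹ • (f1 * g))
    (h2 : f2 * g = qq⁻¹ • (g * f2)) (x y z : ℕ) (hxz : x ≤ z) :
    ∃ u ∈ Submodule.span OO (PP f1 g f2 '' {s | s.2.1 < y}),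
      dn f1 x * dn f2 (y + z) * dn f1 y = PP f1 g f2 (x, y, z) + qq • u := by
  have e := dn_dn_expand hg h1 h2 (y + z) y
  rw [dz_nat, SS_expand] at e
  rw [mul_assoc, e, mul_add, Finset.mul_sum]
  obtain ⟨u, hu, e2⟩ := sum_q_mem (Submodule.span OO (PP f1 g f2 '' {s | s.2.1 < y})) y
    (fun k => dn f1 x * (qq ^ ((((y - k : ℕ) : ℤ) + z) * ((y - k : ℕ) : ℤ)) •
      (dn f1 (y - k) * dn g k * dn f2 (y - k + z)))) (by
      intro k hk
      obtain ⟨c, hc, e3⟩ := coef_mem x z (y - k) (by omega) hxz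
      refine ⟨c • PP f1 g f2 (x + (y - k), k, y - k + z),
        Submodule.smul_mem _ (⟨c, hc⟩ : OO) (Submodule.subset_span ⟨_, hk, rfl⟩), ?_⟩
      simp only [PP]
      rw [mul_smul_comm, ← mul_assoc, ← mul_assoc, dn_mul, smul_mul_assoc, smul_mul_assoc,
        smul_smul, e3, smul_smul])
  refine ⟨u, hu, ?_⟩
  rw [e2, add_comm, PP, ← mul_assoc]

theorem mono2 (hg : f2 * f1 = qq • (f1 * f2) + g) (h1 : g * f1 = qq⁻¹ • (f1 * g))
    (h2 : f2 * g = qq⁻¹ • (g * f2)) (x y z : ℕ) (hxz : z ≤ x) :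
    ∃ u ∈ Submodule.span OO (PP f1 g f2 '' {s | s.2.1 < y}),
      dn f2 y * dn f1 (y + x) * dn f2 z = PP f1 g f2 (x, y, z) + qq • u := by
  have e := dn_dn_expand hg h1 h2 y (y + x : ℕ)
  rw [dz_nat, SS_expand2] at e
  rw [e, add_mul, Finset.sum_mul]
  obtain ⟨u, hu, e2⟩ := sum_q_mem (Submodule.span OO (PP f1 g f2 '' {s | s.2.1 < y})) y
    (fun k => (qq ^ ((((y - k : ℕ) : ℤ) + x) * ((y - k : ℕ) : ℤ)) •
      (dn f1 (y - k + x) * dn g k * dn f2 (y - k))) * dn f2 z) (by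
      intro k hk
      obtain ⟨c, hc, e3⟩ := coef_mem z x (y - k) (by omega) hxz
      refine ⟨c • PP f1 g f2 (y - k + x, k, y - k + z),
        Submodule.smul_mem _ (⟨c, hc⟩ : OO) (Submodule.subset_span ⟨_, hk, rfl⟩), ?_⟩
      simp only [PP]
      rw [smul_mul_assoc, mul_assoc _ (dn f2 _), dn_mul, mul_smul_comm,
        smul_smul, add_comm (y - k) z, mul_comm (qFact (y - k)), e3, smul_smul])
  refine ⟨u, hu, ?_⟩
  rw [e2, add_comm, PP]

/-- monomials, first version -/
noncomputable def mA (f1 f2 : A) (t : ℕ × ℕ × ℕ) : A :=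
  if t.1 ≤ t.2.2 then dn f1 t.1 * dn f2 (t.2.1 + t.2.2) * dn f1 t.2.1
  else dn f2 t.2.1 * dn f1 (t.2.1 + t.1) * dn f2 t.2.2

/-- monomials, second version -/
noncomputable def mB (f1 f2 : A) (t : ℕ × ℕ × ℕ) : A :=
  if t.1 < t.2.2 then dn f1 t.1 * dn f2 (t.2.1 + t.2.2) * dn f1 t.2.1
  else dn f2 t.2.1 * dn f1 (t.2.1 + t.1) * dn f2 t.2.2

theorem mA_tri (hg : f2 * f1 = qq • (f1 * f2) + g) (h1 : g * f1 = qq⁻¹ • (f1 * g))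
    (h2 : f2 * g = qq⁻¹ • (g * f2)) (t : ℕ × ℕ × ℕ) :
    ∃ u ∈ Submodule.span OO (PP f1 g f2 '' {s | s.2.1 < t.2.1}),
      mA f1 f2 t = PP f1 g f2 t + qq • u := by
  unfold mA
  split
  · exact mono1 hg h1 h2 _ _ _ ‹_›
  · exact mono2 hg h1 h2 _ _ _ (by omega)

theorem mB_tri (hg : f2 * f1 = qq • (f1 * f2) + g) (h1 : g * f1 = qq⁻¹ • (f1 * g))
    (h2 : f2 * g = qq⁻¹ • (g * f2)) (t : ℕ × ℕ × ℕ) :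
    ∃ u ∈ Submodule.span OO (PP f1 g f2 '' {s | s.2.1 < t.2.1}),
      mB f1 f2 t = PP f1 g f2 t + qq • u := by
  unfold mB
  split
  · exact mono1 hg h1 h2 _ _ _ (by omega)
  · exact mono2 hg h1 h2 _ _ _ (by omega)

theorem mAB (t : ℕ × ℕ × ℕ) : ∃ s, mA f1 f2 t = mB f2 f1 s := by
  obtain ⟨x, y, z⟩ := t
  by_cases h : x ≤ z
  · refine ⟨(y + z - x, x, y), ?_⟩
    simp only [mA, mB]
    rw [if_pos h, if_neg (by omega), show x + (y + z - x) = y + z by omega]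
  · refine ⟨(y, z, x + y - z), ?_⟩
    simp only [mA, mB]
    rw [if_neg h, if_pos (by omega), show z + (x + y - z) = y + x by omega]

/-- the rank two comparison -/
theorem rank2 {h : A} (hg : f2 * f1 = qq • (f1 * f2) + g) (h1 : g * f1 = qq⁻¹ • (f1 * g))
    (h2 : f2 * g = qq⁻¹ • (g * f2)) (hh : f1 * f2 = qq • (f2 * f1) + h)
    (h1' : h * f2 = qq⁻¹ • (f2 * h)) (h2' : f1 * h = qq⁻¹ • (h * f1)) (t : ℕ × ℕ × ℕ) :
    ∃ s, ∃ u ∈ Submodule.span OO (Set.range (PP f2 h f1)),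
      PP f1 g f2 t = PP f2 h f1 s + qq • u := by
  obtain ⟨u, hu, e⟩ := tri (PP f1 g f2) (mA f1 f2) (fun t => t.2.1) (mA_tri hg h1 h2) t
  obtain ⟨s, es⟩ := mAB (f1 := f1) (f2 := f2) t
  obtain ⟨v, hv, e'⟩ := mB_tri hh h1' h2' s
  have hB : ∀ s, mB f2 f1 s ∈ Submodule.span OO (Set.range (PP f2 h f1)) := by
    intro s
    obtain ⟨v, hv, e'⟩ := mB_tri hh h1' h2' s
    rw [e']
    exact Submodule.add_mem _ (Submodule.subset_span ⟨_, rfl⟩)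
      (Submodule.smul_mem _ (⟨qq, qq_mem⟩ : OO) (Submodule.span_mono (Set.image_subset_range _ _) hv))
  refine ⟨s, v + u, Submodule.add_mem _ (Submodule.span_mono (Set.image_subset_range _ _) hv)
    (Submodule.span_le.2 ?_ hu), ?_⟩
  · rintro _ ⟨r, rfl⟩
    obtain ⟨s', es'⟩ := mAB (f1 := f1) (f2 := f2) r
    rw [es']; exact hB s'
  · rw [e, es, e', smul_add, add_assoc]

/-- Serre relations give the `q`-commutation -/
theorem serre_q {f1 f2 : A}
    (h1 : f1 ^ 2 * f2 + f2 * f1 ^ 2 = (qq + qq⁻¹) • (f1 * f2 * f1)) :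
    (f2 * f1 - qq • (f1 * f2)) * f1 = qq⁻¹ • (f1 * (f2 * f1 - qq • (f1 * f2))) := by
  have h := qq_ne
  have h1' : f2 * f1 ^ 2 = (qq + qq⁻¹) • (f1 * f2 * f1) - f1 ^ 2 * f2 := by rw [← h1]; abel
  rw [sub_mul, mul_sub, mul_assoc f2, ← pow_two, h1', smul_mul_assoc, mul_smul_comm, smul_sub,
    smul_smul, inv_mul_cancel₀ h, add_smul, ← mul_assoc, ← mul_assoc, ← pow_two, one_smul]
  abel

theorem serre_q' {f1 f2 : A}
    (h1 : f2 ^ 2 * f1 + f1 * f2 ^ 2 = (qq + qq⁻¹) • (f2 * f1 * f2)) :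
    f2 * (f2 * f1 - qq • (f1 * f2)) = qq⁻¹ • ((f2 * f1 - qq • (f1 * f2)) * f2) := by
  have h := qq_ne
  have h1' : f2 ^ 2 * f1 = (qq + qq⁻¹) • (f2 * f1 * f2) - f1 * f2 ^ 2 := by rw [← h1]; abel
  rw [sub_mul, mul_sub, ← mul_assoc, ← pow_two, h1', smul_mul_assoc, mul_smul_comm, smul_sub,
    smul_smul, inv_mul_cancel₀ h, add_smul, mul_assoc f1, ← mul_assoc f2, ← pow_two, one_smul]
  abel

theorem rank2_serre {f1 f2 : A}
    (s1 : f1 ^ 2 * f2 + f2 * f1 ^ 2 = (qq + qq⁻¹) • (f1 * f2 * f1))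
    (s2 : f2 ^ 2 * f1 + f1 * f2 ^ 2 = (qq + qq⁻¹) • (f2 * f1 * f2)) (t : ℕ × ℕ × ℕ) :
    ∃ s, ∃ u ∈ Submodule.span OO (Set.range (PP f2 (f1 * f2 - qq • (f2 * f1)) f1)),
      PP f1 (f2 * f1 - qq • (f1 * f2)) f2 t = PP f2 (f1 * f2 - qq • (f2 * f1)) f1 s + qq • u :=
  rank2 (by abel) (serre_q s1) (serre_q' s2) (by abel) (serre_q s2) (serre_q' s1) t

end alg
end CB

namespace CB

section uq
variable {I : Type} [Fintype I] [DecidableEq I] (D : ADEData I)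

theorem rK (i : I) : KK D i * KKinv D i = 1 := by
  have := RingQuot.mkAlgHom_rel 𝕂 (QRel.KKinv (D := D) i)
  simpa only [map_mul, map_one, EE, FF, KK, KKinv] using this

theorem rK' (i : I) : KKinv D i * KK D i = 1 := by
  have := RingQuot.mkAlgHom_rel 𝕂 (QRel.KinvK (D := D) i)
  simpa only [map_mul, map_one, EE, FF, KK, KKinv] using this

theorem rKK (i j : I) : KK D i * KK D j = KK D j * KK D i := by
  have := RingQuot.mkAlgHom_rel 𝕂 (QRel.KcommK (D := D) i j)
  simpa only [map_mul, EE, FF, KK, KKinv] using this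

theorem cartan_cases (i j : I) : (i = j) ∨ (D.adj i j = true ∧ i ≠ j) ∨ (D.adj i j = false ∧ i ≠ j) := by
  by_cases h : i = j
  · exact Or.inl h
  · cases h' : D.adj i j <;> simp [h]

theorem adj_ne {i j : I} (h : D.adj i j = true) : i ≠ j := by
  rintro rfl; rw [D.irrefl] at h; exact absurd h (by simp)

theorem of_conj {A : Type*} [Ring A] [Algebra 𝕂 A] {k k' x : A} {s : 𝕂} (hk : k' * k = 1)
    (h : k * x * k' = s • x) : k * x = s • (x * k) := by
  have := congrArg (· * k) h
  simpa only [mul_assoc, hk, mul_one, smul_mul_assoc] using this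

theorem cartan_self' (i : I) : cartan D i i = 2 := by simp [cartan, cartanOf]
theorem cartan_adj' {i j : I} (h : D.adj i j = true) : cartan D i j = -1 := by
  simp [cartan, cartanOf, h, adj_ne D h]
theorem cartan_far' {i j : I} (h : i ≠ j) (h' : D.adj i j = false) : cartan D i j = 0 := by
  simp [cartan, cartanOf, h, h']

theorem rKE (i j : I) : KK D i * EE D j = qq ^ (cartan D i j) • (EE D j * KK D i) := by
  apply of_conj (rK' D i)
  rcases cartan_cases D i j with rfl | ⟨h, h'⟩ | ⟨h, h'⟩
  · have := RingQuot.mkAlgHom_rel 𝕂 (QRel.KEself (D := D) i)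
    rw [cartan_self', show qq ^ (2 : ℤ) = qq ^ 2 from zpow_ofNat _ _]
    simpa only [map_mul, map_smul, EE, FF, KK, KKinv] using this
  · have := RingQuot.mkAlgHom_rel 𝕂 (QRel.KEadj (D := D) i j h)
    rw [cartan_adj' D h, zpow_neg_one]
    simpa only [map_mul, map_smul, EE, FF, KK, KKinv] using this
  · have := RingQuot.mkAlgHom_rel 𝕂 (QRel.KEfar (D := D) i j h' h)
    rw [cartan_far' D h' h, zpow_zero, one_smul]
    simpa only [map_mul, map_smul, EE, FF, KK, KKinv] using this

theorem rKF (i j : I) : KK D i * FF D j = qq ^ (-cartan D i j) • (FF D j * KK D i) := by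
  apply of_conj (rK' D i)
  rcases cartan_cases D i j with rfl | ⟨h, h'⟩ | ⟨h, h'⟩
  · have := RingQuot.mkAlgHom_rel 𝕂 (QRel.KFself (D := D) i)
    rw [cartan_self', zpow_neg, show qq ^ (2 : ℤ) = qq ^ 2 from zpow_ofNat _ _]
    simpa only [map_mul, map_smul, EE, FF, KK, KKinv] using this
  · have := RingQuot.mkAlgHom_rel 𝕂 (QRel.KFadj (D := D) i j h)
    rw [cartan_adj' D h, neg_neg, zpow_one]
    simpa only [map_mul, map_smul, EE, FF, KK, KKinv] using this
  · have := RingQuot.mkAlgHom_rel 𝕂 (QRel.KFfar (D := D) i j h' h)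
    rw [cartan_far' D h' h, neg_zero, zpow_zero, one_smul]
    simpa only [map_mul, map_smul, EE, FF, KK, KKinv] using this

theorem rEFd {i j : I} (h : i ≠ j) : EE D i * FF D j = FF D j * EE D i := by
  have := RingQuot.mkAlgHom_rel 𝕂 (QRel.EFdiff (D := D) i j h)
  rw [map_sub, map_zero, sub_eq_zero] at this
  simpa only [map_mul, EE, FF, KK, KKinv] using this

theorem rEF (i : I) : EE D i * FF D i = FF D i * EE D i + (qq - qq⁻¹)⁻¹ • (KK D i - KKinv D i) := by
  have := RingQuot.mkAlgHom_rel 𝕂 (QRel.EFself (D := D) i)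
  simp only [map_sub, map_mul, map_smul] at this
  rw [sub_eq_iff_eq_add'] at this
  exact this

theorem rSE {i j : I} (h : D.adj i j = true) : EE D i ^ 2 * EE D j + EE D j * EE D i ^ 2 =
    (qq + qq⁻¹) • (EE D i * EE D j * EE D i) := by
  have := RingQuot.mkAlgHom_rel 𝕂 (QRel.serreE (D := D) i j h)
  simpa only [map_mul, map_add, map_smul, map_pow, EE, FF, KK, KKinv] using this

theorem rSF {i j : I} (h : D.adj i j = true) : FF D i ^ 2 * FF D j + FF D j * FF D i ^ 2 =
    (qq + qq⁻¹) • (FF D i * FF D j * FF D i) := by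
  have := RingQuot.mkAlgHom_rel 𝕂 (QRel.serreF (D := D) i j h)
  simpa only [map_mul, map_add, map_smul, map_pow, EE, FF, KK, KKinv] using this

theorem rEE {i j : I} (h : i ≠ j) (h' : D.adj i j = false) : EE D i * EE D j = EE D j * EE D i := by
  have := RingQuot.mkAlgHom_rel 𝕂 (QRel.EEfar (D := D) i j h h')
  simpa only [map_mul, EE, FF, KK, KKinv] using this

theorem rFF {i j : I} (h : i ≠ j) (h' : D.adj i j = false) : FF D i * FF D j = FF D j * FF D i := by
  have := RingQuot.mkAlgHom_rel 𝕂 (QRel.FFfar (D := D) i j h h')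
  simpa only [map_mul, EE, FF, KK, KKinv] using this

theorem inv_comm {A : Type*} [Ring A] [Algebra 𝕂 A] {k k' x : A} {s : 𝕂} (hs : s ≠ 0)
    (hk : k * k' = 1) (hk' : k' * k = 1) (h : k * x = s • (x * k)) : k' * x = s⁻¹ • (x * k') := by
  have h2 : k' * (k * x) * k' = s • (k' * (x * k) * k') := by rw [h]; simp
  rw [← mul_assoc, hk', one_mul, ← mul_assoc, mul_assoc _ k, hk, mul_one] at h2
  rw [h2, smul_smul, inv_mul_cancel₀ hs, one_smul]

theorem rK'E (i j : I) : KKinv D i * EE D j = qq ^ (-cartan D i j) • (EE D j * KKinv D i) := by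
  rw [zpow_neg]
  exact inv_comm (zpow_ne_zero _ qq_ne) (rK D i) (rK' D i) (rKE D i j)

theorem rK'F (i j : I) : KKinv D i * FF D j = qq ^ (cartan D i j) • (FF D j * KKinv D i) := by
  have := inv_comm (zpow_ne_zero _ qq_ne) (rK D i) (rK' D i) (rKF D i j)
  rwa [zpow_neg, inv_inv] at this

theorem hom_ext' {B : Type*} [Ring B] [Algebra 𝕂 B] {f g : Uq D →ₐ[𝕂] B}
    (hE : ∀ i, f (EE D i) = g (EE D i)) (hF : ∀ i, f (FF D i) = g (FF D i))
    (hK : ∀ i, f (KK D i) = g (KK D i)) : f = g := by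
  apply RingQuot.ringQuot_ext'
  apply FreeAlgebra.hom_ext
  funext x
  cases x with
  | E i => exact hE i
  | F i => exact hF i
  | K i => exact hK i
  | Kinv i =>
    show f (KKinv D i) = g (KKinv D i)
    have h1 : f (KKinv D i) * f (KK D i) = 1 := by rw [← map_mul, rK', map_one]
    have h2 : g (KK D i) * g (KKinv D i) = 1 := by rw [← map_mul, rK, map_one]
    rw [hK] at h1
    exact left_inv_eq_right_inv h1 h2

theorem TTF_aux {𝕜 A : Type*} [Field 𝕜] [Ring A] [Algebra 𝕜 A] {q : 𝕜} (hq : q ≠ 0) (hd : q - q⁻¹ ≠ 0) {k k' e f1 f2 : A}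
    (hk' : k' * k = 1) (h1' : k' * f1 = q ^ (2 : ℤ) • (f1 * k'))
    (h2 : k * f2 = q • (f2 * k)) (h2' : k' * f2 = q⁻¹ • (f2 * k'))
    (he1 : e * f1 = f1 * e + (q - q⁻¹)⁻¹ • (k - k')) (he2 : e * f2 = f2 * e) :
    (-(k' * e)) * (f2 * f1 - q • (f1 * f2)) - q • ((f2 * f1 - q • (f1 * f2)) * (-(k' * e))) = f2 := by
  have hd' : q ^ 2 - 1 ≠ 0 := by
    intro h; apply hd; field_simp; rw [mul_zero]; exact h
  set X := f2 * f1 - q • (f1 * f2) with hX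
  have hkX : k' * X = q • (X * k') := by
    rw [hX, mul_sub, mul_smul_comm, ← mul_assoc, ← mul_assoc, h1', h2', smul_mul_assoc, mul_assoc f2,
      h1', smul_mul_assoc, mul_assoc f1, h2', mul_smul_comm, mul_smul_comm, sub_mul, smul_mul_assoc,
      ← mul_assoc, ← mul_assoc, zpow_ofNat]
    match_scalars <;> field_simp
  have heX : e * X = X * e - q • (f2 * k) := by
    rw [hX, mul_sub, mul_smul_comm, ← mul_assoc, ← mul_assoc, he2, mul_assoc f2, he1, add_mul,
      mul_assoc f1 e, he2, smul_mul_assoc, sub_mul, h2, h2', mul_add, mul_smul_comm, mul_sub, sub_mul,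
      smul_mul_assoc, ← mul_assoc, ← mul_assoc]
    match_scalars <;> field_simp <;> ring
  have h3 : X * k' = q⁻¹ • (k' * X) := by rw [hkX, smul_smul, inv_mul_cancel₀ hq, one_smul]
  rw [neg_mul, mul_assoc, heX, mul_neg, ← mul_assoc X, h3, smul_mul_assoc, smul_neg, smul_smul,
    mul_inv_cancel₀ hq, one_smul, mul_sub, mul_smul_comm, ← mul_assoc k' f2, h2', smul_mul_assoc,
    mul_assoc f2, hk', smul_smul, mul_inv_cancel₀ hq, one_smul, mul_one, ← mul_assoc]
  abel

theorem TTE_aux {𝕜 A : Type*} [Field 𝕜] [Ring A] [Algebra 𝕜 A] {q : 𝕜} (hq : q ≠ 0) (hd : q - q⁻¹ ≠ 0) {k k' f e1 e2 : A}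
    (hk' : k' * k = 1) (h1 : k * e1 = q ^ (2 : ℤ) • (e1 * k))
    (h2 : k * e2 = q⁻¹ • (e2 * k)) (h2' : k' * e2 = q • (e2 * k'))
    (he1 : e1 * f = f * e1 + (q - q⁻¹)⁻¹ • (k - k')) (he2 : e2 * f = f * e2) :
    (e1 * e2 - q⁻¹ • (e2 * e1)) * (-(f * k)) - q⁻¹ • ((-(f * k)) * (e1 * e2 - q⁻¹ • (e2 * e1)))
      = e2 := by
  have hd' : q ^ 2 - 1 ≠ 0 := by
    intro h; apply hd; field_simp; rw [mul_zero]; exact h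
  set Y := e1 * e2 - q⁻¹ • (e2 * e1) with hY
  have hkY : k * Y = q • (Y * k) := by
    rw [hY, mul_sub, mul_smul_comm, ← mul_assoc, ← mul_assoc, h1, h2, smul_mul_assoc, mul_assoc e1,
      h2, smul_mul_assoc, mul_assoc e2, h1, mul_smul_comm, mul_smul_comm, sub_mul, smul_mul_assoc,
      ← mul_assoc, ← mul_assoc, zpow_ofNat]
    match_scalars <;> field_simp
  have hfY : Y * f = f * Y - (e2 * k') := by
    rw [hY, sub_mul, smul_mul_assoc, mul_assoc, mul_assoc, he2, ← mul_assoc, he1, mul_add e2,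
      ← mul_assoc e2, he2, add_mul, mul_smul_comm, smul_mul_assoc, sub_mul, h2, h2', mul_sub, mul_sub,
      mul_smul_comm, mul_assoc, mul_assoc]
    match_scalars <;> field_simp <;> ring
  rw [mul_neg, ← mul_assoc, hfY, neg_mul, mul_assoc f, hkY, smul_neg, mul_smul_comm, smul_smul,
    inv_mul_cancel₀ hq, one_smul, sub_mul, mul_assoc e2, hk', mul_one, mul_assoc]
  abel

theorem braid_aux {𝕜 A : Type*} [Field 𝕜] [Ring A] [Algebra 𝕜 A] {a b c : A} (s : 𝕜) (h : b * c = c * b) :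
    (c * a - s • (a * c)) * b - s • (b * (c * a - s • (a * c))) =
      c * (a * b - s • (b * a)) - s • ((a * b - s • (b * a)) * c) := by
  simp only [mul_sub, sub_mul, smul_mul_assoc, mul_smul_comm]
  rw [mul_assoc a b c, h, ← mul_assoc b c a, h, mul_assoc c b a, mul_assoc c a b, mul_assoc a c b,
    ← mul_assoc b a c]
  module

theorem braid_aux' {𝕜 A : Type*} [Field 𝕜] [Ring A] [Algebra 𝕜 A] {a b c : A} (s : 𝕜) (h : b * c = c * b) :
    b * (a * c - s • (c * a)) - s • ((a * c - s • (c * a)) * b) =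
      (b * a - s • (a * b)) * c - s • (c * (b * a - s • (a * b))) := by
  simp only [mul_sub, sub_mul, smul_mul_assoc, mul_smul_comm]
  rw [mul_assoc b a c, ← mul_assoc b c a, h, mul_assoc c b a, mul_assoc a b c, h, mul_assoc a c b,
    mul_assoc c a b]
  module

theorem far_aux {𝕜 A : Type*} [Field 𝕜] [Ring A] [Algebra 𝕜 A] {a b c : A} (s : 𝕜) (h : a * b = b * a) :
    (c * a - s • (a * c)) * b - s • (b * (c * a - s • (a * c))) =
      (c * b - s • (b * c)) * a - s • (a * (c * b - s • (b * c))) := by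
  simp only [mul_sub, sub_mul, smul_mul_assoc, mul_smul_comm]
  rw [mul_assoc c a b, h, ← mul_assoc b a c, ← h, mul_assoc c b a, mul_assoc a b c, mul_assoc a c b,
    mul_assoc b c a, h]
  module

theorem far_aux' {𝕜 A : Type*} [Field 𝕜] [Ring A] [Algebra 𝕜 A] {a b c : A} (s : 𝕜) (h : a * b = b * a) :
    b * (a * c - s • (c * a)) - s • ((a * c - s • (c * a)) * b) =
      a * (b * c - s • (c * b)) - s • ((b * c - s • (c * b)) * a) := by
  simp only [mul_sub, sub_mul, smul_mul_assoc, mul_smul_comm]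
  rw [← mul_assoc b a c, ← h, mul_assoc a b c, mul_assoc c a b, h, ← mul_assoc b c a, mul_assoc a c b,
    mul_assoc c b a]
  module

end uq
end CB

namespace CB

section br
variable {I : Type} [Fintype I] [DecidableEq I] {D : ADEData I} {T : I → (Uq D ≃ₐ[𝕂] Uq D)}

theorem no_triangle {a b c : I} (hab : D.adj a b = true) (hac : D.adj a c = true) :
    D.adj b c = false := by
  by_contra h
  have hbc : D.adj b c = true := by simpa using h
  have h0 : frm D (simpleRoot a + simpleRoot b + simpleRoot c)
      (simpleRoot a + simpleRoot b + simpleRoot c) = 0 := by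
    have hr : ∀ u v w : I → ℤ, frm D u (v + w) = frm D u v + frm D u w := fun u v w => by
      rw [frm_comm, frm_add_left, frm_comm, frm_comm D w]
    simp only [frm_add_left, hr, frm_simple, cartan_self, cartan_symm D b a, cartan_symm D c a,
      cartan_symm D c b, cartan_adj D hab, cartan_adj D hac, cartan_adj D hbc]
    norm_num
  have hne : (simpleRoot a + simpleRoot b + simpleRoot c : I → ℤ) ≠ 0 := by
    intro h
    have := congrFun h a
    simp [simpleRoot, adj_ne D hab, adj_ne D hac] at this
  have := frm_pos D hne
  omega

theorem TF (hT : IsLusztigAuts D T) (i : I) : T i (FF D i) = -(KKinv D i * EE D i) := (hT i i).1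
theorem TFa (hT : IsLusztigAuts D T) {i j : I} (h : D.adj i j = true) :
    T i (FF D j) = FF D j * FF D i - qq • (FF D i * FF D j) := (hT i j).2.1 h
theorem TFf (hT : IsLusztigAuts D T) {i j : I} (h : i ≠ j) (h' : D.adj i j = false) :
    T i (FF D j) = FF D j := (hT i j).2.2.1 h h'
theorem TE (hT : IsLusztigAuts D T) (i : I) : T i (EE D i) = -(FF D i * KK D i) := (hT i i).2.2.2.1
theorem TEa (hT : IsLusztigAuts D T) {i j : I} (h : D.adj i j = true) :
    T i (EE D j) = EE D i * EE D j - qq⁻¹ • (EE D j * EE D i) := (hT i j).2.2.2.2.1 h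
theorem TEf (hT : IsLusztigAuts D T) {i j : I} (h : i ≠ j) (h' : D.adj i j = false) :
    T i (EE D j) = EE D j := (hT i j).2.2.2.2.2.1 h h'
theorem TK (hT : IsLusztigAuts D T) (i : I) : T i (KK D i) = KKinv D i := (hT i i).2.2.2.2.2.2.1
theorem TKa (hT : IsLusztigAuts D T) {i j : I} (h : D.adj i j = true) :
    T i (KK D j) = KK D i * KK D j := (hT i j).2.2.2.2.2.2.2.1 h
theorem TKf (hT : IsLusztigAuts D T) {i j : I} (h : i ≠ j) (h' : D.adj i j = false) :
    T i (KK D j) = KK D j := (hT i j).2.2.2.2.2.2.2.2 h h'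

theorem map_Kinv (f : Uq D →ₐ[𝕂] Uq D) {i : I} {x y : Uq D} (h : f (KK D i) = x) (hxy : x * y = 1) :
    f (KKinv D i) = y := by
  have h1 : f (KKinv D i) * f (KK D i) = 1 := by rw [← map_mul, rK', map_one]
  rw [h] at h1
  exact left_inv_eq_right_inv h1 hxy

theorem TK' (hT : IsLusztigAuts D T) (i : I) : T i (KKinv D i) = KK D i :=
  map_Kinv (T i).toAlgHom (TK hT i) (rK' D i)

theorem TK'f (hT : IsLusztigAuts D T) {i j : I} (h : i ≠ j) (h' : D.adj i j = false) :
    T i (KKinv D j) = KKinv D j :=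
  map_Kinv (T i).toAlgHom (TKf hT h h') (rK D j)

theorem TTF (hT : IsLusztigAuts D T) {i j : I} (h : D.adj i j = true) :
    T i (T j (FF D i)) = FF D j := by
  have h' : D.adj j i = true := by rw [D.symm]; exact h
  rw [TFa hT h', map_sub, map_smul, map_mul, map_mul, TF hT, TFa hT h]
  have e1 := rK'F D i i
  have e2 := rKF D i j
  have e3 := rK'F D i j
  rw [cartan_self] at e1
  rw [cartan_adj D h] at e2 e3
  rw [neg_neg, zpow_one] at e2
  rw [zpow_neg_one] at e3
  exact TTF_aux qq_ne qdiff_ne (rK' D i) e1 e2 e3 (rEF D i) (rEFd D (adj_ne D h))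

theorem TTE (hT : IsLusztigAuts D T) {i j : I} (h : D.adj i j = true) :
    T i (T j (EE D i)) = EE D j := by
  have h' : D.adj j i = true := by rw [D.symm]; exact h
  rw [TEa hT h', map_sub, map_smul, map_mul, map_mul, TE hT, TEa hT h]
  have e1 := rKE D i i
  have e2 := rKE D i j
  have e3 := rK'E D i j
  rw [cartan_self] at e1
  rw [cartan_adj D h] at e2 e3
  rw [neg_neg, zpow_one] at e3
  rw [zpow_neg_one] at e2
  exact TTE_aux qq_ne qdiff_ne (rK' D i) e1 e2 e3 (rEF D i) (rEFd D (adj_ne D h'))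

theorem TTK (hT : IsLusztigAuts D T) {i j : I} (h : D.adj i j = true) :
    T i (T j (KK D i)) = KK D j := by
  have h' : D.adj j i = true := by rw [D.symm]; exact h
  rw [TKa hT h', map_mul, TK hT, TKa hT h, rKK, mul_assoc, rK, mul_one]

theorem TTK' (hT : IsLusztigAuts D T) {i j : I} (h : D.adj i j = true) :
    T i (T j (KKinv D i)) = KKinv D j :=
  map_Kinv ((T i).toAlgHom.comp (T j).toAlgHom) (TTK hT h) (rK D j)

theorem braid_gen (hT : IsLusztigAuts D T) {a b : I} (h : D.adj a b = true) (c : I)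
    (hc : c = a ∨ (c ≠ b ∧ D.adj b c = false)) :
    T a (T b (T a (EE D c))) = T b (T a (T b (EE D c))) ∧
    T a (T b (T a (FF D c))) = T b (T a (T b (FF D c))) ∧
    T a (T b (T a (KK D c))) = T b (T a (T b (KK D c))) := by
  have h' : D.adj b a = true := by rw [D.symm]; exact h
  rcases hc with rfl | ⟨hcb, hbc⟩
  · refine ⟨?_, ?_, ?_⟩
    · rw [TTE hT h, TE hT, TE hT, map_neg, map_neg, map_mul, map_mul, TTF hT h, TTK hT h]
    · rw [TTF hT h, TF hT, TF hT, map_neg, map_neg, map_mul, map_mul, TTE hT h, TTK' hT h]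
    · rw [TTK hT h, TK hT, TK hT, TTK' hT h]
  · rw [TFf hT hcb.symm hbc, TEf hT hcb.symm hbc, TKf hT hcb.symm hbc]
    rcases cartan_cases D a c with rfl | ⟨hac, hne⟩ | ⟨hac, hne⟩
    · rw [h'] at hbc; exact absurd hbc (by simp)
    · refine ⟨?_, ?_, ?_⟩
      · rw [TEa hT hac]
        simp only [map_sub, map_mul, map_smul]
        rw [TTE hT h, TEf hT hcb.symm hbc, TEa hT hac, TEa hT h']
        exact braid_aux' _ (rEE D hcb.symm hbc)
      · rw [TFa hT hac]
        simp only [map_sub, map_mul, map_smul]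
        rw [TTF hT h, TFf hT hcb.symm hbc, TFa hT hac, TFa hT h']
        exact braid_aux _ (rFF D hcb.symm hbc)
      · rw [TKa hT hac]
        simp only [map_mul]
        rw [TTK hT h, TKf hT hcb.symm hbc, TKa hT hac, TKa hT h', mul_assoc]
    · rw [TFf hT hne hac, TEf hT hne hac, TKf hT hne hac, TFf hT hcb.symm hbc, TEf hT hcb.symm hbc,
        TKf hT hcb.symm hbc, TFf hT hne hac, TEf hT hne hac, TKf hT hne hac]
      exact ⟨rfl, rfl, rfl⟩

theorem braid3 (hT : IsLusztigAuts D T) {a b : I} (h : D.adj a b = true) (x : Uq D) :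
    T a (T b (T a x)) = T b (T a (T b x)) := by
  have h' : D.adj b a = true := by rw [D.symm]; exact h
  have key : ∀ c, T a (T b (T a (EE D c))) = T b (T a (T b (EE D c))) ∧
      T a (T b (T a (FF D c))) = T b (T a (T b (FF D c))) ∧
      T a (T b (T a (KK D c))) = T b (T a (T b (KK D c))) := by
    intro c
    by_cases h1 : c = a ∨ (c ≠ b ∧ D.adj b c = false)
    · exact braid_gen hT h c h1
    · have h2 : c = b ∨ (c ≠ a ∧ D.adj a c = false) := by
        by_cases hcb : c = b
        · exact Or.inl hcb
        · right
          have h3 : c ≠ a := fun e => h1 (Or.inl e)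
          have h4 : D.adj b c = true := by
            by_contra h5; exact h1 (Or.inr ⟨hcb, by simpa using h5⟩)
          exact ⟨h3, no_triangle h' h4⟩
      obtain ⟨u, v, w⟩ := braid_gen hT h' c h2
      exact ⟨u.symm, v.symm, w.symm⟩
  have := hom_ext' D (f := (T a).toAlgHom.comp ((T b).toAlgHom.comp (T a).toAlgHom))
    (g := (T b).toAlgHom.comp ((T a).toAlgHom.comp (T b).toAlgHom)) (fun c => (key c).1)
    (fun c => (key c).2.1) (fun c => (key c).2.2)
  exact DFunLike.congr_fun this x

theorem far_gen (hT : IsLusztigAuts D T) {a b : I} (hab : a ≠ b) (h : D.adj a b = false) (c : I)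
    (hc : c = a ∨ (c ≠ b ∧ D.adj b c = false)) :
    T a (T b (EE D c)) = T b (T a (EE D c)) ∧
    T a (T b (FF D c)) = T b (T a (FF D c)) ∧
    T a (T b (KK D c)) = T b (T a (KK D c)) := by
  have h' : D.adj b a = false := by rw [D.symm]; exact h
  rcases hc with rfl | ⟨hcb, hbc⟩
  · rw [TFf hT hab.symm h', TEf hT hab.symm h', TKf hT hab.symm h', TF hT, TE hT, TK hT,
      TK'f hT hab.symm h']
    simp only [map_neg, map_mul]
    rw [TFf hT hab.symm h', TEf hT hab.symm h', TKf hT hab.symm h', TK'f hT hab.symm h']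
    exact ⟨rfl, rfl, trivial⟩
  · rw [TFf hT hcb.symm hbc, TEf hT hcb.symm hbc, TKf hT hcb.symm hbc]
    rcases cartan_cases D a c with rfl | ⟨hac, hne⟩ | ⟨hac, hne⟩
    · rw [TF hT, TE hT, TK hT, TK'f hT hab.symm h']
      simp only [map_neg, map_mul]
      rw [TFf hT hab.symm h', TEf hT hab.symm h', TKf hT hab.symm h', TK'f hT hab.symm h']
      exact ⟨rfl, rfl, trivial⟩
    · rw [TEa hT hac, TFa hT hac, TKa hT hac]
      simp only [map_sub, map_mul, map_smul]
      rw [TFf hT hab.symm h', TEf hT hab.symm h', TKf hT hab.symm h',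
        TFf hT hcb.symm hbc, TEf hT hcb.symm hbc, TKf hT hcb.symm hbc]
      exact ⟨rfl, rfl, rfl⟩
    · rw [TFf hT hne hac, TEf hT hne hac, TKf hT hne hac, TFf hT hcb.symm hbc, TEf hT hcb.symm hbc,
        TKf hT hcb.symm hbc]
      exact ⟨rfl, rfl, rfl⟩

theorem braid2 (hT : IsLusztigAuts D T) {a b : I} (hab : a ≠ b) (h : D.adj a b = false) (x : Uq D) :
    T a (T b x) = T b (T a x) := by
  have h' : D.adj b a = false := by rw [D.symm]; exact h
  have key : ∀ c, T a (T b (EE D c)) = T b (T a (EE D c)) ∧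
      T a (T b (FF D c)) = T b (T a (FF D c)) ∧
      T a (T b (KK D c)) = T b (T a (KK D c)) := by
    intro c
    by_cases h1 : c = a ∨ (c ≠ b ∧ D.adj b c = false)
    · exact far_gen hT hab h c h1
    by_cases h2 : c = b ∨ (c ≠ a ∧ D.adj a c = false)
    · obtain ⟨u, v, w⟩ := far_gen hT hab.symm h' c h2
      exact ⟨u.symm, v.symm, w.symm⟩
    push Not at h1 h2
    have hbc : D.adj b c = true := by simpa using h1.2 h2.1
    have hac : D.adj a c = true := by simpa using h2.2 h1.1
    refine ⟨?_, ?_, ?_⟩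
    · rw [TEa hT hac, TEa hT hbc]
      simp only [map_sub, map_mul, map_smul]
      rw [TEa hT hac, TEa hT hbc, TEf hT hab h, TEf hT hab.symm h']
      exact far_aux' _ (rEE D hab h)
    · rw [TFa hT hac, TFa hT hbc]
      simp only [map_sub, map_mul, map_smul]
      rw [TFa hT hac, TFa hT hbc, TFf hT hab h, TFf hT hab.symm h']
      exact far_aux _ (rFF D hab h)
    · rw [TKa hT hac, TKa hT hbc]
      simp only [map_mul]
      rw [TKa hT hac, TKa hT hbc, TKf hT hab h, TKf hT hab.symm h', ← mul_assoc, ← mul_assoc, rKK D b a]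
  have := hom_ext' D (f := (T a).toAlgHom.comp (T b).toAlgHom)
    (g := (T b).toAlgHom.comp (T a).toAlgHom) (fun c => (key c).1)
    (fun c => (key c).2.1) (fun c => (key c).2.2)
  exact DFunLike.congr_fun this x

/-- `applyT` as an algebra automorphism -/
noncomputable def TT (T : I → (Uq D ≃ₐ[𝕂] Uq D)) : List I → (Uq D ≃ₐ[𝕂] Uq D)
  | [] => AlgEquiv.refl
  | i :: l => (TT T l).trans (T i)

theorem TT_eq (l : List I) (x : Uq D) : applyT T l x = TT T l x := by
  induction l with
  | nil => rfl
  | cons i l ih => show T i (applyT T l x) = T i (TT T l x); rw [ih]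

theorem TT_cons (i : I) (l : List I) (x : Uq D) : TT T (i :: l) x = T i (TT T l x) := rfl

theorem TT_append (l l' : List I) (x : Uq D) : TT T (l ++ l') x = TT T l (TT T l' x) := by
  induction l with
  | nil => rfl
  | cons i l ih => show T i (TT T (l ++ l') x) = _; rw [ih]; rfl

theorem TT_braid (hT : IsLusztigAuts D T) {w w' : List I} (h : BraidMove D w w') (x : Uq D) :
    TT T w x = TT T w' x := by
  rcases h with ⟨w1, w2, a, b, hab, h, rfl, rfl⟩ | ⟨w1, w2, a, b, h, rfl, rfl⟩
  · simp only [TT_append, TT_cons]; rw [braid2 hT hab h]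
  · simp only [TT_append, TT_cons]; rw [braid3 hT h]

theorem TT_braids (hT : IsLusztigAuts D T) {w w' : List I}
    (h : Relation.ReflTransGen (BraidMove D) w w') (x : Uq D) : TT T w x = TT T w' x := by
  induction h with
  | refl => rfl
  | tail _ hb ih => rw [ih, TT_braid hT hb]

theorem TT_congr (hT : IsLusztigAuts D T) {w w' : List I} (h : Red D w) (h' : Red D w')
    (e : actL D w = actL D w') (x : Uq D) : TT T w x = TT T w' x :=
  TT_braids hT (matsumoto D _ w w' rfl h h' e) x

theorem FF_mem (i : I) : FF D i ∈ Uminus D := Algebra.subset_adjoin ⟨i, rfl⟩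

theorem simple_inj {i j : I} (h : (simpleRoot i : I → ℤ) = simpleRoot j) : i = j := by
  have := congrFun h i
  by_contra hne
  simp [simpleRoot, hne] at this

theorem simple_indec {u v : I → ℤ} (hu : 0 ≤ u) (hv : 0 ≤ v) (hu0 : u ≠ 0) (hv0 : v ≠ 0) {m : I} :
    u + v ≠ simpleRoot m := by
  intro h
  have h1 : ∀ j, j ≠ m → u j = 0 ∧ v j = 0 := by
    intro j hj
    have e := congrFun h j
    have a := hu j
    have b := hv j
    simp [simpleRoot, hj] at e a b
    omega
  have h2 : u m ≠ 0 := fun e => hu0 (funext fun j => by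
    by_cases hj : j = m
    · rw [hj]; exact e
    · exact (h1 j hj).1)
  have h3 : v m ≠ 0 := fun e => hv0 (funext fun j => by
    by_cases hj : j = m
    · rw [hj]; exact e
    · exact (h1 j hj).2)
  have e := congrFun h m
  have a := hu m
  have b := hv m
  simp [simpleRoot] at e a b
  omega

theorem rootv (hT : IsLusztigAuts D T) (n : ℕ) : ∀ (u : List I) (k : I), u.length = n → Red D u →
    0 ≤ actL D u (simpleRoot k) → TT T u (FF D k) ∈ Uminus D ∧
      ∀ j, actL D u (simpleRoot k) = simpleRoot j → TT T u (FF D k) = FF D j := by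
  induction n using Nat.strong_induction_on with
  | _ n ih =>
    intro u k hn hu hp
    rcases List.eq_nil_or_concat u with rfl | ⟨u', j, rfl⟩
    · refine ⟨FF_mem k, fun j hj => ?_⟩
      rw [simple_inj hj]; rfl
    rw [List.concat_eq_append] at *
    have hu' := Red.prefix D hu
    have hpj := red_snoc_pos D hu
    rw [List.length_append, List.length_singleton] at hn
    have e1 : TT T (u' ++ [j]) (FF D k) = TT T u' (T j (FF D k)) := TT_append _ _ _
    rw [e1, actL_snoc] at *
    rcases cartan_cases D j k with rfl | ⟨hjk, hne⟩ | ⟨hjk, hne⟩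
    · exfalso
      have := actL_snoc_simple D u' j
      rw [actL_snoc] at this
      rw [this] at hp
      exact root_not_both D hpj (by simpa using hp)
    · have hkj : D.adj k j = true := by rw [D.symm]; exact hjk
      rw [sref_adj D hjk] at *
      rcases root_sign D u' k with h | h
      · obtain ⟨a1, _⟩ := ih u'.length (by omega) u' k rfl hu' h
        obtain ⟨a2, _⟩ := ih u'.length (by omega) u' j rfl hu' hpj
        rw [TFa hT hjk]
        simp only [map_sub, map_mul, map_smul]
        refine ⟨Subalgebra.sub_mem _ (Subalgebra.mul_mem _ a1 a2)
          (Subalgebra.smul_mem _ (Subalgebra.mul_mem _ a2 a1) _), fun m hm => ?_⟩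
        rw [map_add] at hm
        exact absurd hm (simple_indec hpj h (root_ne D _ _) (root_ne D _ _))
      · obtain ⟨u'', hlen, heq, hred⟩ := exch_red D hu' h
        have e2 : TT T u' (T j (FF D k)) = TT T u'' (FF D j) := by
          rw [← TT_congr hT hred hu' heq, TT_append]
          show TT T u'' (T k (T j (FF D k))) = _
          rw [TTF hT hkj]
        have e3 : actL D u' (simpleRoot j + simpleRoot k) = actL D u'' (simpleRoot j) := by
          rw [← heq, actL_snoc, add_comm (simpleRoot j), ← sref_adj D hkj, sref_sref]
        rw [e3] at hp
        rw [e2, e3]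
        exact ih u''.length (by omega) u'' j rfl (Red.prefix D hred) hp
    · rw [sref_far D hne hjk] at *
      rw [TFf hT hne hjk]
      exact ih u'.length (by omega) u' k rfl hu' hp

end br
end CB

namespace CB

theorem serre_c1 {𝕜 A : Type*} [Field 𝕜] [Ring A] [Algebra 𝕜 A] {q : 𝕜} (hq : q ≠ 0) (d : 𝕜)
    {k k' e f1 f2 : A} (h1 : k * f1 = (q ^ 2)⁻¹ • (f1 * k)) (h1' : k' * f1 = q ^ 2 • (f1 * k'))
    (h2 : k * f2 = q • (f2 * k)) (h2' : k' * f2 = q⁻¹ • (f2 * k'))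
    (he1 : e * f1 = f1 * e + d • (k - k')) (he2 : e * f2 = f2 * e) :
    e * (f1 ^ 2 * f2 + f2 * f1 ^ 2 - (q + q⁻¹) • (f1 * f2 * f1)) =
      (f1 ^ 2 * f2 + f2 * f1 ^ 2 - (q + q⁻¹) • (f1 * f2 * f1)) * e := by
  have a1 : ∀ x, k * (f1 * x) = (q ^ 2)⁻¹ • (f1 * (k * x)) := fun x => by
    rw [← mul_assoc, h1, smul_mul_assoc, mul_assoc]
  have a1' : ∀ x, k' * (f1 * x) = q ^ 2 • (f1 * (k' * x)) := fun x => by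
    rw [← mul_assoc, h1', smul_mul_assoc, mul_assoc]
  have a2 : ∀ x, k * (f2 * x) = q • (f2 * (k * x)) := fun x => by
    rw [← mul_assoc, h2, smul_mul_assoc, mul_assoc]
  have a2' : ∀ x, k' * (f2 * x) = q⁻¹ • (f2 * (k' * x)) := fun x => by
    rw [← mul_assoc, h2', smul_mul_assoc, mul_assoc]
  have a3 : ∀ x, e * (f1 * x) = f1 * (e * x) + d • (k * x - k' * x) := fun x => by
    rw [← mul_assoc, he1, add_mul, mul_assoc, smul_mul_assoc, sub_mul]
  have a4 : ∀ x, e * (f2 * x) = f2 * (e * x) := fun x => by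
    rw [← mul_assoc, he2, mul_assoc]
  simp only [pow_two f1, mul_add, add_mul, mul_sub, sub_mul, mul_smul_comm, smul_mul_assoc, mul_assoc,
    a1, a1', a2, a2', a3, a4, h1, h1', h2, h2', he1, he2, smul_sub, smul_add]
  match_scalars <;> field_simp <;> ring

theorem serre_c2 {𝕜 A : Type*} [Field 𝕜] [Ring A] [Algebra 𝕜 A] {q : 𝕜} (hq : q ≠ 0) (d : 𝕜)
    {k k' e f1 f2 : A} (h2 : k * f1 = q • (f1 * k)) (h2' : k' * f1 = q⁻¹ • (f1 * k'))
    (he1 : e * f2 = f2 * e + d • (k - k')) (he2 : e * f1 = f1 * e) :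
    e * (f1 ^ 2 * f2 + f2 * f1 ^ 2 - (q + q⁻¹) • (f1 * f2 * f1)) =
      (f1 ^ 2 * f2 + f2 * f1 ^ 2 - (q + q⁻¹) • (f1 * f2 * f1)) * e := by
  have a2 : ∀ x, k * (f1 * x) = q • (f1 * (k * x)) := fun x => by
    rw [← mul_assoc, h2, smul_mul_assoc, mul_assoc]
  have a2' : ∀ x, k' * (f1 * x) = q⁻¹ • (f1 * (k' * x)) := fun x => by
    rw [← mul_assoc, h2', smul_mul_assoc, mul_assoc]
  have a3 : ∀ x, e * (f2 * x) = f2 * (e * x) + d • (k * x - k' * x) := fun x => by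
    rw [← mul_assoc, he1, add_mul, mul_assoc, smul_mul_assoc, sub_mul]
  have a4 : ∀ x, e * (f1 * x) = f1 * (e * x) := fun x => by
    rw [← mul_assoc, he2, mul_assoc]
  simp only [pow_two f1, mul_add, add_mul, mul_sub, sub_mul, mul_smul_comm, smul_mul_assoc, mul_assoc,
    a2, a2', a3, a4, h2, h2', he1, he2, smul_sub, smul_add]
  match_scalars <;> field_simp <;> ring

theorem far_c {𝕜 A : Type*} [Field 𝕜] [Ring A] [Algebra 𝕜 A] (d : 𝕜)
    {k k' e f1 f2 : A} (h2 : k * f2 = f2 * k) (h2' : k' * f2 = f2 * k')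
    (he1 : e * f1 = f1 * e + d • (k - k')) (he2 : e * f2 = f2 * e) :
    e * (f1 * f2 - f2 * f1) = (f1 * f2 - f2 * f1) * e := by
  have a3 : ∀ x, e * (f1 * x) = f1 * (e * x) + d • (k * x - k' * x) := fun x => by
    rw [← mul_assoc, he1, add_mul, mul_assoc, smul_mul_assoc, sub_mul]
  have a4 : ∀ x, e * (f2 * x) = f2 * (e * x) := fun x => by
    rw [← mul_assoc, he2, mul_assoc]
  simp only [mul_sub, sub_mul, mul_assoc, a3, a4, he1, he2, h2, h2', mul_add, mul_smul_comm]
  abel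

theorem comm_c {𝕜 A : Type*} [Field 𝕜] [Ring A] [Algebra 𝕜 A] (s : 𝕜) {e f1 f2 : A}
    (h1 : e * f1 = f1 * e) (h2 : e * f2 = f2 * e) :
    e * (f1 ^ 2 * f2 + f2 * f1 ^ 2 - s • (f1 * f2 * f1)) =
      (f1 ^ 2 * f2 + f2 * f1 ^ 2 - s • (f1 * f2 * f1)) * e := by
  have c1 : Commute e f1 := h1
  have c2 : Commute e f2 := h2
  exact ((((c1.pow_right 2).mul_right c2).add_right (c2.mul_right (c1.pow_right 2))).sub_right
    ((((c1.mul_right c2).mul_right c1)).smul_right s))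

theorem comm_k {𝕜 A : Type*} [Field 𝕜] [Ring A] [Algebra 𝕜 A] (s t u : 𝕜) {k f1 f2 : A}
    (h1 : k * f1 = t • (f1 * k)) (h2 : k * f2 = u • (f2 * k)) :
    k * (f1 ^ 2 * f2 + f2 * f1 ^ 2 - s • (f1 * f2 * f1)) =
      (t ^ 2 * u) • ((f1 ^ 2 * f2 + f2 * f1 ^ 2 - s • (f1 * f2 * f1)) * k) := by
  have a1 : ∀ x, k * (f1 * x) = t • (f1 * (k * x)) := fun x => by
    rw [← mul_assoc, h1, smul_mul_assoc, mul_assoc]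
  have a2 : ∀ x, k * (f2 * x) = u • (f2 * (k * x)) := fun x => by
    rw [← mul_assoc, h2, smul_mul_assoc, mul_assoc]
  simp only [pow_two f1, mul_add, add_mul, mul_sub, sub_mul, mul_smul_comm, smul_mul_assoc, mul_assoc,
    a1, a2, h1, h2, smul_sub, smul_add]
  match_scalars <;> ring

theorem comm_k2 {𝕜 A : Type*} [Field 𝕜] [Ring A] [Algebra 𝕜 A] (t u : 𝕜) {k f1 f2 : A}
    (h1 : k * f1 = t • (f1 * k)) (h2 : k * f2 = u • (f2 * k)) :
    k * (f1 * f2 - f2 * f1) = (t * u) • ((f1 * f2 - f2 * f1) * k) := by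
  have a1 : ∀ x, k * (f1 * x) = t • (f1 * (k * x)) := fun x => by
    rw [← mul_assoc, h1, smul_mul_assoc, mul_assoc]
  have a2 : ∀ x, k * (f2 * x) = u • (f2 * (k * x)) := fun x => by
    rw [← mul_assoc, h2, smul_mul_assoc, mul_assoc]
  simp only [mul_sub, sub_mul, mul_assoc, mul_smul_comm, a1, a2, h1, h2, smul_sub]
  match_scalars <;> ring

theorem ef_flip {𝕜 A : Type*} [Field 𝕜] [Ring A] [Algebra 𝕜 A] {d : 𝕜} {k k' e f : A}
    (h : e * f = f * e + d • (k - k')) : f * e = e * f + d • (k' - k) := by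
  rw [h, add_assoc, ← smul_add, sub_add_sub_cancel, sub_self, smul_zero, add_zero]

theorem far_c' {A : Type*} [Ring A] {e f1 f2 : A}
    (h : e * (f1 * f2 - f2 * f1) = (f1 * f2 - f2 * f1) * e) :
    e * (f2 * f1 - f1 * f2) = (f2 * f1 - f1 * f2) * e := by
  rw [← neg_sub, mul_neg, neg_mul, h]

theorem far_c3 {A : Type*} [Ring A] {e f1 f2 : A} (c1 : e * f1 = f1 * e) (c2 : e * f2 = f2 * e) :
    e * (f1 * f2 - f2 * f1) = (f1 * f2 - f2 * f1) * e := by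
  have c1 : Commute e f1 := c1
  have c2 : Commute e f2 := c2
  exact (c1.mul_right c2).sub_right (c2.mul_right c1)

section verma
variable {I : Type} [Fintype I] [DecidableEq I] (D : ADEData I) (z : ℤ)

/-- the free module on words -/
abbrev VV (I : Type) := List I →₀ 𝕂

noncomputable def ev (l : List I) : VV I := Finsupp.single l 1

noncomputable def chi (i : I) : List I → 𝕂
  | [] => qq ^ z
  | j :: l => qq ^ (-cartan D i j) * chi i l

theorem chi_ne (i : I) (l : List I) : chi D z i l ≠ 0 := by
  induction l with
  | nil => exact zpow_ne_zero _ qq_ne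
  | cons j l ih => exact mul_ne_zero (zpow_ne_zero _ qq_ne) ih

noncomputable def lc (f : List I → VV I) : Module.End 𝕂 (VV I) := Finsupp.linearCombination 𝕂 f

theorem lc_ev (f : List I → VV I) (l : List I) : lc f (ev l) = f l := by
  simp [lc, ev]

theorem op_ext {f g : Module.End 𝕂 (VV I)} (h : ∀ l, f (ev l) = g (ev l)) : f = g := by
  apply Finsupp.lhom_ext'
  intro l
  apply LinearMap.ext_ring
  exact h l

noncomputable def oF (j : I) : Module.End 𝕂 (VV I) := lc (fun l => ev (j :: l))
noncomputable def oK (i : I) : Module.End 𝕂 (VV I) := lc (fun l => chi D z i l • ev l)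
noncomputable def oK' (i : I) : Module.End 𝕂 (VV I) := lc (fun l => (chi D z i l)⁻¹ • ev l)

noncomputable def eE (i : I) : List I → VV I
  | [] => 0
  | j :: l => oF j (eE i l) +
      if i = j then (qq - qq⁻¹)⁻¹ • (chi D z i l • ev l - (chi D z i l)⁻¹ • ev l) else 0

noncomputable def oE (i : I) : Module.End 𝕂 (VV I) := lc (eE D z i)

theorem oF_ev (j : I) (l : List I) : oF j (ev l) = ev (j :: l) := lc_ev _ _
theorem oK_ev (i : I) (l : List I) : oK D z i (ev l) = chi D z i l • ev l := lc_ev _ _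
theorem oK'_ev (i : I) (l : List I) : oK' D z i (ev l) = (chi D z i l)⁻¹ • ev l := lc_ev _ _
theorem oE_ev (i : I) (l : List I) : oE D z i (ev l) = eE D z i l := lc_ev _ _

theorem oKK' (i : I) : oK D z i * oK' D z i = 1 := op_ext fun l => by
  simp only [Module.End.mul_apply, oK'_ev, map_smul, oK_ev, smul_smul, Module.End.one_apply]
  rw [inv_mul_cancel₀ (chi_ne D z i l), one_smul]

theorem oK'K (i : I) : oK' D z i * oK D z i = 1 := op_ext fun l => by
  simp only [Module.End.mul_apply, oK'_ev, map_smul, oK_ev, smul_smul, Module.End.one_apply]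
  rw [mul_inv_cancel₀ (chi_ne D z i l), one_smul]

theorem oKK (i j : I) : oK D z i * oK D z j = oK D z j * oK D z i := op_ext fun l => by
  simp only [Module.End.mul_apply, map_smul, oK_ev, smul_smul]
  rw [mul_comm]

theorem oKF (i j : I) : oK D z i * oF j = qq ^ (-cartan D i j) • (oF j * oK D z i) := op_ext fun l => by
  simp only [Module.End.mul_apply, LinearMap.smul_apply, map_smul, oK_ev, oF_ev, smul_smul]
  rfl

theorem oK'F (i j : I) : oK' D z i * oF j = qq ^ (cartan D i j) • (oF j * oK' D z i) := by
  have := inv_comm (A := Module.End 𝕂 (VV I)) (zpow_ne_zero (-cartan D i j) qq_ne) (oKK' D z i) (oK'K D z i) (oKF D z i j)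
  rwa [zpow_neg, inv_inv] at this

theorem oEF (i : I) : oE D z i * oF i = oF i * oE D z i + (qq - qq⁻¹)⁻¹ • (oK D z i - oK' D z i) :=
  op_ext fun l => by
    simp only [Module.End.mul_apply, LinearMap.add_apply, LinearMap.smul_apply, LinearMap.sub_apply,
      oK_ev, oK'_ev, oF_ev, oE_ev]
    simp [eE]

theorem oEFd {i j : I} (h : i ≠ j) : oE D z i * oF j = oF j * oE D z i :=
  op_ext fun l => by
    simp only [Module.End.mul_apply, oF_ev, oE_ev]
    simp [eE, h]

theorem oKE (i j : I) : oK D z i * oE D z j = qq ^ (cartan D i j) • (oE D z j * oK D z i) :=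
  op_ext fun l => by
    induction l with
    | nil => simp [oE_ev, oK_ev, eE]
    | cons m l ih =>
      have h1 : ∀ x, oK D z i (oF m x) = qq ^ (-cartan D i m) • oF m (oK D z i x) := fun x =>
        DFunLike.congr_fun (oKF D z i m) x
      simp only [Module.End.mul_apply, LinearMap.smul_apply, oE_ev, oK_ev, map_smul] at ih ⊢
      have hq : qq ^ (cartan D i m) ≠ 0 := zpow_ne_zero _ qq_ne
      rw [eE, map_add, h1, ih, chi, map_smul, map_smul]
      split_ifs with hjm
      · subst hjm
        simp only [map_sub, map_smul, oK_ev, smul_add, smul_smul, smul_sub, zpow_neg]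
        congr 1
        · congr 1; ring
        · congr 2 <;> field_simp
      · simp only [map_zero, smul_zero, add_zero, smul_smul]
        congr 1; ring

theorem oK'E (i j : I) : oK' D z i * oE D z j = qq ^ (-cartan D i j) • (oE D z j * oK' D z i) := by
  have := inv_comm (A := Module.End 𝕂 (VV I)) (zpow_ne_zero (cartan D i j) qq_ne) (oKK' D z i) (oK'K D z i) (oKE D z i j)
  rwa [← zpow_neg] at this

theorem op_zero {X : Module.End 𝕂 (VV I)} (h0 : X (ev []) = 0) (h : ∀ k, oF k * X = X * oF k) : X = 0 :=
  op_ext fun l => by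
    induction l with
    | nil => exact h0
    | cons j l ih =>
      rw [← oF_ev]
      have := DFunLike.congr_fun (h j) (ev l)
      simp only [Module.End.mul_apply] at this
      rw [← this, ih]; simp

theorem oSE {i j : I} (h : D.adj i j = true) : oE D z i ^ 2 * oE D z j + oE D z j * oE D z i ^ 2 =
    (qq + qq⁻¹) • (oE D z i * oE D z j * oE D z i) := by
  have hne := adj_ne D h
  have h' : D.adj j i = true := by rw [D.symm]; exact h
  rw [← sub_eq_zero]
  apply op_zero
  · simp [pow_two, oE_ev, eE]
  · intro k
    have hf : ∀ m, oF m * oE D z m = oE D z m * oF m + (qq - qq⁻¹)⁻¹ • (oK' D z m - oK D z m) := fun m =>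
      ef_flip (A := Module.End 𝕂 (VV I)) (oEF D z m)
    by_cases hi : k = i
    · subst hi
      refine serre_c1 (A := Module.End 𝕂 (VV I)) qq_ne (qq - qq⁻¹)⁻¹ (k := oK' D z k) (k' := oK D z k) ?_ ?_ ?_ ?_ (hf k) (oEFd D z hne.symm).symm
      · rw [oK'E, cartan_self]; congr 1
      · rw [oKE, cartan_self]; congr 1
      · rw [oK'E, cartan_adj D h]; norm_num
      · rw [oKE, cartan_adj D h, zpow_neg_one]
    by_cases hj : k = j
    · subst hj
      refine serre_c2 (A := Module.End 𝕂 (VV I)) qq_ne (qq - qq⁻¹)⁻¹ (k := oK' D z k) (k' := oK D z k) ?_ ?_ (hf k) (oEFd D z hne).symm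
      · rw [oK'E, cartan_adj D h']; norm_num
      · rw [oKE, cartan_adj D h', zpow_neg_one]
    exact comm_c (A := Module.End 𝕂 (VV I)) _ (oEFd D z (Ne.symm hi)).symm (oEFd D z (Ne.symm hj)).symm

theorem oEE {i j : I} (hne : i ≠ j) (h : D.adj i j = false) : oE D z i * oE D z j = oE D z j * oE D z i := by
  have h' : D.adj j i = false := by rw [D.symm]; exact h
  rw [← sub_eq_zero]
  apply op_zero
  · simp [oE_ev, eE]
  · intro k
    have hf : ∀ m, oF m * oE D z m = oE D z m * oF m + (qq - qq⁻¹)⁻¹ • (oK' D z m - oK D z m) := fun m =>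
      ef_flip (A := Module.End 𝕂 (VV I)) (oEF D z m)
    by_cases hi : k = i
    · subst hi
      refine far_c (A := Module.End 𝕂 (VV I)) (qq - qq⁻¹)⁻¹ (k := oK' D z k) (k' := oK D z k) ?_ ?_ (hf k) (oEFd D z hne.symm).symm
      · rw [oK'E, cartan_far D hne h]; simp
      · rw [oKE, cartan_far D hne h]; simp
    by_cases hj : k = j
    · subst hj
      have := far_c (A := Module.End 𝕂 (VV I)) (qq - qq⁻¹)⁻¹ (k := oK' D z k) (k' := oK D z k) (e := oF k)
        (f1 := oE D z k) (f2 := oE D z i) (by rw [oK'E, cartan_far D hne.symm h']; simp)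
        (by rw [oKE, cartan_far D hne.symm h']; simp) (hf k) (oEFd D z hne).symm
      exact far_c' (A := Module.End 𝕂 (VV I)) this
    exact far_c3 (A := Module.End 𝕂 (VV I)) (oEFd D z (Ne.symm hi)).symm (oEFd D z (Ne.symm hj)).symm

noncomputable def sF (i j : I) : Module.End 𝕂 (VV I) :=
  oF i ^ 2 * oF j + oF j * oF i ^ 2 - (qq + qq⁻¹) • (oF i * oF j * oF i)

/-- submodules that contain the Serre relations -/
def IsN (S : Submodule 𝕂 (VV I)) : Prop :=
  (∀ i j x, D.adj i j = true → sF i j x ∈ S) ∧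
  (∀ i j x, i ≠ j → D.adj i j = false → (oF i * oF j - oF j * oF i) x ∈ S) ∧
  (∀ j x, x ∈ S → oF j x ∈ S)

noncomputable def NN : Submodule 𝕂 (VV I) := sInf {S | IsN D S}

theorem NN_is : IsN D (NN D) := by
  refine ⟨fun i j x h => ?_, fun i j x h h' => ?_, fun j x h => ?_⟩
  · exact Submodule.mem_sInf.2 fun S hS => hS.1 i j x h
  · exact Submodule.mem_sInf.2 fun S hS => hS.2.1 i j x h h'
  · exact Submodule.mem_sInf.2 fun S hS => hS.2.2 j x (Submodule.mem_sInf.1 h S hS)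

theorem NN_le {S : Submodule 𝕂 (VV I)} (h : IsN D S) : NN D ≤ S := sInf_le h

theorem NN_K_aux (X : Module.End 𝕂 (VV I)) (s : I → 𝕂) (hX : ∀ j, X * oF j = s j • (oF j * X)) :
    NN D ≤ (NN D).comap X := by
  obtain ⟨h1, h2, h3⟩ := NN_is D
  apply NN_le
  refine ⟨fun i j x h => ?_, fun i j x h h' => ?_, fun j x h => ?_⟩
  · have := DFunLike.congr_fun (comm_k (A := Module.End 𝕂 (VV I)) (qq + qq⁻¹) _ _ (hX i) (hX j)) x
    show (X * sF i j) x ∈ NN D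
    rw [sF, this]
    exact Submodule.smul_mem _ _ (h1 i j _ h)
  · have := DFunLike.congr_fun (comm_k2 (A := Module.End 𝕂 (VV I)) _ _ (hX i) (hX j)) x
    show (X * (oF i * oF j - oF j * oF i)) x ∈ NN D
    rw [this]
    exact Submodule.smul_mem _ _ (h2 i j _ h h')
  · show (X * oF j) x ∈ NN D
    rw [hX]
    exact Submodule.smul_mem _ _ (h3 j _ h)

theorem NN_K (i : I) : NN D ≤ (NN D).comap (oK D z i) := NN_K_aux D _ _ (oKF D z i)
theorem NN_K' (i : I) : NN D ≤ (NN D).comap (oK' D z i) := NN_K_aux D _ _ (oK'F D z i)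
theorem NN_F (i : I) : NN D ≤ (NN D).comap (oF i) := fun x h => (NN_is D).2.2 i x h

theorem NN_E (k : I) : NN D ≤ (NN D).comap (oE D z k) := by
  obtain ⟨h1, h2, h3⟩ := NN_is D
  suffices h : NN D ≤ NN D ⊓ (NN D).comap (oE D z k) from h.trans inf_le_right
  apply NN_le
  refine ⟨fun i j x h => ⟨h1 i j x h, ?_⟩, fun i j x h h' => ⟨h2 i j x h h', ?_⟩, fun j x h => ⟨h3 j x h.1, ?_⟩⟩
  · have hne := adj_ne D h
    have h' : D.adj j i = true := by rw [D.symm]; exact h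
    have : oE D z k * sF i j = sF i j * oE D z k := by
      by_cases hi : k = i
      · subst hi
        refine serre_c1 (A := Module.End 𝕂 (VV I)) qq_ne (qq - qq⁻¹)⁻¹ (k := oK D z k) (k' := oK' D z k) ?_ ?_ ?_ ?_ (oEF D z k) (oEFd D z hne)
        · rw [oKF, cartan_self]; congr 1
        · rw [oK'F, cartan_self]; congr 1
        · rw [oKF, cartan_adj D h]; norm_num
        · rw [oK'F, cartan_adj D h, zpow_neg_one]
      by_cases hj : k = j
      · subst hj
        refine serre_c2 (A := Module.End 𝕂 (VV I)) qq_ne (qq - qq⁻¹)⁻¹ (k := oK D z k) (k' := oK' D z k) ?_ ?_ (oEF D z k) (oEFd D z hne.symm)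
        · rw [oKF, cartan_adj D h']; norm_num
        · rw [oK'F, cartan_adj D h', zpow_neg_one]
      exact comm_c (A := Module.End 𝕂 (VV I)) _ (oEFd D z hi) (oEFd D z hj)
    show (oE D z k * sF i j) x ∈ NN D
    rw [this]
    exact h1 i j _ h
  · have h'' : D.adj j i = false := by rw [D.symm]; exact h'
    have : oE D z k * (oF i * oF j - oF j * oF i) = (oF i * oF j - oF j * oF i) * oE D z k := by
      by_cases hi : k = i
      · subst hi
        refine far_c (A := Module.End 𝕂 (VV I)) (qq - qq⁻¹)⁻¹ (k := oK D z k) (k' := oK' D z k) ?_ ?_ (oEF D z k) (oEFd D z h)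
        · rw [oKF, cartan_far D h h']; simp
        · rw [oK'F, cartan_far D h h']; simp
      by_cases hj : k = j
      · subst hj
        have := far_c (A := Module.End 𝕂 (VV I)) (qq - qq⁻¹)⁻¹ (k := oK D z k) (k' := oK' D z k) (e := oE D z k)
          (f1 := oF k) (f2 := oF i) (by rw [oKF, cartan_far D h.symm h'']; simp)
          (by rw [oK'F, cartan_far D h.symm h'']; simp) (oEF D z k) (oEFd D z h.symm)
        exact far_c' (A := Module.End 𝕂 (VV I)) this
      exact far_c3 (A := Module.End 𝕂 (VV I)) (oEFd D z hi) (oEFd D z hj)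
    show (oE D z k * (oF i * oF j - oF j * oF i)) x ∈ NN D
    rw [this]
    exact h2 i j _ h h'
  · show (oE D z k * oF j) x ∈ NN D
    by_cases hj : k = j
    · subst hj
      rw [oEF]
      exact Submodule.add_mem _ (h3 _ _ h.2) (Submodule.smul_mem _ _
        (Submodule.sub_mem _ (NN_K D z k h.1) (NN_K' D z k h.1)))
    · rw [oEFd D z hj]
      exact h3 _ _ h.2

end verma
end CB

namespace CB

section verma
variable {I : Type} [Fintype I] [DecidableEq I] (D : ADEData I) (z : ℤ)

noncomputable def opG : Gen I → Module.End 𝕂 (VV I)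
  | Gen.E i => oE D z i
  | Gen.F i => oF i
  | Gen.K i => oK D z i
  | Gen.Kinv i => oK' D z i

theorem NN_op (g : Gen I) : NN D ≤ (NN D).comap (opG D z g) := by
  cases g
  · exact NN_E D z _
  · exact NN_F D _
  · exact NN_K D z _
  · exact NN_K' D z _

abbrev MM := VV I ⧸ NN D

noncomputable def rho0 : FA I →ₐ[𝕂] Module.End 𝕂 (VV I) := FreeAlgebra.lift 𝕂 (opG D z)
noncomputable def rhoQ : FA I →ₐ[𝕂] Module.End 𝕂 (MM D) :=
  FreeAlgebra.lift 𝕂 (fun g => (NN D).mapQ (NN D) (opG D z g) (NN_op D z g))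

theorem rhoQ_mk (a : FA I) : ∀ x : VV I, rhoQ D z a ((NN D).mkQ x) = (NN D).mkQ (rho0 D z a x) := by
  induction a using FreeAlgebra.induction with
  | grade0 r => intro x; simp [AlgHom.commutes]
  | grade1 g => intro x; simp [rhoQ, rho0]
  | mul a b ha hb => intro x; rw [map_mul, map_mul, Module.End.mul_apply, Module.End.mul_apply, hb, ha]
  | add a b ha hb =>
    intro x; rw [map_add, map_add, LinearMap.add_apply, LinearMap.add_apply, hb, ha, map_add]

theorem rho0_E (i : I) : rho0 D z (gE i) = oE D z i := by simp [rho0, gE, opG]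
theorem rho0_F (i : I) : rho0 D z (gF i) = oF i := by simp [rho0, gF, opG]
theorem rho0_K (i : I) : rho0 D z (gK i) = oK D z i := by simp [rho0, gK, opG]
theorem rho0_K' (i : I) : rho0 D z (gKinv i) = oK' D z i := by simp [rho0, gKinv, opG]

theorem conj_of {A : Type*} [Ring A] [Algebra 𝕂 A] {k k' x : A} {s : 𝕂} (hk : k * k' = 1)
    (h : k * x = s • (x * k)) : k * x * k' = s • x := by
  rw [h, smul_mul_assoc, mul_assoc, hk, mul_one]

theorem sub_of {A : Type*} [Ring A] {x y z : A} (h : x = y + z) : x - y = z := by rw [h]; abel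

theorem rho_rel {a b : FA I} (h : QRel D a b) : ∀ x, rho0 D z a x - rho0 D z b x ∈ NN D := by
  have key : rho0 D z a = rho0 D z b → ∀ x, rho0 D z a x - rho0 D z b x ∈ NN D := fun e x => by
    rw [e, sub_self]; exact Submodule.zero_mem _
  have hc := @conj_of (Module.End 𝕂 (VV I)) _ _
  cases h with
  | KKinv i => apply key; simp only [map_mul, map_one, rho0_K, rho0_K', oKK']
  | KinvK i => apply key; simp only [map_mul, map_one, rho0_K, rho0_K', oK'K]
  | KcommK i j => apply key; simp only [map_mul, rho0_K]; exact oKK D z i j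
  | KEself i =>
    apply key; simp only [map_mul, map_smul, rho0_K, rho0_K', rho0_E]
    refine hc (oKK' D z i) ?_
    rw [oKE, cartan_self]; congr 1
  | KFself i =>
    apply key; simp only [map_mul, map_smul, rho0_K, rho0_K', rho0_F]
    refine hc (oKK' D z i) ?_
    rw [oKF, cartan_self]; congr 1
  | EFdiff i j h =>
    apply key; simp only [map_mul, map_sub, map_zero, rho0_F, rho0_E]
    rw [oEFd D z h, sub_self]
  | EFself i =>
    apply key; simp only [map_mul, map_sub, map_smul, rho0_F, rho0_E, rho0_K, rho0_K']
    exact sub_of (A := Module.End 𝕂 (VV I)) (oEF D z i)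
  | serreE i j h =>
    apply key; simp only [map_mul, map_add, map_pow, map_smul, rho0_E]
    exact oSE D z h
  | serreF i j h =>
    intro x
    simp only [map_mul, map_add, map_pow, map_smul, rho0_F]
    exact (NN_is D).1 i j x h
  | KEadj i j h =>
    apply key; simp only [map_mul, map_smul, rho0_K, rho0_K', rho0_E]
    refine hc (oKK' D z i) ?_
    rw [oKE, cartan_adj D h, zpow_neg_one]
  | KFadj i j h =>
    apply key; simp only [map_mul, map_smul, rho0_K, rho0_K', rho0_F]
    refine hc (oKK' D z i) ?_
    rw [oKF, cartan_adj D h, neg_neg, zpow_one]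
  | EEfar i j h h' =>
    apply key; simp only [map_mul, rho0_E]
    exact oEE D z h h'
  | FFfar i j h h' =>
    intro x
    simp only [map_mul, rho0_F]
    exact (NN_is D).2.1 i j x h h'
  | KEfar i j h h' =>
    apply key; simp only [map_mul, rho0_K, rho0_K', rho0_E]
    have := hc (oKK' D z i) (x := oE D z j) (s := 1) (by rw [oKE, cartan_far D h h', zpow_zero])
    rwa [one_smul] at this
  | KFfar i j h h' =>
    apply key; simp only [map_mul, rho0_K, rho0_K', rho0_F]
    have := hc (oKK' D z i) (x := oF j) (s := 1) (by rw [oKF, cartan_far D h h', neg_zero, zpow_zero])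
    rwa [one_smul] at this

noncomputable def rho : Uq D →ₐ[𝕂] Module.End 𝕂 (MM D) :=
  RingQuot.liftAlgHom 𝕂 ⟨rhoQ D z, fun a b h => by
    apply LinearMap.ext
    intro y
    obtain ⟨x, rfl⟩ := (NN D).mkQ_surjective y
    rw [rhoQ_mk, rhoQ_mk, ← sub_eq_zero, ← map_sub]
    exact (Submodule.Quotient.mk_eq_zero _).2 (rho_rel D z h x)⟩

theorem rho_mk (a : FA I) (x : VV I) :
    rho D z (RingQuot.mkAlgHom 𝕂 (QRel D) a) ((NN D).mkQ x) = (NN D).mkQ (rho0 D z a x) := by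
  rw [rho, RingQuot.liftAlgHom_mkAlgHom_apply, rhoQ_mk]

theorem rho_E (i : I) (x : VV I) : rho D z (EE D i) ((NN D).mkQ x) = (NN D).mkQ (oE D z i x) := by
  rw [EE, rho_mk, rho0_E]
theorem rho_F (i : I) (x : VV I) : rho D z (FF D i) ((NN D).mkQ x) = (NN D).mkQ (oF i x) := by
  rw [FF, rho_mk, rho0_F]
theorem rho_K' (i : I) (x : VV I) : rho D z (KKinv D i) ((NN D).mkQ x) = (NN D).mkQ (oK' D z i x) := by
  rw [KKinv, rho_mk, rho0_K']

noncomputable def phiV : VV I →ₗ[𝕂] Uq D :=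
  Finsupp.linearCombination 𝕂 (fun l : List I => (l.map (FF D)).prod)

theorem phiV_ev (l : List I) : phiV D (ev l) = (l.map (FF D)).prod := by simp [phiV, ev]

theorem phiV_F (j : I) (x : VV I) : phiV D (oF j x) = FF D j * phiV D x := by
  have : phiV D ∘ₗ (oF j) = LinearMap.mulLeft 𝕂 (FF D j) ∘ₗ phiV D := by
    apply Finsupp.lhom_ext'
    intro l
    apply LinearMap.ext_ring
    show phiV D (oF j (ev l)) = FF D j * phiV D (ev l)
    rw [oF_ev, phiV_ev, phiV_ev]; simp
  exact DFunLike.congr_fun this x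

theorem phiV_N : NN D ≤ LinearMap.ker (phiV D) := by
  apply NN_le
  refine ⟨fun i j x h => ?_, fun i j x h h' => ?_, fun j x h => ?_⟩
  · rw [LinearMap.mem_ker, sF]
    simp only [pow_two, LinearMap.sub_apply, LinearMap.add_apply, LinearMap.smul_apply, Module.End.mul_apply, map_sub,
      map_add, map_smul, phiV_F]
    have := congrArg (· * phiV D x) (rSF D h)
    simp only [pow_two, add_mul, smul_mul_assoc, mul_assoc] at this
    rw [this, sub_self]
  · rw [LinearMap.mem_ker]
    simp only [LinearMap.sub_apply, Module.End.mul_apply, map_sub, phiV_F]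
    rw [← mul_assoc, ← mul_assoc, rFF D h h', sub_self]
  · rw [LinearMap.mem_ker] at *
    rw [phiV_F, h, mul_zero]

noncomputable def phi : MM D →ₗ[𝕂] Uq D := (NN D).liftQ (phiV D) (phiV_N D)

theorem phi_mk (x : VV I) : phi D ((NN D).mkQ x) = phiV D x := by
  simp [phi]

theorem phi_rho {u : Uq D} (hu : u ∈ Uminus D) : ∀ m, phi D (rho D z u m) = u * phi D m := by
  induction hu using Algebra.adjoin_induction with
  | mem x hx =>
    obtain ⟨j, rfl⟩ := hx
    intro m
    obtain ⟨x, rfl⟩ := (NN D).mkQ_surjective m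
    rw [rho_F, phi_mk, phi_mk, phiV_F]
  | algebraMap r => intro m; rw [AlgHom.commutes]; simp [Algebra.algebraMap_eq_smul_one]
  | add x y _ _ hx hy => intro m; rw [map_add, LinearMap.add_apply, map_add, hx, hy, add_mul]
  | mul x y _ _ hx hy => intro m; rw [map_mul, Module.End.mul_apply, hx, hy, mul_assoc]

theorem eE_repl (i : I) (N : ℕ) : oE D (-1) i (ev (List.replicate (N + 1) i)) =
    (-(qI (N + 1 : ℤ)) ^ 2) • ev (List.replicate N i) ∧ chi D (-1) i (List.replicate N i) = qq ^ (-1 - 2 * N : ℤ) := by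
  have hq := qq_ne
  have hd := qdiff_ne
  induction N with
  | zero =>
    refine ⟨?_, by simp [chi]⟩
    rw [oE_ev]
    simp only [List.replicate, eE, if_true, chi, map_zero, zero_add, inv_inv, ← sub_smul, smul_smul]
    congr 1
    simp only [Nat.cast_zero, zero_add, qI_one]
    rw [zpow_neg_one, inv_inv, ← neg_sub qq, mul_neg, inv_mul_cancel₀ hd]; norm_num
  | succ N ih =>
    have hc : chi D (-1) i (List.replicate (N + 1) i) = qq ^ (-1 - 2 * (N + 1 : ℕ) : ℤ) := by
      rw [List.replicate_succ, chi, ih.2, cartan_self, ← zpow_add₀ hq]; congr 1; push_cast; ring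
    refine ⟨?_, hc⟩
    rw [oE_ev, List.replicate_succ, eE, ← oE_ev, ih.1, map_smul, oF_ev, ← List.replicate_succ, if_pos rfl, hc,
      ← sub_smul, smul_smul, ← add_smul]
    congr 1
    rw [← zpow_neg]
    simp only [qI]
    push_cast
    generalize hz : (N + 1 : ℤ) = z
    rw [show (-1 - 2 * z) = -(z + z + 1) by ring, neg_neg, zpow_neg, zpow_neg, zpow_neg,
      zpow_add₀ hq, zpow_add₀ hq, zpow_add₀ hq, zpow_one]
    have hz0 : qq ^ z ≠ 0 := zpow_ne_zero _ hq
    have hd2 : qq ^ 2 - 1 ≠ 0 := by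
      intro h; apply hd; field_simp; rw [mul_zero]; exact h
    generalize qq ^ z = y at *
    field_simp
    ring

theorem peel (i : I) (m : ℕ) (u : ℕ → Uq D) (hu : ∀ n, u n ∈ Uminus D)
    (h : ∑ n ∈ Finset.range m, u n * (-(KKinv D i * EE D i)) ^ n = 0) : ∀ n < m, u n = 0 := by
  set g := -(KKinv D i * EE D i) with hg
  let v : ℕ → MM D := fun N => (NN D).mkQ (ev (List.replicate N i))
  have hstep : ∀ N, ∃ r : 𝕂, r ≠ 0 ∧ rho D (-1) g (v (N + 1)) = r • v N := by
    intro N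
    obtain ⟨h1, h2⟩ := eE_repl D i N
    refine ⟨(qI (N + 1 : ℤ)) ^ 2 * (chi D (-1) i (List.replicate N i))⁻¹,
      mul_ne_zero (pow_ne_zero _ (qI_ne (by positivity))) (inv_ne_zero (chi_ne D (-1) _ _)), ?_⟩
    rw [hg, map_neg, LinearMap.neg_apply, map_mul, Module.End.mul_apply, rho_E, h1, rho_K', map_smul, oK'_ev,
      smul_smul, map_smul, ← neg_smul]
    congr 1; ring
  have h0 : rho D (-1) g (v 0) = 0 := by
    rw [hg, map_neg, LinearMap.neg_apply, map_mul, Module.End.mul_apply, rho_E, oE_ev]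
    simp [eE]
  have hpow : ∀ N, (∃ r : 𝕂, r ≠ 0 ∧ rho D (-1) (g ^ N) (v N) = r • v 0) ∧ ∀ n, N < n → rho D (-1) (g ^ n) (v N) = 0 := by
    intro N
    induction N with
    | zero =>
      refine ⟨⟨1, one_ne_zero, by simp⟩, fun n hn => ?_⟩
      obtain ⟨n, rfl⟩ : ∃ k, n = k + 1 := ⟨n - 1, by omega⟩
      rw [pow_succ, map_mul, Module.End.mul_apply, h0, map_zero]
    | succ N ih =>
      obtain ⟨⟨r, hr, h1⟩, h2⟩ := ih
      obtain ⟨s, hs, h3⟩ := hstep N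
      refine ⟨⟨s * r, mul_ne_zero hs hr, ?_⟩, fun n hn => ?_⟩
      · rw [pow_succ, map_mul, Module.End.mul_apply, h3, map_smul, h1, smul_smul]
      · obtain ⟨n, rfl⟩ : ∃ k, n = k + 1 := ⟨n - 1, by omega⟩
        rw [pow_succ, map_mul, Module.End.mul_apply, h3, map_smul, h2 n (by omega), smul_zero]
  have hphi : phi D (v 0) = 1 := by
    show phi D ((NN D).mkQ (ev (List.replicate 0 i))) = 1
    rw [phi_mk, phiV_ev]; rfl
  intro n
  induction n using Nat.strong_induction_on with
  | _ N ih =>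
    intro hN
    have h4 := congrArg (fun x => phi D (rho D (-1) x (v N))) h
    simp only [map_sum, LinearMap.sum_apply, map_zero, LinearMap.zero_apply] at h4
    rw [Finset.sum_eq_single N] at h4
    · obtain ⟨⟨r, hr, h1⟩, _⟩ := hpow N
      rw [map_mul, Module.End.mul_apply, h1, phi_rho D (-1) (hu N), map_smul, hphi, mul_smul_comm, mul_one] at h4
      exact (smul_eq_zero.1 h4).resolve_left hr
    · intro n hn hne
      rcases lt_or_gt_of_ne hne with h5 | h5
      · rw [ih n h5 (by omega), zero_mul, map_zero, LinearMap.zero_apply, map_zero]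
      · rw [map_mul, Module.End.mul_apply, (hpow N).2 n h5, map_zero, map_zero]
    · intro hn; exact absurd (Finset.mem_range.2 hN) hn

end verma
end CB

namespace CB

section pbw
variable {I : Type} [Fintype I] [DecidableEq I] {D : ADEData I} {T : I → (Uq D ≃ₐ[𝕂] Uq D)}

def cns (a : ℕ) (f : ℕ → ℕ) : ℕ → ℕ
  | 0 => a
  | n + 1 => f n
def shf (f : ℕ → ℕ) : ℕ → ℕ := fun n => f (n + 1)

@[simp] theorem cns_zero (a : ℕ) (f : ℕ → ℕ) : cns a f 0 = a := rfl
@[simp] theorem cns_succ (a : ℕ) (f : ℕ → ℕ) (n : ℕ) : cns a f (n + 1) = f n := rfl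
@[simp] theorem shf_cns (a : ℕ) (f : ℕ → ℕ) : shf (cns a f) = f := rfl
theorem cns_shf (f : ℕ → ℕ) : cns (f 0) (shf f) = f := by
  funext n; cases n <;> rfl
theorem cns_inj {a b : ℕ} {f g : ℕ → ℕ} : cns a f = cns b g ↔ a = b ∧ f = g := by
  constructor
  · intro h
    exact ⟨congrFun h 0, funext fun n => congrFun h (n + 1)⟩
  · rintro ⟨rfl, rfl⟩; rfl

variable (T) in
noncomputable def pL : List I → (ℕ → ℕ) → Uq D
  | [], _ => 1
  | i :: l, f => dn (FF D i) (f 0) * T i (pL l (shf f))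

theorem pL_cns (i : I) (l : List I) (a : ℕ) (f : ℕ → ℕ) :
    pL T (i :: l) (cns a f) = dn (FF D i) a * T i (pL T l f) := rfl

theorem map_dn (g : Uq D ≃ₐ[𝕂] Uq D) (x : Uq D) (n : ℕ) : g (dn x n) = dn (g x) n := by
  simp [dn, map_smul]

theorem pL_snoc (l : List I) (k : I) : ∀ f : ℕ → ℕ,
    pL T (l ++ [k]) f = pL T l f * dn (TT T l (FF D k)) (f l.length) := by
  induction l with
  | nil => intro f; simp [pL]; rfl
  | cons i l ih =>
    intro f
    rw [List.cons_append, pL, ih, map_mul, ← mul_assoc, map_dn]; rfl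

theorem pL_congr (l : List I) : ∀ f g : ℕ → ℕ, (∀ k < l.length, f k = g k) → pL T l f = pL T l g := by
  induction l with
  | nil => intro f g _; rfl
  | cons i l ih =>
    intro f g h
    rw [pL, pL, h 0 (by simp), ih (shf f) (shf g) fun k hk => h (k + 1) (by simpa using hk)]

theorem dn_mem {x : Uq D} (h : x ∈ Uminus D) (n : ℕ) : dn x n ∈ Uminus D :=
  Subalgebra.smul_mem _ (pow_mem h n) _

theorem TT_pL_mem (hT : IsLusztigAuts D T) (w : List I) : ∀ (u : List I) (f : ℕ → ℕ), Red D (u ++ w) →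
    TT T u (pL T w f) ∈ Uminus D := by
  induction w with
  | nil => intro u f _; rw [pL, map_one]; exact one_mem _
  | cons i l ih =>
    intro u f h
    have h' : Red D ((u ++ [i]) ++ l) := by simpa using h
    have h1 := ih (u ++ [i]) (shf f) h'
    rw [TT_append] at h1
    rw [pL, map_mul, map_dn]
    refine mul_mem (dn_mem ((rootv hT _ u i rfl (Red.prefix D h) ?_).1) _) h1
    exact red_snoc_pos D (Red.prefix D h')

theorem pL_mem (hT : IsLusztigAuts D T) {w : List I} (hw : Red D w) (f : ℕ → ℕ) : pL T w f ∈ Uminus D :=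
  TT_pL_mem hT w [] f hw

variable (T) in
noncomputable def LL (w : List I) : Submodule OO (Uq D) := Submodule.span OO (Set.range (pL T w))

theorem pL_LL (w : List I) (f : ℕ → ℕ) : pL T w f ∈ LL T w := Submodule.subset_span ⟨f, rfl⟩

theorem qq_LL {w : List I} {x : Uq D} (h : x ∈ LL T w) : qq • x ∈ LL T w :=
  (LL T w).smul_mem (⟨qq, qq_mem⟩ : OO) h

variable (T) in
def QQ (w' w : List I) : Prop := ∀ f, ∃ g, ∃ z ∈ LL T w, pL T w' f = pL T w g + qq • z

theorem QQ_le {w' w : List I} (h : QQ T w' w) : LL T w' ≤ LL T w := by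
  refine Submodule.span_le.2 ?_
  rintro _ ⟨f, rfl⟩
  obtain ⟨g, z, hz, e⟩ := h f
  rw [e]
  exact add_mem (pL_LL _ _) (qq_LL hz)

theorem QQ_refl (w : List I) : QQ T w w := fun f => ⟨f, 0, zero_mem _, by simp⟩

theorem QQ_trans {w1 w2 w3 : List I} (h : QQ T w1 w2) (h' : QQ T w2 w3) : QQ T w1 w3 := by
  intro f
  obtain ⟨g, z, hz, e⟩ := h f
  obtain ⟨g', z', hz', e'⟩ := h' g
  refine ⟨g', z' + z, add_mem hz' (QQ_le h' hz), ?_⟩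
  rw [e, e', smul_add, add_assoc]

theorem LL_cons {i : I} {w : List I} (n : ℕ) {z : Uq D} (hz : z ∈ LL T w) :
    dn (FF D i) n * T i z ∈ LL T (i :: w) := by
  unfold LL at hz
  induction hz using Submodule.span_induction with
  | mem x hx =>
    obtain ⟨f, rfl⟩ := hx
    rw [← pL_cns]; exact pL_LL _ _
  | zero => simp
  | add x y _ _ hx hy => rw [map_add, mul_add]; exact add_mem hx hy
  | smul a x _ hx =>
    have : dn (FF D i) n * T i (a • x) = a • (dn (FF D i) n * T i x) := by
      show dn (FF D i) n * T i ((a : 𝕂) • x) = (a : 𝕂) • (dn (FF D i) n * T i x)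
      rw [map_smul, mul_smul_comm]
    rw [this]; exact Submodule.smul_mem _ _ hx

theorem QQ_cons {w' w : List I} (i : I) (h : QQ T w' w) : QQ T (i :: w') (i :: w) := by
  intro f
  obtain ⟨g, z, hz, e⟩ := h (shf f)
  refine ⟨cns (f 0) g, _, LL_cons (f 0) hz, ?_⟩
  rw [pL_cns, pL, e, map_add, mul_add, map_smul, mul_smul_comm]

theorem QQ_append {w' w : List I} (u : List I) (h : QQ T w' w) : QQ T (u ++ w') (u ++ w) := by
  induction u with
  | nil => exact h
  | cons i u ih => exact QQ_cons i ih

theorem QQ_far (hT : IsLusztigAuts D T) {a b : I} (hab : a ≠ b) (h : D.adj a b = false) (w : List I) :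
    QQ T (a :: b :: w) (b :: a :: w) := by
  intro f
  refine ⟨cns (f 1) (cns (f 0) (shf (shf f))), 0, zero_mem _, ?_⟩
  rw [pL_cns, pL_cns, pL, pL, map_mul, map_mul, map_dn, map_dn, TFf hT hab h,
    TFf hT hab.symm (by rw [D.symm]; exact h), braid2 hT hab h, ← mul_assoc, ← mul_assoc, smul_zero, add_zero]
  congr 1
  show dn (FF D a) (f 0) * dn (FF D b) (f 1) = dn (FF D b) (f 1) * dn (FF D a) (f 0)
  have : FF D a * FF D b = FF D b * FF D a := rFF D hab h
  unfold dn
  rw [smul_mul_smul_comm, smul_mul_smul_comm, mul_comm (qFact (f 0))⁻¹]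
  congr 1
  exact (Commute.pow_pow (show Commute (FF D a) (FF D b) from this) _ _).eq

theorem pL3 (hT : IsLusztigAuts D T) {a b : I} (h : D.adj a b = true) (w : List I) (f : ℕ → ℕ) :
    pL T (a :: b :: a :: w) f = PP (FF D a) (FF D b * FF D a - qq • (FF D a * FF D b)) (FF D b)
      (f 0, f 1, f 2) * T a (T b (T a (pL T w (shf (shf (shf f)))))) := by
  rw [pL, pL, pL, map_mul, map_mul, map_mul, map_dn, map_dn, map_dn, TFa hT h, TTF hT h, PP]
  simp only [mul_assoc]; rfl

theorem QQ_adj (hT : IsLusztigAuts D T) {a b : I} (h : D.adj a b = true) (w : List I) :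
    QQ T (a :: b :: a :: w) (b :: a :: b :: w) := by
  intro f
  have h' : D.adj b a = true := by rw [D.symm]; exact h
  obtain ⟨s, u, hu, e⟩ := rank2_serre (rSF D h) (rSF D h') (f 0, f 1, f 2)
  have key : ∀ s : ℕ × ℕ × ℕ, pL T (b :: a :: b :: w) (cns s.1 (cns s.2.1 (cns s.2.2 (shf (shf (shf f)))))) =
    PP (FF D b) (FF D a * FF D b - qq • (FF D b * FF D a)) (FF D a) s *
      T a (T b (T a (pL T w (shf (shf (shf f)))))) := by
    intro s; rw [pL3 hT h', braid3 hT h]; rfl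
  refine ⟨cns s.1 (cns s.2.1 (cns s.2.2 (shf (shf (shf f))))), u * T a (T b (T a (pL T w (shf (shf (shf f)))))), ?_, ?_⟩
  rotate_left 1
  · rw [pL3 hT h, e, add_mul, smul_mul_assoc, key]
  · clear e
    induction hu using Submodule.span_induction with
    | mem x hx =>
      obtain ⟨s, rfl⟩ := hx
      rw [← key]; exact pL_LL _ _
    | zero => simp
    | add x y _ _ hx hy => rw [add_mul]; exact add_mem hx hy
    | smul a x _ hx => rw [smul_mul_assoc]; exact Submodule.smul_mem _ _ hx

theorem QQ_braids (hT : IsLusztigAuts D T) {w w' : List I}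
    (h : Relation.ReflTransGen (BraidMove D) w w') : QQ T w w' := by
  induction h with
  | refl => exact QQ_refl _
  | tail _ hb ih =>
    refine QQ_trans ih ?_
    rcases hb with ⟨w1, w2, a, b, hab, h, rfl, rfl⟩ | ⟨w1, w2, a, b, h, rfl, rfl⟩
    · exact QQ_append _ (QQ_far hT hab h _)
    · exact QQ_append _ (QQ_adj hT h _)

theorem QQ_redM (hT : IsLusztigAuts D T) {w w' : List I} (h : RedM D w) (h' : RedM D w') : QQ T w w' :=
  QQ_braids hT (matsumoto D _ w w' rfl h.1 h'.1 (redM_unique D h h'))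

theorem redM_len {w w' : List I} (h : RedM D w) (h' : RedM D w') : w.length = w'.length :=
  le_antisymm (h'.2 _ h.1) (h.2 _ h'.1)

theorem LL_sub {w : List I} : (LL T w : Set (Uq D)) ⊆ Submodule.span 𝕂 (Set.range (pL T w)) := by
  intro x hx
  unfold LL at hx
  induction hx using Submodule.span_induction with
  | mem x hx => exact Submodule.subset_span hx
  | zero => exact zero_mem _
  | add x y _ _ hx hy => exact add_mem hx hy
  | smul a x _ hx => exact Submodule.smul_mem _ (a : 𝕂) hx

theorem span_pL (hT : IsLusztigAuts D T) {w : List I} (h : RedM D w) :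
    Submodule.span 𝕂 (Set.range (pL T w)) = Subalgebra.toSubmodule (Uminus D) := by
  apply le_antisymm
  · refine Submodule.span_le.2 ?_
    rintro _ ⟨f, rfl⟩
    exact pL_mem hT h.1 f
  have hle : ∀ {w w' : List I}, RedM D w → RedM D w' →
      Submodule.span 𝕂 (Set.range (pL T w)) ≤ Submodule.span 𝕂 (Set.range (pL T w')) := by
    intro w w' h h'
    refine Submodule.span_le.2 ?_
    rintro _ ⟨f, rfl⟩
    exact LL_sub (QQ_le (QQ_redM hT h h') (pL_LL _ _))
  have hF : ∀ i, ∀ x ∈ Submodule.span 𝕂 (Set.range (pL T w)),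
      FF D i * x ∈ Submodule.span 𝕂 (Set.range (pL T w)) := by
    intro i x hx
    obtain ⟨l, hl⟩ := redM_start D h i
    refine hle hl h ?_
    replace hx := hle h hl hx
    induction hx using Submodule.span_induction with
    | mem x hx =>
      obtain ⟨f, rfl⟩ := hx
      rw [pL, ← mul_assoc, dn_succ, smul_mul_assoc, ← pL_cns]
      exact Submodule.smul_mem _ _ (Submodule.subset_span ⟨_, rfl⟩)
    | zero => simp
    | add x y _ _ hx hy => rw [mul_add]; exact add_mem hx hy
    | smul a x _ hx => rw [mul_smul_comm]; exact Submodule.smul_mem _ _ hx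
  have hone : (1 : Uq D) ∈ Submodule.span 𝕂 (Set.range (pL T w)) := by
    have : ∀ l : List I, pL T l (fun _ => 0) = 1 := by
      intro l
      induction l with
      | nil => rfl
      | cons i l ih =>
        rw [pL, dn_zero, one_mul]
        have : shf (fun _ => 0) = fun _ => 0 := rfl
        rw [this, ih, map_one]
    exact Submodule.subset_span ⟨fun _ => 0, this w⟩
  have hmul : ∀ u ∈ Uminus D, ∀ x ∈ Submodule.span 𝕂 (Set.range (pL T w)),
      u * x ∈ Submodule.span 𝕂 (Set.range (pL T w)) := by
    intro u hu
    unfold Uminus at hu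
    induction hu using Algebra.adjoin_induction with
    | mem u hu => obtain ⟨i, rfl⟩ := hu; exact hF i
    | algebraMap r => intro x hx; rw [← Algebra.smul_def]; exact Submodule.smul_mem _ _ hx
    | add a b _ _ ha hb => intro x hx; rw [add_mul]; exact add_mem (ha x hx) (hb x hx)
    | mul a b _ _ ha hb => intro x hx; rw [mul_assoc]; exact ha _ (hb x hx)
  intro x hx
  have := hmul x hx 1 hone
  rwa [mul_one] at this

end pbw
end CB

namespace CB

section pbw
variable {I : Type} [Fintype I] [DecidableEq I] {D : ADEData I} {T : I → (Uq D ≃ₐ[𝕂] Uq D)}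

theorem rot_fwd (hT : IsLusztigAuts D T) {i : I} {l : List I} (h : RedM D (i :: l)) :
    ∃ k, RedM D (l ++ [k]) ∧ TT T l (FF D k) = FF D i := by
  obtain ⟨k, h1, h2⟩ := redM_rotate D h
  refine ⟨k, h2, ?_⟩
  exact (rootv hT _ l k rfl (Red.prefix D h2.1) (red_snoc_pos D h2.1)).2 i h1

theorem rot_back (hT : IsLusztigAuts D T) {k : I} {l : List I} (h : RedM D (l ++ [k])) :
    ∃ i, RedM D (i :: l) ∧ TT T l (FF D k) = FF D i := by
  have h0 := h.reverse D
  rw [List.reverse_append, List.reverse_singleton, List.singleton_append] at h0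
  obtain ⟨i, h1, h2⟩ := redM_rotate D h0
  have h3 := h2.reverse D
  simp only [List.reverse_append, List.reverse_singleton, List.singleton_append, List.reverse_reverse] at h3
  refine ⟨i, h3, ?_⟩
  refine (rootv hT _ l k rfl (Red.prefix D h.1) (red_snoc_pos D h.1)).2 i ?_
  rw [← h1]
  have := LinearMap.congr_fun (actL_reverse' D l) (simpleRoot i)
  simpa using this

noncomputable def cou0 : FA I →ₐ[𝕂] 𝕂 := FreeAlgebra.lift 𝕂 (fun g : Gen I => match g with
  | Gen.E _ => 0
  | Gen.F _ => 0
  | Gen.K _ => 1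
  | Gen.Kinv _ => 1)

theorem one_ne : (1 : Uq D) ≠ 0 := by
  have key : ∀ ⦃a b : FA I⦄, QRel D a b → cou0 a = cou0 b := by
    intro a b h
    have e1 : ∀ i : I, cou0 (gE i) = 0 := fun i => by simp [cou0, gE]
    have e2 : ∀ i : I, cou0 (gF i) = 0 := fun i => by simp [cou0, gF]
    have e3 : ∀ i : I, cou0 (gK i) = 1 := fun i => by simp [cou0, gK]
    have e4 : ∀ i : I, cou0 (gKinv i) = 1 := fun i => by simp [cou0, gKinv]
    cases h <;> simp [e1, e2, e3, e4]
  intro h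
  have := congrArg (RingQuot.liftAlgHom 𝕂 ⟨cou0, key⟩) h
  rw [map_one, map_zero] at this
  exact one_ne_zero this

theorem pL_zero (l : List I) : pL T l (fun _ => 0) = 1 := by
  induction l with
  | nil => rfl
  | cons i l ih =>
    rw [pL, dn_zero, one_mul]
    have : shf (fun _ => 0) = fun _ => 0 := rfl
    rw [this, ih, map_one]

def XX (N : ℕ) : Set (ℕ → ℕ) := {f | ∀ k, N ≤ k → f k = 0}
def tr (N : ℕ) (f : ℕ → ℕ) : ℕ → ℕ := fun k => if k < N then f k else 0

theorem tr_mem (N : ℕ) (f : ℕ → ℕ) : tr N f ∈ XX N := fun k hk => if_neg (by omega)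
theorem tr_of_mem {N : ℕ} {f : ℕ → ℕ} (h : f ∈ XX N) : tr N f = f := by
  funext k
  unfold tr
  split
  · rfl
  · exact (h k (by omega)).symm
theorem pL_tr (w : List I) (f : ℕ → ℕ) : pL T w (tr w.length f) = pL T w f :=
  pL_congr _ _ _ fun _ hk => if_pos hk

theorem indep_aux (hT : IsLusztigAuts D T) (m : ℕ) : ∀ w : List I, RedM D w → ∀ t : Finset (ℕ → ℕ),
    (∀ f ∈ t, ∀ k, f k ≠ 0 → k < w.length ∧ w.length ≤ k + m) → ∀ c : (ℕ → ℕ) → 𝕂,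
    ∑ f ∈ t, c f • pL T w f = 0 → ∀ f ∈ t, c f = 0 := by
  classical
  induction m with
  | zero =>
    intro w hw t ht c h f hf
    have h0 : ∀ f ∈ t, f = fun _ => 0 := by
      intro f hf
      funext k
      by_contra hk
      have := ht f hf k hk
      omega
    have ht1 : t = {f} := by
      ext g
      constructor
      · intro hg; rw [Finset.mem_singleton, h0 g hg, h0 f hf]
      · intro hg; rw [Finset.mem_singleton.1 hg]; exact hf
    rw [ht1, Finset.sum_singleton, h0 f hf, pL_zero] at h
    rw [h0 f hf]
    exact (smul_eq_zero.1 h).resolve_right one_ne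
  | succ m ih =>
    intro w hw t ht c h
    rcases List.eq_nil_or_concat w with rfl | ⟨l, k, rfl⟩
    · exact ih [] hw t (fun f hf k hk => by have := (ht f hf k hk).1; simp at this) c h
    rw [List.concat_eq_append] at hw ht h
    obtain ⟨i, hi, e⟩ := rot_back hT hw
    have hlen : (l ++ [k]).length = l.length + 1 := by simp
    let u : ℕ → Uq D := fun n => ∑ f ∈ t.filter (fun f => f l.length = n),
      (c f * (qFact n)⁻¹) • T i (pL T l f)
    have hu : ∀ n, u n ∈ Uminus D := by
      intro n
      refine sum_mem fun f _ => Subalgebra.smul_mem _ ?_ _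
      exact TT_pL_mem hT l [i] f hi.1
    obtain ⟨M, hM⟩ : ∃ M, ∀ f ∈ t, f l.length < M := by
      refine ⟨t.sup (fun f => f l.length) + 1, fun f hf => ?_⟩
      exact Nat.lt_succ_of_le (Finset.le_sup (f := fun f : ℕ → ℕ => f l.length) hf)
    have hsum : ∑ n ∈ Finset.range M, u n * (-(KKinv D i * EE D i)) ^ n = 0 := by
      have h2 := congrArg (T i) h
      rw [map_zero, map_sum] at h2
      rw [← h2, ← Finset.sum_fiberwise_of_maps_to (s := t) (t := Finset.range M) (g := fun f => f l.length)
        (fun f hf => Finset.mem_range.2 (hM f hf))]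
      refine Finset.sum_congr rfl fun n _ => ?_
      rw [Finset.sum_mul]
      refine Finset.sum_congr rfl fun f hf => ?_
      rw [map_smul, pL_snoc, map_mul, e, map_dn, TF hT, (Finset.mem_filter.1 hf).2, dn, mul_smul_comm,
        smul_smul, smul_mul_assoc]
    have hpe := peel D i M u hu hsum
    intro f hf
    set n := f l.length with hn
    have hun := hpe n (hM f hf)
    let ψ : (ℕ → ℕ) → (ℕ → ℕ) := fun f => cns 0 (Function.update f l.length 0)
    let χ : (ℕ → ℕ) → (ℕ → ℕ) := fun g => Function.update (shf g) l.length n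
    have hχ : ∀ f : ℕ → ℕ, f l.length = n → χ (ψ f) = f := by
      intro f hf
      simp only [χ, ψ, shf_cns, Function.update_idem]
      rw [← hf, Function.update_eq_self]
    have hinj : Set.InjOn ψ (t.filter (fun f => f l.length = n)) := by
      intro f hf g hg hfg
      have h1 := hχ f (Finset.mem_filter.1 (Finset.mem_coe.1 hf)).2
      have h2 := hχ g (Finset.mem_filter.1 (Finset.mem_coe.1 hg)).2
      rw [← h1, hfg, h2]
    have key := ih (i :: l) hi ((t.filter (fun f => f l.length = n)).image ψ) ?_ (fun g => c (χ g)) ?_ (ψ f)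
      (Finset.mem_image_of_mem _ (Finset.mem_filter.2 ⟨hf, rfl⟩))
    · rwa [hχ f rfl] at key
    · intro g hg j hj
      obtain ⟨f', hf', rfl⟩ := Finset.mem_image.1 hg
      have h3 := ht f' (Finset.mem_filter.1 hf').1
      rw [hlen] at h3
      cases j with
      | zero => simp [ψ] at hj
      | succ j =>
        simp only [ψ, cns_succ] at hj
        by_cases hjl : j = l.length
        · rw [hjl, Function.update_self] at hj; exact absurd rfl hj
        · rw [Function.update_of_ne hjl] at hj
          have := h3 j hj
          simp only [List.length_cons]
          omega
    · rw [Finset.sum_image hinj]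
      have hq := qFact_ne n
      have h4 : ∑ f ∈ t.filter (fun f => f l.length = n), c (χ (ψ f)) • pL T (i :: l) (ψ f) = qFact n • u n := by
        rw [Finset.smul_sum]
        refine Finset.sum_congr rfl fun f hf => ?_
        rw [hχ f (Finset.mem_filter.1 hf).2, smul_smul, pL_cns, dn_zero, one_mul,
          pL_congr l (Function.update f l.length 0) f fun j hj => Function.update_of_ne (by omega) _ _]
        congr 1
        rw [mul_comm, mul_assoc, inv_mul_cancel₀ hq, mul_one]
      rw [h4, hun, smul_zero]

theorem indep (hT : IsLusztigAuts D T) {w : List I} (hw : RedM D w) :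
    LinearIndependent 𝕂 (fun f : XX w.length => pL T w f) := by
  rw [linearIndependent_iff']
  intro s g h f hf
  classical
  let c : (ℕ → ℕ) → 𝕂 := fun f => if hf : f ∈ XX w.length then g ⟨f, hf⟩ else 0
  have hc : ∀ f : XX w.length, c f = g f := fun f => by simp [c]
  have := indep_aux hT w.length w hw (s.map (Function.Embedding.subtype _)) ?_ c ?_ f ?_
  · rwa [hc] at this
  · intro f hf k hk
    obtain ⟨f', _, rfl⟩ := Finset.mem_map.1 hf
    refine ⟨?_, by omega⟩
    by_contra hlt
    exact hk (f'.2 k (by omega))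
  · rw [Finset.sum_map, ← h]
    refine Finset.sum_congr rfl fun f _ => ?_
    rw [← hc]; rfl
  · exact Finset.mem_map.2 ⟨f, hf, rfl⟩

theorem kap_exists (hT : IsLusztigAuts D T) {w : List I} (hw : RedM D w) :
    ∃ κ : Uq D →ₗ[𝕂] ((ℕ → ℕ) →₀ 𝕂), ∀ f, κ (pL T w f) = Finsupp.single (tr w.length f) 1 := by
  obtain ⟨g, hg⟩ := LinearMap.exists_leftInverse_of_injective
    (Finsupp.linearCombination 𝕂 (fun f : XX w.length => pL T w f))
    (LinearMap.ker_eq_bot.2 (indep hT hw))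
  refine ⟨(Finsupp.lmapDomain 𝕂 𝕂 Subtype.val).comp g, fun f => ?_⟩
  have := LinearMap.congr_fun hg (Finsupp.single ⟨tr w.length f, tr_mem _ _⟩ 1)
  simp only [LinearMap.comp_apply, Finsupp.linearCombination_single, one_smul, LinearMap.id_apply, pL_tr] at this
  rw [LinearMap.comp_apply, this]
  simp

noncomputable def kap (hT : IsLusztigAuts D T) {w : List I} (hw : RedM D w) :
    Uq D →ₗ[𝕂] ((ℕ → ℕ) →₀ 𝕂) := (kap_exists hT hw).choose

theorem kap_pL (hT : IsLusztigAuts D T) {w : List I} (hw : RedM D w) (f : ℕ → ℕ) :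
    kap hT hw (pL T w f) = Finsupp.single (tr w.length f) 1 := (kap_exists hT hw).choose_spec f

/-- induction principle on Uminus -/
theorem U_ind (hT : IsLusztigAuts D T) {w : List I} (hw : RedM D w) {P : Uq D → Prop}
    (h1 : ∀ f ∈ XX w.length, P (pL T w f)) (h2 : ∀ x y, P x → P y → P (x + y)) (h0 : P 0)
    (h3 : ∀ (a : 𝕂) x, P x → P (a • x)) {x : Uq D} (hx : x ∈ Uminus D) : P x := by
  have hx' : x ∈ Submodule.span 𝕂 (Set.range (pL T w)) := by rw [span_pL hT hw]; exact hx
  clear hx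
  induction hx' using Submodule.span_induction with
  | mem x h => obtain ⟨f, rfl⟩ := h; rw [← pL_tr]; exact h1 _ (tr_mem _ _)
  | zero => exact h0
  | add x y hx hy h h' =>
    exact h2 _ _ h h'
  | smul a x hx h =>
    exact h3 _ _ h

theorem kap_sum (hT : IsLusztigAuts D T) {w : List I} (hw : RedM D w) {x : Uq D} (hx : x ∈ Uminus D) :
    Finsupp.linearCombination 𝕂 (pL T w) (kap hT hw x) = x := by
  refine U_ind hT hw (P := fun x => Finsupp.linearCombination 𝕂 (pL T w) (kap hT hw x) = x) ?_ ?_ ?_ ?_ hx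
  · intro f hf; rw [kap_pL, Finsupp.linearCombination_single, one_smul, pL_tr]
  · intro x y h h'; rw [map_add, map_add, h, h']
  · simp
  · intro a x h; rw [map_smul, map_smul, h]

theorem kap_supp (hT : IsLusztigAuts D T) {w : List I} (hw : RedM D w) {x : Uq D} (hx : x ∈ Uminus D) :
    ∀ f, kap hT hw x f ≠ 0 → f ∈ XX w.length := by
  refine U_ind hT hw (P := fun x => ∀ f, kap hT hw x f ≠ 0 → f ∈ XX w.length) ?_ ?_ ?_ ?_ hx
  · intro g hg f hf
    rw [kap_pL, tr_of_mem hg] at hf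
    by_contra h
    exact hf (Finsupp.single_eq_of_ne (fun h' => h (h' ▸ hg)))
  · intro x y h h' f hf
    rw [map_add, Finsupp.add_apply] at hf
    by_contra hh
    apply hf
    rw [not_not.1 (mt (h f) hh), not_not.1 (mt (h' f) hh), add_zero]
  · simp
  · intro a x h f hf
    rw [map_smul, Finsupp.smul_apply] at hf
    exact h f (right_ne_zero_of_mul hf)

end pbw
end CB

namespace CB

section wt
variable {I : Type} [Fintype I] [DecidableEq I] {D : ADEData I} {T : I → (Uq D ≃ₐ[𝕂] Uq D)}

def WW (D : ADEData I) (x : Uq D) (μ : I → ℤ) : Prop :=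
  ∀ j, KK D j * x = qq ^ (-frm D μ (simpleRoot j)) • (x * KK D j)

theorem WW_mul {x y : Uq D} {μ ν : I → ℤ} (h : WW D x μ) (h' : WW D y ν) : WW D (x * y) (μ + ν) := by
  intro j
  rw [← mul_assoc, h j, smul_mul_assoc, mul_assoc, h' j, mul_smul_comm, smul_smul, mul_assoc,
    ← zpow_add₀ qq_ne, frm_add_left, neg_add]

theorem WW_smul {x : Uq D} {μ : I → ℤ} (a : 𝕂) (h : WW D x μ) : WW D (a • x) μ := by
  intro j
  rw [mul_smul_comm, h j, smul_mul_assoc, smul_comm]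

theorem WW_one : WW D 1 0 := by
  intro j
  have : frm D 0 (simpleRoot j) = 0 := by simp [frm]
  rw [this]; simp

theorem WW_F (i : I) : WW D (FF D i) (simpleRoot i) := by
  intro j
  rw [rKF, frm_simple, cartan_symm]

theorem WW_pow {x : Uq D} {μ : I → ℤ} (h : WW D x μ) (n : ℕ) : WW D (x ^ n) ((n : ℤ) • μ) := by
  induction n with
  | zero => simpa using WW_one
  | succ n ih =>
    rw [pow_succ]
    have := WW_mul ih h
    rwa [← add_one_zsmul, ← Nat.cast_succ] at this

theorem k_flip {A : Type*} [Ring A] [Algebra 𝕂 A] {k k' x : A} {s : 𝕂} (hs : s ≠ 0) (h1 : k * k' = 1)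
    (h2 : k' * k = 1) (h : k' * x = s • (x * k')) : k * x = s⁻¹ • (x * k) := by
  have h3 : x * k = s • (k * x) := by
    calc x * k = k * (k' * x) * k := by rw [← mul_assoc k, h1, one_mul]
      _ = s • (k * x) := by
        rw [h, mul_smul_comm, smul_mul_assoc, mul_assoc, mul_assoc, h2, mul_one]
  rw [h3, smul_smul, inv_mul_cancel₀ hs, one_smul]

theorem WW_T (hT : IsLusztigAuts D T) {x : Uq D} {μ : I → ℤ} (h : WW D x μ) (i : I) :
    WW D (T i x) (actL D [i] μ) := by
  have hs : actL D [i] μ = sref D i μ := rfl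
  intro j
  rcases eq_or_ne i j with rfl | hij
  · have h1 := congrArg (T i) (h i)
    rw [map_mul, map_smul, map_mul, TK hT] at h1
    have h2 := k_flip (zpow_ne_zero _ qq_ne) (rK D i) (rK' D i) h1
    rw [h2, hs, sref_eq, frm_sub_left, frm_smul_left, frm_simple, cartan_self, ← zpow_neg]
    congr 2; ring
  · have h0 : KK D i * KK D j * x = qq ^ (-frm D μ (simpleRoot i) + -frm D μ (simpleRoot j)) • (x * (KK D i * KK D j)) := by
      rw [mul_assoc, h j, mul_smul_comm, ← mul_assoc, h i, smul_mul_assoc, smul_smul, mul_assoc,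
        zpow_add₀ qq_ne, mul_comm]
    cases hadj : D.adj i j with
    | true =>
      have h1 := congrArg (T i) h0
      have h5 : T i (KK D i * KK D j) = KK D j := by
        rw [map_mul, TK hT, TKa hT hadj, ← mul_assoc, rK', one_mul]
      rw [map_mul, map_smul, h5, map_mul, h5] at h1
      rw [h1, hs, sref_eq, frm_sub_left, frm_smul_left, frm_simple, cartan_adj D hadj]
      congr 2; ring
    | false =>
      have h1 := congrArg (T i) (h j)
      rw [map_mul, map_smul, map_mul, TKf hT hij hadj] at h1
      rw [h1, hs, sref_eq, frm_sub_left, frm_smul_left, frm_simple, cartan_far D hij hadj]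
      congr 2; ring

def wtL (D : ADEData I) : List I → (ℕ → ℕ) → (I → ℤ)
  | [], _ => 0
  | i :: l, f => (f 0 : ℤ) • simpleRoot i + actL D [i] (wtL D l (shf f))

theorem WW_pL (hT : IsLusztigAuts D T) (w : List I) : ∀ f, WW D (pL T w f) (wtL D w f) := by
  induction w with
  | nil => intro f; exact WW_one
  | cons i l ih =>
    intro f
    exact WW_mul (WW_smul _ (WW_pow (WW_F i) _)) (WW_T hT (ih _) i)

theorem ht_root {u : List I} {k : I} (h : 0 ≤ actL D u (simpleRoot k)) :
    1 ≤ ∑ j, actL D u (simpleRoot k) j := by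
  have h1 : 0 ≤ ∑ j, actL D u (simpleRoot k) j := Finset.sum_nonneg fun j _ => h j
  by_contra h2
  have h3 : ∑ j, actL D u (simpleRoot k) j = 0 := by omega
  rw [Finset.sum_eq_zero_iff_of_nonneg fun j _ => h j] at h3
  exact root_ne D u k (funext fun j => h3 j (Finset.mem_univ j))

theorem ht_wtL (w : List I) : ∀ (u : List I) (f : ℕ → ℕ), Red D (u ++ w) →
    (∑ k ∈ Finset.range w.length, (f k : ℤ)) ≤ ∑ j, actL D u (wtL D w f) j := by
  induction w with
  | nil => intro u f _; simp [wtL]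
  | cons i l ih =>
    intro u f h
    have h' : Red D ((u ++ [i]) ++ l) := by simpa using h
    have h1 := ih (u ++ [i]) (shf f) h'
    have h2 := ht_root (red_snoc_pos D (Red.prefix D h'))
    rw [actL_append, LinearMap.comp_apply] at h1
    rw [List.length_cons, Finset.sum_range_succ', wtL, map_add, map_smul]
    simp only [Pi.add_apply, Pi.smul_apply, Finset.sum_add_distrib, ← Finset.mul_sum, smul_eq_mul]
    have h3 : (f 0 : ℤ) ≤ f 0 * ∑ j, actL D u (simpleRoot i) j :=
      le_mul_of_one_le_right (by positivity) h2
    have h4 : ∑ k ∈ Finset.range l.length, (f (k + 1) : ℤ) = ∑ k ∈ Finset.range l.length, (shf f k : ℤ) := rfl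
    rw [h4]
    linarith

theorem wt_fin {w : List I} (hw : Red D w) (μ : I → ℤ) : {f | f ∈ XX w.length ∧ wtL D w f = μ}.Finite := by
  let r : (ℕ → ℕ) → (Fin w.length → ℕ) := fun f k => f k
  refine Set.Finite.of_finite_image (f := r) ?_ ?_
  · refine (Set.finite_Iic (fun _ : Fin w.length => (∑ j, μ j).toNat)).subset ?_
    rintro _ ⟨f, ⟨hf, hfm⟩, rfl⟩ k
    have h1 := ht_wtL w [] f hw
    have h2 : (f k : ℤ) ≤ ∑ k ∈ Finset.range w.length, (f k : ℤ) :=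
      Finset.single_le_sum (f := fun k => (f k : ℤ)) (fun _ _ => by positivity) (Finset.mem_range.2 k.2)
    have h3 : actL D [] (wtL D w f) = μ := hfm
    rw [h3] at h1
    show f k ≤ (∑ j, μ j).toNat
    omega
  · intro f hf g hg h
    funext k
    by_cases hk : k < w.length
    · exact congrFun h ⟨k, hk⟩
    · rw [hf.1 k (by omega), hg.1 k (by omega)]

theorem frm_nondeg {u v : I → ℤ} (h : ∀ j, frm D u (simpleRoot j) = frm D v (simpleRoot j)) : u = v := by
  by_contra hne
  have h1 := frm_pos D (sub_ne_zero.2 hne)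
  have h2 : ∀ x : I → ℤ, frm D (u - v) x = 0 := by
    intro x
    rw [vec_expand x, frm_comm]
    have : ∀ s : Finset I, frm D (∑ k ∈ s, x k • simpleRoot k) (u - v) = 0 := by
      intro s
      induction s using Finset.induction_on with
      | empty => simp [frm]
      | insert a s ha ih =>
        rw [Finset.sum_insert ha, frm_add_left, ih, frm_smul_left, frm_comm, frm_sub_left, h a]; simp
    exact this _
  rw [h2] at h1
  exact lt_irrefl _ h1

theorem kap_wt (hT : IsLusztigAuts D T) {w : List I} (hw : RedM D w) {x : Uq D} (hx : x ∈ Uminus D)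
    {μ : I → ℤ} (h : WW D x μ) {f : ℕ → ℕ} (hf : kap hT hw x f ≠ 0) : wtL D w f = μ := by
  apply frm_nondeg (D := D)
  intro j
  have key : kap hT hw (KK D j * x * KKinv D j) f = qq ^ (-frm D (wtL D w f) (simpleRoot j)) * kap hT hw x f := by
    refine U_ind hT hw (P := fun x => kap hT hw (KK D j * x * KKinv D j) f =
      qq ^ (-frm D (wtL D w f) (simpleRoot j)) * kap hT hw x f) ?_ ?_ ?_ ?_ hx
    · intro g hg
      rw [WW_pL hT w g j, smul_mul_assoc, mul_assoc, rK, mul_one, map_smul, kap_pL, tr_of_mem hg,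
        Finsupp.smul_apply, smul_eq_mul]
      by_cases hgf : g = f
      · rw [hgf]
      · rw [Finsupp.single_eq_of_ne (Ne.symm hgf), mul_zero, mul_zero]
    · intro x y h h'; rw [mul_add, add_mul, map_add, map_add, Finsupp.add_apply, Finsupp.add_apply, h, h', mul_add]
    · simp
    · intro a x h
      rw [mul_smul_comm, smul_mul_assoc, map_smul, map_smul, Finsupp.smul_apply, Finsupp.smul_apply, h,
        smul_eq_mul, smul_eq_mul]; ring
  rw [h j, smul_mul_assoc, mul_assoc, rK, mul_one, map_smul, Finsupp.smul_apply, smul_eq_mul] at key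
  have := qq_zpow_inj (mul_right_cancel₀ hf key)
  omega

end wt
end CB

namespace CB

section bar
variable {I : Type} [Fintype I] [DecidableEq I] {D : ADEData I} {T : I → (Uq D ≃ₐ[𝕂] Uq D)}
  {bar : Uq D →+* Uq D}

theorem alg_inj {a b : 𝕂} (h : algebraMap 𝕂 (Uq D) a = algebraMap 𝕂 (Uq D) b) : a = b := by
  have : Nontrivial (Uq D) := ⟨⟨1, 0, one_ne⟩⟩
  exact (algebraMap 𝕂 (Uq D)).injective h

theorem bar_alg (hb : IsBar D bar) (c : 𝕂) : ∃ c' : 𝕂, bar (algebraMap 𝕂 (Uq D) c) = algebraMap 𝕂 (Uq D) c' := by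
  have hpoly : ∀ p : Polynomial ℚ, ∃ c' : 𝕂, bar (algebraMap 𝕂 (Uq D) (algebraMap (Polynomial ℚ) 𝕂 p)) =
      algebraMap 𝕂 (Uq D) c' := by
    intro p
    induction p using Polynomial.induction_on' with
    | add p q hp hq =>
      obtain ⟨a, ha⟩ := hp
      obtain ⟨b, hb⟩ := hq
      exact ⟨a + b, by rw [map_add, map_add, map_add, ha, hb, map_add]⟩
    | monomial n a =>
      refine ⟨algebraMap ℚ 𝕂 a * qq⁻¹ ^ n, ?_⟩
      have h1 : algebraMap (Polynomial ℚ) 𝕂 (Polynomial.monomial n a) = algebraMap ℚ 𝕂 a * qq ^ n := by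
        rw [← Polynomial.C_mul_X_pow_eq_monomial, map_mul, map_pow]; simp [qq]
      have h2 : (bar.comp ((algebraMap 𝕂 (Uq D)).comp (algebraMap ℚ 𝕂))) =
          ((algebraMap 𝕂 (Uq D)).comp (algebraMap ℚ 𝕂)) := RingHom.ext_rat _ _
      have h3 := RingHom.congr_fun h2 a
      rw [h1, map_mul, map_mul, map_pow, map_pow, hb.2.2.2.1, map_mul, map_pow]
      congr 1
  obtain ⟨n, hn⟩ := hpoly c.num
  obtain ⟨d, hd⟩ := hpoly c.denom
  have hd0 : algebraMap (Polynomial ℚ) 𝕂 c.denom ≠ 0 := RatFunc.algebraMap_ne_zero c.denom_ne_zero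
  have e : c = algebraMap (Polynomial ℚ) 𝕂 c.num * (algebraMap (Polynomial ℚ) 𝕂 c.denom)⁻¹ := by
    rw [← div_eq_mul_inv]; exact (RatFunc.num_div_denom c).symm
  generalize algebraMap (Polynomial ℚ) 𝕂 c.denom = y at *
  have h1 : bar (algebraMap 𝕂 (Uq D) y⁻¹) * algebraMap 𝕂 (Uq D) d = 1 := by
    rw [← hd, ← map_mul, ← map_mul, inv_mul_cancel₀ hd0, map_one, map_one]
  have hd1 : d ≠ 0 := by
    rintro rfl
    rw [map_zero, mul_zero] at h1
    exact one_ne h1.symm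
  refine ⟨n * d⁻¹, ?_⟩
  rw [e, map_mul, map_mul, hn, map_mul]
  congr 1
  calc bar (algebraMap 𝕂 (Uq D) y⁻¹) = bar (algebraMap 𝕂 (Uq D) y⁻¹) * (algebraMap 𝕂 (Uq D) d * algebraMap 𝕂 (Uq D) d⁻¹) := by
        rw [← map_mul, mul_inv_cancel₀ hd1, map_one, mul_one]
    _ = _ := by rw [← mul_assoc, h1, one_mul]

noncomputable def sg (hb : IsBar D bar) : 𝕂 →+* 𝕂 where
  toFun c := (bar_alg hb c).choose
  map_one' := alg_inj (D := D) (by rw [← (bar_alg hb 1).choose_spec]; simp)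
  map_zero' := alg_inj (D := D) (by rw [← (bar_alg hb 0).choose_spec]; simp)
  map_mul' a b := alg_inj (D := D) ((bar_alg hb (a * b)).choose_spec.symm.trans (by
    rw [map_mul, map_mul]
    exact (congrArg₂ (· * ·) (bar_alg hb a).choose_spec (bar_alg hb b).choose_spec).trans (map_mul _ _ _).symm))
  map_add' a b := alg_inj (D := D) ((bar_alg hb (a + b)).choose_spec.symm.trans (by
    rw [map_add, map_add]
    exact (congrArg₂ (· + ·) (bar_alg hb a).choose_spec (bar_alg hb b).choose_spec).trans (map_add _ _ _).symm))

theorem bar_sg (hb : IsBar D bar) (c : 𝕂) : bar (algebraMap 𝕂 (Uq D) c) = algebraMap 𝕂 (Uq D) (sg hb c) :=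
  (bar_alg hb c).choose_spec

theorem bar_smul (hb : IsBar D bar) (c : 𝕂) (x : Uq D) : bar (c • x) = sg hb c • bar x := by
  rw [Algebra.smul_def, map_mul, bar_sg, ← Algebra.smul_def]

theorem sg_qq (hb : IsBar D bar) : sg hb qq = qq⁻¹ := alg_inj (D := D) (by rw [← bar_sg, hb.2.2.2.1])

theorem sg_sg (hb : IsBar D bar) (c : 𝕂) : sg hb (sg hb c) = c :=
  alg_inj (D := D) (by rw [← bar_sg, ← bar_sg, hb.2.2.2.2])

theorem sg_fact (hb : IsBar D bar) (n : ℕ) : sg hb (qFact n) = qFact n := by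
  induction n with
  | zero => rw [qFact_zero, map_one]
  | succ n ih =>
    rw [qFact_succ, map_mul, ih]
    congr 1
    simp only [qI, map_div₀, map_sub, map_inv₀, map_zpow₀, sg_qq, inv_zpow, inv_inv, zpow_neg]
    rw [← neg_sub, ← neg_sub qq, neg_div_neg_eq]

theorem bar_dn (hb : IsBar D bar) (i : I) (n : ℕ) : bar (dn (FF D i) n) = dn (FF D i) n := by
  rw [dn, bar_smul hb, map_pow, hb.2.1, map_inv₀, sg_fact]

theorem bar_K' (hb : IsBar D bar) (i : I) : bar (KKinv D i) = KK D i := by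
  rw [← hb.2.2.1 i, hb.2.2.2.2]

theorem bar_mem (hb : IsBar D bar) {x : Uq D} (hx : x ∈ Uminus D) : bar x ∈ Uminus D := by
  unfold Uminus at hx
  induction hx using Algebra.adjoin_induction with
  | mem u hu => obtain ⟨i, rfl⟩ := hu; rw [hb.2.1]; exact FF_mem i
  | algebraMap r => rw [bar_sg hb]; exact Subalgebra.algebraMap_mem _ _
  | add a b _ _ ha hc => rw [map_add]; exact add_mem ha hc
  | mul a b _ _ ha hc => rw [map_mul]; exact mul_mem ha hc

theorem bar_WW (hb : IsBar D bar) {x : Uq D} {μ : I → ℤ} (h : WW D x μ) : WW D (bar x) μ := by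
  intro j
  have h1 := congrArg bar (h j)
  rw [map_mul, bar_smul hb, map_mul, hb.2.2.1, map_zpow₀, sg_qq, inv_zpow] at h1
  have h2 := k_flip (inv_ne_zero (zpow_ne_zero _ qq_ne)) (rK D j) (rK' D j) h1
  rwa [inv_inv] at h2

theorem aeval_inj {p q : Polynomial ℤ} (h : Polynomial.aeval qq p = Polynomial.aeval qq q) : p = q := by
  have h1 : ∀ p : Polynomial ℤ, Polynomial.aeval qq p =
      algebraMap (Polynomial ℚ) 𝕂 (p.map (Int.castRingHom ℚ)) := by
    intro p
    induction p using Polynomial.induction_on' with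
    | add p q hp hq => rw [map_add, hp, hq, Polynomial.map_add, map_add]
    | monomial n a =>
      rw [Polynomial.aeval_monomial, Polynomial.map_monomial, ← Polynomial.C_mul_X_pow_eq_monomial, map_mul, map_pow]
      simp [qq]
  rw [h1, h1] at h
  exact Polynomial.map_injective _ (RingHom.injective_int _) (RatFunc.algebraMap_injective ℚ h)

theorem fix_zero (hb : IsBar D bar) {c x : 𝕂} (hc : c ∈ OO) (hx : x = qq * c) (h : sg hb x = x) : x = 0 := by
  obtain ⟨p, rfl⟩ := hc
  by_contra hx0
  have hp0 : p ≠ 0 := by rintro rfl; apply hx0; rw [hx]; simp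
  have hs : sg hb (Polynomial.aeval qq p) = Polynomial.aeval qq⁻¹ p := by
    rw [Polynomial.aeval_def, Polynomial.hom_eval₂, sg_qq, Polynomial.aeval_def]
    congr 1
    exact Subsingleton.elim _ _
  have hr : Polynomial.aeval qq p.reverse = Polynomial.aeval qq⁻¹ p * qq ^ p.natDegree := by
    have : Invertible (qq⁻¹ : 𝕂) := invertibleOfNonzero (inv_ne_zero qq_ne)
    have h1 := Polynomial.eval₂_reverse_mul_pow (algebraMap ℤ 𝕂) (qq⁻¹) p
    rw [invOf_eq_inv, inv_inv] at h1
    rw [Polynomial.aeval_def, Polynomial.aeval_def, ← h1, mul_assoc, ← mul_pow, inv_mul_cancel₀ qq_ne, one_pow, mul_one]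
  have hq := qq_ne
  have e : Polynomial.aeval qq (Polynomial.X ^ (p.natDegree + 2) * p) = Polynomial.aeval qq p.reverse := by
    have hx' : x = qq * Polynomial.aeval qq p := hx
    rw [hx', map_mul, hs, sg_qq] at h
    rw [hr, map_mul, map_pow, Polynomial.aeval_X]
    have : Polynomial.aeval qq⁻¹ p = qq * (qq * Polynomial.aeval qq p) := by
      rw [← h, ← mul_assoc, mul_inv_cancel₀ hq, one_mul]
    rw [this]; ring
  have e2 := congrArg Polynomial.natDegree (aeval_inj e)
  rw [Polynomial.natDegree_X_pow_mul _ hp0] at e2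
  have := Polynomial.reverse_natDegree_le p
  omega

end bar
end CB

namespace CB

section theta
variable {I : Type} [Fintype I] [DecidableEq I] {D : ADEData I} {T : I → (Uq D ≃ₐ[𝕂] Uq D)}
  {bar : Uq D →+* Uq D}

noncomputable def Tb (T : I → (Uq D ≃ₐ[𝕂] Uq D)) (hb : IsBar D bar) (i : I) : Uq D →ₐ[𝕂] Uq D :=
  { bar.comp ((T i : Uq D →+* Uq D).comp bar) with
    commutes' := fun c => by
      change bar (T i (bar (algebraMap 𝕂 (Uq D) c))) = _
      rw [bar_sg hb, AlgEquiv.commutes, bar_sg hb, sg_sg] }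

theorem Tb_ap (hb : IsBar D bar) (i : I) (x : Uq D) : Tb T hb i x = bar (T i (bar x)) := rfl

theorem Tb_F (hT : IsLusztigAuts D T) (hb : IsBar D bar) (i : I) : Tb T hb i (FF D i) = -(KK D i * EE D i) := by
  rw [Tb_ap, hb.2.1, TF hT, map_neg, map_mul, bar_K' hb, hb.1]
theorem Tb_Fa (hT : IsLusztigAuts D T) (hb : IsBar D bar) {i j : I} (h : D.adj i j = true) :
    Tb T hb i (FF D j) = FF D j * FF D i - qq⁻¹ • (FF D i * FF D j) := by
  rw [Tb_ap, hb.2.1, TFa hT h, map_sub, map_mul, bar_smul hb, map_mul, hb.2.1, hb.2.1, sg_qq]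
theorem Tb_Ff (hT : IsLusztigAuts D T) (hb : IsBar D bar) {i j : I} (h : i ≠ j) (h' : D.adj i j = false) :
    Tb T hb i (FF D j) = FF D j := by
  rw [Tb_ap, hb.2.1, TFf hT h h', hb.2.1]
theorem Tb_E (hT : IsLusztigAuts D T) (hb : IsBar D bar) (i : I) : Tb T hb i (EE D i) = -(FF D i * KKinv D i) := by
  rw [Tb_ap, hb.1, TE hT, map_neg, map_mul, hb.2.1, hb.2.2.1]
theorem Tb_K (hT : IsLusztigAuts D T) (hb : IsBar D bar) (i : I) : Tb T hb i (KK D i) = KKinv D i := by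
  rw [Tb_ap, hb.2.2.1, TK' hT, hb.2.2.1]
theorem Tb_K' (hT : IsLusztigAuts D T) (hb : IsBar D bar) (i : I) : Tb T hb i (KKinv D i) = KK D i := by
  rw [Tb_ap, bar_K' hb, TK hT, bar_K' hb]

variable (D) in
noncomputable def yw : List I → Uq D
  | [] => 1
  | j :: l => yw l * FF D j

variable (D) in
noncomputable def WS (d : ℕ) : Submodule 𝕂 (Uq D) := Submodule.span 𝕂 {x | ∃ l : List I, l.length < d ∧ x = yw D l}

theorem yw_WS {l : List I} {d : ℕ} (h : l.length < d) : yw D l ∈ WS D d := Submodule.subset_span ⟨l, h, rfl⟩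

theorem WS_F {d : ℕ} {y : Uq D} (h : y ∈ WS D d) (j : I) : y * FF D j ∈ WS D (d + 1) := by
  unfold WS at h
  induction h using Submodule.span_induction with
  | mem x hx => obtain ⟨l, hl, rfl⟩ := hx; exact yw_WS (l := j :: l) (by simpa using hl)
  | zero => rw [zero_mul]; exact zero_mem _
  | add a b _ _ ha hc => rw [add_mul]; exact add_mem ha hc
  | smul c a _ ha => rw [smul_mul_assoc]; exact Submodule.smul_mem _ _ ha

theorem WS_mono {d e : ℕ} (h : d ≤ e) : WS D d ≤ WS D e :=
  Submodule.span_mono fun _ ⟨l, hl, e⟩ => ⟨l, lt_of_lt_of_le hl h, e⟩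

theorem cm_aux {𝕜 A : Type*} [Field 𝕜] [Ring A] [Algebra 𝕜 A] {e f k k' y y1 y2 w s u : A} {a b : 𝕜}
    (h : e * y = y * e + y1 * k + y2 * k') (hef : e * f = f * e + w)
    (hk : k * f = a • (f * k)) (hk' : k' * f = b • (f * k')) (hw : y * w = s * k + u * k') :
    e * (y * f) = y * f * e + (a • (y1 * f) + s) * k + (b • (y2 * f) + u) * k' := by
  rw [← mul_assoc, h, add_mul, add_mul, mul_assoc y, hef, mul_add, hw, mul_assoc y1, hk, mul_assoc y2, hk']
  simp only [mul_smul_comm, smul_mul_assoc, add_mul, mul_assoc]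
  abel

theorem hw_aux {𝕜 A : Type*} [Field 𝕜] [Ring A] [Algebra 𝕜 A] (y k k' : A) (c : 𝕜) :
    y * (c • (k - k')) = (c • y) * k + (-c • y) * k' := by
  rw [mul_smul_comm, mul_sub, smul_sub, smul_mul_assoc, neg_smul, neg_mul, smul_mul_assoc, sub_eq_add_neg]

theorem rd_aux {A : Type*} [Ring A] {te ty f tκ ty1 ty2 tk tk' g : A} (h3 : te * ty = ty * te + ty1 * tk + ty2 * tk')
    (h1 : te * tκ = -f) (h2 : te = -(f * g)) :
    ty * f - (ty1 * (tk * tκ) + ty2 * (tk' * tκ)) = f * (g * ty * tκ) := by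
  have h4 : ty * f = -(ty * te * tκ) := by rw [mul_assoc, h1, mul_neg, neg_neg]
  have h5 : ty * te = te * ty - ty1 * tk - ty2 * tk' := by rw [h3]; abel
  rw [h4, h5, h2]
  simp only [sub_mul, neg_mul, mul_assoc]
  abel

theorem comm_yw (i : I) (l : List I) : ∃ y1 ∈ WS D l.length, ∃ y2 ∈ WS D l.length,
    EE D i * yw D l = yw D l * EE D i + y1 * KK D i + y2 * KKinv D i := by
  induction l with
  | nil => exact ⟨0, zero_mem _, 0, zero_mem _, by simp [yw]⟩
  | cons j l ih =>
    obtain ⟨y1, h1, y2, h2, e⟩ := ih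
    by_cases hij : i = j
    · subst hij
      refine ⟨_, add_mem (Submodule.smul_mem _ (qq ^ (-cartan D i i)) (WS_F h1 i)) (Submodule.smul_mem _ (qq - qq⁻¹)⁻¹ (yw_WS (Nat.lt_succ_self _))),
        _, add_mem (Submodule.smul_mem _ (qq ^ (cartan D i i)) (WS_F h2 i)) (Submodule.smul_mem _ (-(qq - qq⁻¹)⁻¹) (yw_WS (Nat.lt_succ_self _))), ?_⟩
      refine cm_aux e (rEF D i) (rKF D i i) (rK'F D i i) ?_
      exact hw_aux _ _ _ _
    · refine ⟨_, add_mem (Submodule.smul_mem _ (qq ^ (-cartan D i j)) (WS_F h1 j)) (zero_mem _),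
        _, add_mem (Submodule.smul_mem _ (qq ^ (cartan D i j)) (WS_F h2 j)) (zero_mem _), ?_⟩
      refine cm_aux e (w := 0) (by rw [rEFd D hij, add_zero]) (rKF D i j) (rK'F D i j) ?_
      simp

/-- reduction of `t(y) F x` modulo the image of `F`. -/
theorem red_aux {M : Type*} [AddCommGroup M] [Module 𝕂 M] (ρ : Uq D →ₐ[𝕂] Module.End 𝕂 M) (t : Uq D →ₐ[𝕂] Uq D)
    {e f k k' κ g : Uq D} {y y1 y2 : Uq D}
    (h : e * y = y * e + y1 * k + y2 * k') (h1 : t e * t κ = -f) (h2 : t e = -(f * g)) (x : M) :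
    ρ (t y) (ρ f x) - (ρ (t y1) (ρ (t (k * κ)) x) + ρ (t y2) (ρ (t (k' * κ)) x)) ∈ LinearMap.range (ρ f) := by
  have e1 : t y * f - (t y1 * t (k * κ) + t y2 * t (k' * κ)) = f * (g * t y * t κ) := by
    rw [map_mul, map_mul]
    exact rd_aux (by rw [← map_mul, h, map_add, map_add, map_mul, map_mul, map_mul]) h1 h2
  have e2 := congrArg (fun u => ρ u x) e1
  simp only [map_sub, map_add, map_mul] at e2
  refine ⟨ρ (g * t y * t κ) x, ?_⟩
  simp only [map_mul]
  exact e2.symm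

theorem lin_aux {𝕜 M : Type*} [Field 𝕜] [AddCommGroup M] [Module 𝕜 M] (S : Submodule 𝕜 M) {c s s' r r' : 𝕜} (hc : c ≠ 0)
    {A A' X X' B B' C1 C2 C1' C2' : M} (hA : c • A = X - s • B) (hA' : c • A' = X' - s' • B')
    (hX : X - X' ∈ S) (hB : B - (r • C1 + C2) ∈ S) (hB' : B' - (C1' + r' • C2') ∈ S)
    (h1 : C1 - C1' ∈ S) (h2 : C2 - C2' ∈ S) (e1 : s * r = s') (e2 : s' * r' = s) : A - A' ∈ S := by
  have : c • (A - A') ∈ S := by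
    have : c • (A - A') = (X - X') - s • (B - (r • C1 + C2)) + s' • (B' - (C1' + r' • C2'))
        - s' • (C1 - C1') - s • (C2 - C2') := by
      rw [smul_sub, hA, hA', ← e1]
      have e3 : s * r * r' = s := by rw [e1, e2]
      have : s • C2' = (s * r * r') • C2' := by rw [e3]
      simp only [smul_sub, smul_add, smul_smul]
      rw [this]; abel
    rw [this]
    exact S.sub_mem (S.sub_mem (S.add_mem (S.sub_mem hX (S.smul_mem _ hB)) (S.smul_mem _ hB')) (S.smul_mem _ h1)) (S.smul_mem _ h2)
  exact (S.smul_mem_iff hc).1 this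

theorem neg_mul_assoc_aux {A : Type*} [Ring A] {f k k' : A} (h : k * k' = 1) : -(f * k) * k' = -f := by
  rw [neg_mul, mul_assoc, h, mul_one]

end theta
end CB

namespace CB

section theta2
variable {I : Type} [Fintype I] [DecidableEq I] {D : ADEData I} {T : I → (Uq D ≃ₐ[𝕂] Uq D)}
  {bar : Uq D →+* Uq D}

theorem ef_sing {M : Type*} [AddCommGroup M] [Module 𝕂 M] (ρ : Uq D →ₐ[𝕂] Module.End 𝕂 M) {i : I} {x : M} {n : ℤ}
    (he : ρ (EE D i) x = 0) (hk : ρ (KK D i) x = qq ^ n • x) (hk' : ρ (KKinv D i) x = qq ^ (-n) • x) :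
    ρ (EE D i) (ρ (FF D i) x) = qI n • x := by
  have h := congrArg (fun u => ρ u x) (rEF D i)
  simp only [map_add, map_mul, map_smul, map_sub] at h
  have h2 : ρ (EE D i) (ρ (FF D i) x) = ρ (FF D i) (ρ (EE D i) x) + (qq - qq⁻¹)⁻¹ • (ρ (KK D i) x - ρ (KKinv D i) x) := h
  rw [h2, he, map_zero, zero_add, hk, hk', ← sub_smul, smul_smul, qI, div_eq_inv_mul]

theorem k'_of {M : Type*} [AddCommGroup M] [Module 𝕂 M] (ρ : Uq D →ₐ[𝕂] Module.End 𝕂 M) {i : I} {x : M} {n : ℤ}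
    (hk : ρ (KK D i) x = qq ^ n • x) : ρ (KKinv D i) x = qq ^ (-n) • x := by
  have h : ρ (KKinv D i) (ρ (KK D i) x) = x := by
    rw [← Module.End.mul_apply, ← map_mul, rK', map_one, Module.End.one_apply]
  rw [hk, map_smul] at h
  rw [zpow_neg, eq_inv_smul_iff₀ (zpow_ne_zero _ qq_ne), h]

theorem kf {M : Type*} [AddCommGroup M] [Module 𝕂 M] (ρ : Uq D →ₐ[𝕂] Module.End 𝕂 M) {i : I} (j : I) {x : M} {n : ℤ}
    (hk : ρ (KK D i) x = qq ^ n • x) : ρ (KK D i) (ρ (FF D j) x) = qq ^ (n - cartan D i j) • ρ (FF D j) x := by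
  rw [← Module.End.mul_apply, ← map_mul, rKF, map_smul, map_mul, LinearMap.smul_apply, Module.End.mul_apply, hk,
    map_smul, smul_smul, ← zpow_add₀ qq_ne]
  congr 2; ring

theorem efd {M : Type*} [AddCommGroup M] [Module 𝕂 M] (ρ : Uq D →ₐ[𝕂] Module.End 𝕂 M) {i j : I} (h : i ≠ j) (x : M) :
    ρ (EE D i) (ρ (FF D j) x) = ρ (FF D j) (ρ (EE D i) x) := by
  rw [← Module.End.mul_apply, ← map_mul, rEFd D h, map_mul, Module.End.mul_apply]

theorem x2_aux {𝕜 M : Type*} [Field 𝕜] [AddCommGroup M] [Module 𝕜 M] (g : M →ₗ[𝕜] M) {a b q s : 𝕜} (X Y : M) (h : b - q * a = -s) :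
    a • g (X - q • Y) = g (a • X - b • Y) - s • g Y := by
  have : s = q * a - b := by rw [← neg_eq_iff_eq_neg.2 h]; ring
  rw [this, map_sub, map_smul, map_sub, map_smul, map_smul, smul_sub, smul_smul, sub_smul, mul_comm a]
  abel

theorem theta (hT : IsLusztigAuts D T) (hb : IsBar D bar) (i : I) {M : Type*} [AddCommGroup M] [Module 𝕂 M]
    (ρ : Uq D →ₐ[𝕂] Module.End 𝕂 M) (d : ℕ) : ∀ y ∈ WS D d, ∀ (x : M) (n : ℤ), (d : ℤ) ≤ n + 1 →
    ρ (EE D i) x = 0 → ρ (KK D i) x = qq ^ n • x →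
    ρ (T i y) x - ρ (Tb T hb i y) x ∈ LinearMap.range (ρ (FF D i)) := by
  induction d using Nat.strong_induction_on with
  | _ d IH =>
  intro y hy x n hn he hk
  have hk' := k'_of ρ hk
  unfold WS at hy
  induction hy using Submodule.span_induction with
  | zero => simp
  | add a b _ _ ha hc =>
    have e : ρ (T i (a + b)) x - ρ (Tb T hb i (a + b)) x =
      (ρ (T i a) x - ρ (Tb T hb i a) x) + (ρ (T i b) x - ρ (Tb T hb i b) x) := by
      simp only [map_add, LinearMap.add_apply]; abel
    rw [e]; exact add_mem ha hc
  | smul c a _ ha =>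
    have e : ρ (T i (c • a)) x - ρ (Tb T hb i (c • a)) x = c • (ρ (T i a) x - ρ (Tb T hb i a) x) := by
      simp only [map_smul, LinearMap.smul_apply, smul_sub]
    rw [e]; exact Submodule.smul_mem _ _ ha
  | mem y hy =>
    obtain ⟨l, hl, rfl⟩ := hy
    cases l with
    | nil => simp [yw]
    | cons j l =>
      simp only [List.length_cons] at hl
      have hd : ((l.length + 1 : ℕ) : ℤ) < d := by exact_mod_cast hl
      push_cast at hd
      have hy0 : yw D l ∈ WS D (l.length + 1) := yw_WS (Nat.lt_succ_self _)
      have split : ∀ t : Uq D →ₐ[𝕂] Uq D, ρ (t (yw D (j :: l))) x = ρ (t (yw D l)) (ρ (t (FF D j)) x) := fun t => by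
        rw [yw, map_mul, map_mul]; rfl
      rw [show T i (yw D (j :: l)) = (T i).toAlgHom (yw D (j :: l)) from rfl, split, split]
      change ρ (T i (yw D l)) (ρ (T i (FF D j)) x) - _ ∈ _
      rcases cartan_cases D i j with rfl | ⟨h, hij⟩ | ⟨h, hij⟩
      · have e1 : ρ (T i (FF D i)) x = 0 := by
          rw [TF hT, map_neg, map_mul, LinearMap.neg_apply, Module.End.mul_apply, he, map_zero, neg_zero]
        have e2 : ρ (Tb T hb i (FF D i)) x = 0 := by
          rw [Tb_F hT hb, map_neg, map_mul, LinearMap.neg_apply, Module.End.mul_apply, he, map_zero, neg_zero]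
        rw [e1, e2, map_zero, map_zero, sub_zero]; exact zero_mem _
      · set x1 := ρ (FF D j) x with hx1
        have c1 := cartan_adj' D h
        have k1 : ρ (KK D i) x1 = qq ^ (n + 1) • x1 := by
          have := kf ρ j hk; rwa [c1, sub_neg_eq_add] at this
        have k1' := k'_of ρ k1
        have e1 : ρ (EE D i) x1 = 0 := by rw [hx1, efd ρ hij, he, map_zero]
        set X := ρ (FF D j) (ρ (FF D i) x) with hX
        set Y := ρ (FF D i) x1 with hY
        have eX : ρ (EE D i) X = qI n • x1 := by rw [hX, efd ρ hij, ef_sing ρ he hk hk', map_smul]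
        have eY : ρ (EE D i) Y = qI (n + 1) • x1 := by rw [hY, ef_sing ρ e1 k1 k1']
        have kX : ρ (KK D i) X = qq ^ (n - 1) • X := by
          have := kf ρ j (kf ρ i hk)
          rw [c1, cartan_self'] at this
          rw [hX, this]; congr 2; ring
        have kY : ρ (KK D i) Y = qq ^ (n - 1) • Y := by
          have := kf ρ i k1
          rw [cartan_self'] at this
          rw [hY, this]; congr 2; ring
        obtain ⟨y1, h1, y2, h2, e⟩ := comm_yw (D := D) i l
        have eF : ρ (T i (FF D j)) x = X - qq • Y := by
          rw [TFa hT h, map_sub, map_smul, map_mul, map_mul]; rfl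
        have eF' : ρ (Tb T hb i (FF D j)) x = X - qq⁻¹ • Y := by
          rw [Tb_Fa hT hb h, map_sub, map_smul, map_mul, map_mul]; rfl
        rw [eF, eF']
        have q1 : qI (n + 1) = qq⁻¹ * qI n + qq ^ n := by
          have := qI_add 1 n
          rw [qI_one, mul_one, add_comm 1 n, zpow_neg, zpow_one] at this
          rw [this]; ring
        have q2 : qI (n + 1) = qq * qI n + qq ^ (-n) := by
          have := qI_add n 1
          rw [qI_one, mul_one, zpow_one] at this
          exact this
        have hq := qq_ne
        have q3 : qI n - qq * qI (n + 1) = - qq ^ (n + 1) := by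
          rw [q1, zpow_add₀ hq, zpow_one]; field_simp; ring
        have q4 : qI n - qq⁻¹ * qI (n + 1) = - qq ^ (-(n + 1)) := by
          rw [q2, neg_add, zpow_add₀ hq, zpow_neg_one]; field_simp; ring
        have r1 := red_aux ρ (T i).toAlgHom (κ := KK D i) (f := FF D i) (g := KK D i) e
          (by change T i _ * T i _ = _; rw [TE hT, TK hT]; exact neg_mul_assoc_aux (rK D i)) (TE hT i) x1
        have r2 := red_aux ρ (Tb T hb i) (κ := KKinv D i) (f := FF D i) (g := KKinv D i) e
          (by rw [Tb_E hT, Tb_K' hT]; exact neg_mul_assoc_aux (rK' D i)) (Tb_E hT hb i) x1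
        have s1 : ρ ((T i).toAlgHom (KK D i * KK D i)) x1 = qq ^ (-(n + 1) + -(n + 1)) • x1 := by
          change ρ (T i (KK D i * KK D i)) x1 = _
          rw [map_mul, TK hT, map_mul, Module.End.mul_apply, k1', map_smul, k1', smul_smul, zpow_add₀ hq]
        have s2 : ρ ((T i).toAlgHom (KKinv D i * KK D i)) x1 = x1 := by
          rw [rK', map_one, map_one, Module.End.one_apply]
        have s3 : ρ (Tb T hb i (KK D i * KKinv D i)) x1 = x1 := by
          rw [rK, map_one, map_one, Module.End.one_apply]
        have s4 : ρ (Tb T hb i (KKinv D i * KKinv D i)) x1 = qq ^ ((n + 1) + (n + 1)) • x1 := by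
          rw [map_mul, Tb_K' hT, map_mul, Module.End.mul_apply, k1, map_smul, k1, smul_smul, zpow_add₀ hq (n + 1)]
        rw [s1, s2, map_smul] at r1
        rw [s3, s4, map_smul] at r2
        refine lin_aux _ (qI_ne (n := n + 1) (by omega)) (x2_aux (ρ (T i (yw D l))) X Y q3)
          (x2_aux (ρ (Tb T hb i (yw D l))) X Y q4) ?_ r1 r2 ?_ ?_ ?_ ?_
        · refine IH (l.length + 1) hl _ hy0 _ (n - 1) (by push_cast; omega) ?_ ?_
          · rw [map_sub, map_smul, map_smul, eX, eY, smul_smul, smul_smul, mul_comm, sub_self]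
          · rw [map_sub, map_smul, map_smul, kX, kY, smul_sub, smul_comm, smul_comm (qI n)]
        · exact IH l.length (by omega) _ h1 _ (n + 1) (by omega) e1 k1
        · exact IH l.length (by omega) _ h2 _ (n + 1) (by omega) e1 k1
        · rw [← zpow_add₀ hq]; congr 1; ring
        · rw [← zpow_add₀ hq]; congr 1; ring
      · rw [TFf hT hij h, Tb_Ff hT hb hij h]
        refine IH (l.length + 1) hl _ hy0 _ n (by push_cast; omega) ?_ ?_
        · rw [efd ρ hij, he, map_zero]
        · have := kf ρ j hk
          rwa [cartan_far' D hij h, sub_zero] at this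

end theta2
end CB

namespace CB

section theta3
variable {I : Type} [Fintype I] [DecidableEq I] {D : ADEData I} {T : I → (Uq D ≃ₐ[𝕂] Uq D)}
  {bar : Uq D →+* Uq D}

theorem mul_WS {x : Uq D} (hx : x ∈ Uminus D) : ∀ d, ∀ y ∈ WS D d, ∃ e, y * x ∈ WS D e := by
  unfold Uminus at hx
  induction hx using Algebra.adjoin_induction with
  | mem u hu => obtain ⟨i, rfl⟩ := hu; exact fun d y hy => ⟨d + 1, WS_F hy i⟩
  | algebraMap r => exact fun d y hy => ⟨d, by rw [← Algebra.commutes, ← Algebra.smul_def]; exact Submodule.smul_mem _ _ hy⟩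
  | add a b _ _ ha hc =>
    intro d y hy
    obtain ⟨e1, h1⟩ := ha d y hy
    obtain ⟨e2, h2⟩ := hc d y hy
    exact ⟨max e1 e2, by rw [mul_add]; exact add_mem (WS_mono (le_max_left _ _) h1) (WS_mono (le_max_right _ _) h2)⟩
  | mul a b _ _ ha hc =>
    intro d y hy
    obtain ⟨e1, h1⟩ := ha d y hy
    rw [← mul_assoc]
    exact hc e1 _ h1

theorem mem_WS {x : Uq D} (hx : x ∈ Uminus D) : ∃ e, x ∈ WS D e := by
  obtain ⟨e, h⟩ := mul_WS hx 1 1 (yw_WS (l := []) (by simp))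
  exact ⟨e, by rwa [one_mul] at h⟩

theorem phi_mem (m : MM D) : phi D m ∈ Uminus D := by
  obtain ⟨x, rfl⟩ := (NN D).mkQ_surjective m
  rw [phi_mk, phiV, Finsupp.linearCombination_apply]
  refine Subalgebra.sum_mem _ fun l _ => Subalgebra.smul_mem _ ?_ _
  refine Subalgebra.list_prod_mem _ fun y hy => ?_
  obtain ⟨j, _, rfl⟩ := List.mem_map.1 hy
  exact FF_mem j

theorem theta' (hT : IsLusztigAuts D T) (hb : IsBar D bar) (i : I) {y y' u : Uq D} (hy : y ∈ Uminus D)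
    (hT1 : bar (T i y) ∈ Uminus D) (h' : T i y' ∈ Uminus D) (e : bar y = y' + u * FF D i) :
    ∃ v ∈ Uminus D, T i y' - bar (T i y) = FF D i * v := by
  obtain ⟨d, hd⟩ := mem_WS (bar_mem hb hy)
  set v0 : MM D := (NN D).mkQ (ev []) with hv0
  have hp : phi D v0 = 1 := by rw [hv0, phi_mk, phiV_ev]; rfl
  have hE : rho D d (EE D i) v0 = 0 := by
    rw [hv0, rho_E, oE_ev, eE, map_zero]
  have hK : rho D d (KK D i) v0 = qq ^ (d : ℤ) • v0 := by
    rw [hv0, KK, rho_mk, rho0_K, oK_ev, chi, map_smul]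
  obtain ⟨m, hm⟩ := theta hT hb i (rho D d) d _ hd v0 d (by omega) hE hK
  refine ⟨phi D m, phi_mem m, ?_⟩
  have h2 := congrArg (phi D) hm
  have e1 : rho D d (T i (bar y)) v0 = rho D d (T i y') v0 := by
    rw [e, map_add, map_mul, TF hT, map_add, map_mul, map_neg, map_mul, LinearMap.add_apply, Module.End.mul_apply,
      LinearMap.neg_apply, Module.End.mul_apply, hE, map_zero, neg_zero, map_zero, add_zero]
  rw [phi_rho D d (FF_mem i), e1, Tb_ap, hb.2.2.2.2, map_sub, phi_rho D d h', phi_rho D d hT1, hp, mul_one, mul_one] at h2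
  exact h2.symm

theorem cns_mem {N a : ℕ} {f : ℕ → ℕ} : cns a f ∈ XX (N + 1) ↔ f ∈ XX N := by
  constructor
  · intro h k hk; exact h (k + 1) (by omega)
  · intro h k hk
    cases k with
    | zero => omega
    | succ k => exact h k (by omega)

theorem dn_pL {i : I} {l : List I} (n : ℕ) (g : ℕ → ℕ) : dn (FF D i) n * pL T (i :: l) g =
    (qFact (n + g 0) / (qFact n * qFact (g 0))) • pL T (i :: l) (cns (n + g 0) (shf g)) := by
  rw [pL_cns, pL, ← mul_assoc, dn_mul, smul_mul_assoc]

theorem kap_dn (hT : IsLusztigAuts D T) {i : I} {l : List I} (hw : RedM D (i :: l)) (n : ℕ) {x : Uq D} (hx : x ∈ Uminus D) :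
    (∀ f : ℕ → ℕ, f 0 < n → kap hT hw (dn (FF D i) n * x) f = 0) ∧
    ∀ f', kap hT hw (dn (FF D i) n * x) (cns n f') = kap hT hw x (cns 0 f') := by
  classical
  refine U_ind hT hw (P := fun x => (∀ f : ℕ → ℕ, f 0 < n → kap hT hw (dn (FF D i) n * x) f = 0) ∧
    ∀ f', kap hT hw (dn (FF D i) n * x) (cns n f') = kap hT hw x (cns 0 f')) ?_ ?_ ?_ ?_ hx
  · intro g hg
    have hg' : cns (n + g 0) (shf g) ∈ XX (i :: l).length := by
      rw [← cns_shf g] at hg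
      exact cns_mem.2 (cns_mem.1 hg)
    constructor
    · intro f hf
      rw [dn_pL, map_smul, kap_pL, tr_of_mem hg', Finsupp.smul_apply, Finsupp.single_apply, if_neg, smul_zero]
      rintro rfl
      simp at hf
    · intro f'
      rw [dn_pL, map_smul, kap_pL, kap_pL, tr_of_mem hg', tr_of_mem hg, Finsupp.smul_apply, Finsupp.single_apply,
        Finsupp.single_apply]
      have e2 : (g = cns 0 f') ↔ g 0 = 0 ∧ shf g = f' := by
        conv_lhs => rw [← cns_shf g]
        exact cns_inj
      simp only [cns_inj, e2]
      by_cases h0 : g 0 = 0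
      · simp [h0, qFact_zero, div_self (qFact_ne n)]
      · rw [if_neg (by omega), if_neg (by omega), smul_zero]
  · rintro x y ⟨h1, h2⟩ ⟨h3, h4⟩
    refine ⟨fun f hf => ?_, fun f' => ?_⟩
    · rw [mul_add, map_add, Finsupp.add_apply, h1 f hf, h3 f hf, add_zero]
    · rw [mul_add, map_add, map_add, Finsupp.add_apply, Finsupp.add_apply, h2, h4]
  · simp
  · rintro a x ⟨h1, h2⟩
    refine ⟨fun f hf => ?_, fun f' => ?_⟩
    · rw [mul_smul_comm, map_smul, Finsupp.smul_apply, h1 f hf, smul_zero]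
    · rw [mul_smul_comm, map_smul, map_smul, Finsupp.smul_apply, Finsupp.smul_apply, h2]

theorem snoc_dec (hT : IsLusztigAuts D T) {i k : I} {l : List I} (hw : RedM D (i :: l)) (hw' : RedM D (l ++ [k]))
    (hk : TT T l (FF D k) = FF D i) {y : Uq D} (hy : y ∈ Uminus D) :
    ∃ y' u, T i y' ∈ Uminus D ∧ y = y' + u * FF D i ∧
      ∀ f' ∈ XX l.length, kap hT hw (T i y') (cns 0 f') = kap hT hw' y f' := by
  classical
  refine U_ind hT hw' (P := fun y => ∃ y' u, T i y' ∈ Uminus D ∧ y = y' + u * FF D i ∧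
      ∀ f' ∈ XX l.length, kap hT hw (T i y') (cns 0 f') = kap hT hw' y f') ?_ ?_ ?_ ?_ hy
  · intro f hf
    rcases h0 : f l.length with _ | a
    · have hf' : f ∈ XX l.length := by
        intro m hm
        rcases hm.eq_or_lt with rfl | hm
        · exact h0
        · exact hf m (by simp; omega)
      have e : T i (pL T l f) = pL T (i :: l) (cns 0 f) := by rw [pL_cns, dn_zero, one_mul]
      refine ⟨pL T l f, 0, ?_, ?_, ?_⟩
      · rw [e]; exact pL_mem hT hw.1 _
      · rw [pL_snoc, h0, dn_zero, mul_one, zero_mul, add_zero]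
      · intro f' _
        rw [e, kap_pL, kap_pL, tr_of_mem hf, tr_of_mem (N := (i :: l).length) (cns_mem.2 hf'), Finsupp.single_apply, Finsupp.single_apply]
        simp [cns_inj]
    · refine ⟨0, pL T l f * ((qFact (a + 1))⁻¹ • FF D i ^ a), ?_, ?_, ?_⟩
      · rw [map_zero]; exact zero_mem _
      · rw [pL_snoc, h0, zero_add, hk, dn, pow_succ, mul_assoc, smul_mul_assoc]
      · intro f' hf'
        rw [map_zero, map_zero, kap_pL, tr_of_mem hf, Finsupp.single_apply, if_neg]
        · rfl
        · rintro rfl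
          have := hf' l.length le_rfl
          omega
  · rintro x y ⟨x', u, h1, h2, h3⟩ ⟨y', v, h4, h5, h6⟩
    refine ⟨x' + y', u + v, ?_, ?_, ?_⟩
    · rw [map_add]; exact add_mem h1 h4
    · rw [h2, h5, add_mul]; abel
    · intro f' hf'
      rw [map_add, map_add, map_add, Finsupp.add_apply, Finsupp.add_apply, h3 f' hf', h6 f' hf']
  · exact ⟨0, 0, by rw [map_zero]; exact zero_mem _, by simp, by simp⟩
  · rintro a x ⟨x', u, h1, h2, h3⟩
    refine ⟨a • x', a • u, ?_, ?_, ?_⟩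
    · rw [map_smul]; exact Subalgebra.smul_mem _ h1 _
    · rw [h2, smul_mul_assoc, smul_add]
    · intro f' hf'
      rw [map_smul, map_smul, map_smul, Finsupp.smul_apply, Finsupp.smul_apply, h3 f' hf']

theorem theta_con (hT : IsLusztigAuts D T) (hb : IsBar D bar) {i k : I} {l : List I} (hw : RedM D (i :: l)) (hw' : RedM D (l ++ [k]))
    (hk : TT T l (FF D k) = FF D i) {y : Uq D} (hy : y ∈ Uminus D) (hy1 : T i y ∈ Uminus D) {f : ℕ → ℕ} (hf : f ∈ XX l.length) :
    kap hT hw (bar (T i y)) (cns 0 f) = kap hT hw' (bar y) f := by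
  obtain ⟨y', u, h1, h2, h3⟩ := snoc_dec hT hw hw' hk (bar_mem hb hy)
  obtain ⟨v, hv, e⟩ := theta' hT hb i hy (bar_mem hb hy1) h1 h2
  have e1 : bar (T i y) = T i y' - dn (FF D i) 1 * v := by
    have : dn (FF D i) 1 = FF D i := by rw [dn, qFact_succ, qFact_zero]; simp [qI_one]
    rw [this, ← e, sub_sub_cancel]
  rw [e1, map_sub, Finsupp.sub_apply, (kap_dn hT hw 1 hv).1 _ (by simp), sub_zero, h3 f hf]

end theta3
end CB

namespace CB

section tri
variable {I : Type} [Fintype I] [DecidableEq I] {D : ADEData I} {T : I → (Uq D ≃ₐ[𝕂] Uq D)}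
  {bar : Uq D →+* Uq D}

theorem lex_cns {a b : ℕ} (f g : ℕ → ℕ) (h : a < b) : toLex (cns a f) ≤ toLex (cns b g) :=
  le_of_lt ⟨0, fun j hj => absurd hj (Nat.not_lt_zero j), h⟩

theorem lex_cns' (a : ℕ) {f g : ℕ → ℕ} (h : toLex f ≤ toLex g) : toLex (cns a f) ≤ toLex (cns a g) := by
  rcases h.eq_or_lt with h | ⟨k, h1, h2⟩
  · rw [toLex.injective h]
  · refine le_of_lt ⟨k + 1, fun j hj => ?_, h2⟩
    cases j with
    | zero => rfl
    | succ j => exact h1 j (Nat.lt_of_succ_lt_succ hj)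

theorem tri_aux (hT : IsLusztigAuts D T) (hb : IsBar D bar) (m : ℕ) : ∀ (w : List I) (hw : RedM D w), m ≤ w.length →
    ∀ f ∈ XX m, ∀ g ∈ XX m, (kap hT hw (bar (pL T w g)) f ≠ 0 → toLex g ≤ toLex f) ∧ kap hT hw (bar (pL T w f)) f = 1 := by
  induction m with
  | zero =>
    intro w hw _ f hf g hg
    have e1 : f = fun _ => 0 := funext fun k => hf k (by omega)
    have e2 : g = fun _ => 0 := funext fun k => hg k (by omega)
    subst e1 e2
    refine ⟨fun _ => le_rfl, ?_⟩
    rw [pL_zero, map_one, ← pL_zero w, kap_pL, tr_of_mem (fun k _ => rfl), Finsupp.single_eq_same]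
  | succ m ih =>
    intro w hw hm f hf g hg
    cases w with
    | nil => simp at hm
    | cons i l =>
      simp only [List.length_cons, Nat.add_le_add_iff_right] at hm
      obtain ⟨k, hw', hk⟩ := rot_fwd hT hw
      have key : ∀ f ∈ XX m, ∀ g ∈ XX m, ∀ a, kap hT hw (bar (pL T (i :: l) (cns a g))) (cns a f) =
          kap hT hw' (bar (pL T (l ++ [k]) g)) f := by
        intro f hf g hg a
        have e : T i (pL T l g) = pL T (i :: l) (cns 0 g) := by rw [pL_cns, dn_zero, one_mul]
        have h1 : T i (pL T l g) ∈ Uminus D := by rw [e]; exact pL_mem hT hw.1 _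
        have h2 : pL T l g ∈ Uminus D := pL_mem hT (Red.prefix D hw'.1) _
        rw [pL_cns, map_mul, bar_dn hb, (kap_dn hT hw a (bar_mem hb h1)).2,
          theta_con hT hb hw hw' hk h2 h1 (fun j hj => hf j (by omega)), pL_snoc, hg l.length hm, dn_zero, mul_one]
      have hlen : m ≤ (l ++ [k]).length := by simp; omega
      rw [← cns_shf f] at hf ⊢
      rw [← cns_shf g] at hg ⊢
      have hf' := cns_mem.1 hf
      have hg' := cns_mem.1 hg
      generalize f 0 = a at *
      generalize g 0 = b at *
      generalize shf f = f at *
      generalize shf g = g at *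
      refine ⟨fun h => ?_, ?_⟩
      · rcases lt_trichotomy a b with hab | rfl | hab
        · exfalso
          apply h
          have h1 : T i (pL T l g) ∈ Uminus D := by
            have e : T i (pL T l g) = pL T (i :: l) (cns 0 g) := by rw [pL_cns, dn_zero, one_mul]
            rw [e]; exact pL_mem hT hw.1 _
          rw [pL_cns, map_mul, bar_dn hb]
          exact (kap_dn hT hw b (bar_mem hb h1)).1 _ hab
        · rw [key f hf' g hg'] at h
          exact lex_cns' _ ((ih _ hw' hlen f hf' g hg').1 h)
        · exact lex_cns _ _ hab
      · rw [key f hf' f hf']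
        exact (ih _ hw' hlen f hf' f hf').2

theorem kap_bar (hT : IsLusztigAuts D T) (hb : IsBar D bar) {w : List I} (hw : RedM D w) {x : Uq D} (hx : x ∈ Uminus D)
    (f : ℕ → ℕ) : kap hT hw (bar x) f =
      ∑ g ∈ (kap hT hw x).support, sg hb (kap hT hw x g) * kap hT hw (bar (pL T w g)) f := by
  conv_lhs => rw [← kap_sum hT hw hx]
  rw [Finsupp.linearCombination_apply, Finsupp.sum, map_sum, map_sum, Finsupp.finsetSum_apply]
  refine Finset.sum_congr rfl fun g _ => ?_
  rw [bar_smul hb, map_smul, Finsupp.smul_apply, smul_eq_mul]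

/-- the lex-minimum argument -/
theorem lexmin (hT : IsLusztigAuts D T) (hb : IsBar D bar) {w : List I} (hw : RedM D w) {x : Uq D} (hx : x ∈ Uminus D)
    (hbx : bar x = x) (S : Set (ℕ → ℕ))
    (hS : ∀ f ∈ S, f ∈ XX w.length → ∀ g ∈ XX w.length, g ∉ S → kap hT hw (bar (pL T w g)) f = 0)
    (ho : ∀ f ∈ S, ∃ o ∈ OO, kap hT hw x f = qq * o) : ∀ f ∈ S, kap hT hw x f = 0 := by
  classical
  intro f0 hf0
  by_contra hne
  obtain ⟨f, hf, hmin⟩ := Finset.exists_min_image ((kap hT hw x).support.filter (· ∈ S)) (fun f => toLex f)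
    ⟨f0, by simp [hne, hf0]⟩
  rw [Finset.mem_filter, Finsupp.mem_support_iff] at hf
  have hfX := kap_supp hT hw hx f hf.1
  apply hf.1
  obtain ⟨o, ho1, ho2⟩ := ho f hf.2
  refine fix_zero hb ho1 ho2 ?_
  have h := kap_bar hT hb hw hx f
  rw [hbx, Finset.sum_eq_single f, (tri_aux hT hb _ w hw le_rfl f hfX f hfX).2, mul_one] at h
  · exact h.symm
  · intro g hg hgf
    rw [Finsupp.mem_support_iff] at hg
    have hgX := kap_supp hT hw hx g hg
    by_cases hgS : g ∈ S
    · have h1 := hmin g (by simp [hg, hgS])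
      by_cases h0 : kap hT hw (bar (pL T w g)) f = 0
      · rw [h0, mul_zero]
      · exact absurd (toLex.injective (le_antisymm ((tri_aux hT hb _ w hw le_rfl f hfX g hgX).1 h0) h1)) hgf
    · rw [hS f hf.2 hfX g hgX hgS, mul_zero]
  · intro h; exact absurd (Finsupp.mem_support_iff.2 hf.1) h

theorem pL_snoc_pow (hT : IsLusztigAuts D T) {i k : I} {l : List I}
    (hw' : RedM D (l ++ [k])) (hk : TT T l (FF D k) = FF D i) {n : ℕ} {g : ℕ → ℕ} (h : n ≤ g l.length) :
    ∃ u ∈ Uminus D, pL T (l ++ [k]) g = u * FF D i ^ n := by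
  obtain ⟨m, hm⟩ := Nat.exists_eq_add_of_le' h
  refine ⟨pL T l g * ((qFact (g l.length))⁻¹ • FF D i ^ m), mul_mem (pL_mem hT (Red.prefix D hw'.1) _)
    (Subalgebra.smul_mem _ (pow_mem (FF_mem i) _) _), ?_⟩
  rw [pL_snoc, hk, dn, mul_assoc, smul_mul_assoc, ← pow_add, ← hm]

theorem snoc_pow (hT : IsLusztigAuts D T) {i k : I} {l : List I}
    (hw' : RedM D (l ++ [k])) (hk : TT T l (FF D k) = FF D i) (n : ℕ) {u : Uq D} (hu : u ∈ Uminus D) :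
    u * FF D i ^ n ∈ Submodule.span 𝕂 {x | ∃ g ∈ XX (l ++ [k]).length, n ≤ g l.length ∧ x = pL T (l ++ [k]) g} := by
  refine U_ind hT hw' (P := fun u => u * FF D i ^ n ∈ Submodule.span 𝕂
    {x | ∃ g ∈ XX (l ++ [k]).length, n ≤ g l.length ∧ x = pL T (l ++ [k]) g}) ?_ ?_ ?_ ?_ hu
  · intro g hg
    have e : pL T (l ++ [k]) g * FF D i ^ n = ((qFact (g l.length))⁻¹ * qFact (g l.length + n)) •
        pL T (l ++ [k]) (Function.update g l.length (g l.length + n)) := by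
      rw [pL_snoc, pL_snoc, hk, dn, mul_assoc, smul_mul_assoc, ← pow_add, Function.update_self, dn,
        pL_congr l (Function.update g l.length (g l.length + n)) g
          (fun j hj => Function.update_of_ne (by omega) _ _), mul_smul_comm, mul_smul_comm, smul_smul,
        mul_assoc, mul_inv_cancel₀ (qFact_ne _), mul_one]
    rw [e]
    refine Submodule.smul_mem _ _ (Submodule.subset_span ⟨_, ?_, by simp, rfl⟩)
    intro j hj
    rw [Function.update_of_ne (by simp at hj; omega)]
    exact hg j hj
  · intro x y hx hy; rw [add_mul]; exact add_mem hx hy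
  · rw [zero_mul]; exact zero_mem _
  · intro a x hx; rw [smul_mul_assoc]; exact Submodule.smul_mem _ _ hx

theorem J_closed (hT : IsLusztigAuts D T) (hb : IsBar D bar) {i k : I} {l : List I}
    (hw' : RedM D (l ++ [k])) (hk : TT T l (FF D k) = FF D i) {n : ℕ} {f g : ℕ → ℕ}
    (hf : f l.length < n) (hg : n ≤ g l.length) : kap hT hw' (bar (pL T (l ++ [k]) g)) f = 0 := by
  classical
  obtain ⟨u, hu, e⟩ := pL_snoc_pow hT hw' hk hg
  rw [e, map_mul, map_pow, hb.2.1]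
  have h := snoc_pow hT hw' hk n (bar_mem hb hu)
  generalize bar u * FF D i ^ n = x at h
  induction h using Submodule.span_induction with
  | mem x hx =>
    obtain ⟨g', hg', h1, rfl⟩ := hx
    rw [kap_pL, tr_of_mem hg', Finsupp.single_apply, if_neg]
    rintro rfl; omega
  | zero => simp
  | add x y _ _ hx hy => rw [map_add, Finsupp.add_apply, hx, hy, add_zero]
  | smul a x _ hx => rw [map_smul, Finsupp.smul_apply, hx, smul_zero]

end tri
end CB

namespace CB

section fin
variable {I : Type} [Fintype I] [DecidableEq I] {D : ADEData I} {T : I → (Uq D ≃ₐ[𝕂] Uq D)}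
  {bar : Uq D →+* Uq D}

theorem pbw_eq (w : List I) : ∀ g : ℕ → ℕ, pbw T w (fun k => g k) = pL T w g := by
  induction w with
  | nil => intro g; rfl
  | cons i l ih =>
    intro g
    rw [pL, ← ih (shf g), pbw, pbw, map_list_prod, List.map_map]
    change (List.map _ (List.finRange (l.length + 1))).prod = _
    rw [List.finRange_succ, List.map_cons, List.prod_cons, List.map_map]
    congr 1
    congr 1
    refine List.map_congr_left fun k _ => ?_
    exact (map_dn (T i) _ _).symm

theorem pbw_eq' (w : List I) (a : Fin w.length → ℕ) : pbw T w a = pL T w (fun k => if h : k < w.length then a ⟨k, h⟩ else 0) := by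
  rw [← pbw_eq]
  congr 1
  funext k
  simp

theorem sm_LL {w : List I} {x : Uq D} (p : Polynomial ℤ) (hx : x ∈ LL T w) : p • x ∈ LL T w :=
  (LL T w).smul_mem (⟨Polynomial.aeval qq p, ⟨p, rfl⟩⟩ : OO) hx

theorem latt_LL {w : List I} {x : Uq D} (hx : x ∈ latt T w) : x ∈ LL T w := by
  unfold latt at hx
  induction hx using Submodule.span_induction with
  | mem x hx => obtain ⟨a, rfl⟩ := hx; rw [pbw_eq']; exact pL_LL _ _
  | zero => exact zero_mem _
  | add x y _ _ hx hy => exact add_mem hx hy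
  | smul p x _ hx => exact sm_LL p hx

theorem sm_q (p : Polynomial ℤ) (x : Uq D) : p • (qq • x) = qq • (p • x) :=
  smul_comm (Polynomial.aeval qq p : 𝕂) qq x

theorem qlatt_LL {w : List I} {x : Uq D} (hx : x ∈ qlatt T w) : ∃ z ∈ LL T w, x = qq • z := by
  unfold qlatt at hx
  induction hx using Submodule.span_induction with
  | mem x hx => obtain ⟨y, hy, rfl⟩ := hx; exact ⟨y, latt_LL hy, rfl⟩
  | zero => exact ⟨0, zero_mem _, by simp⟩
  | add x y _ _ hx hy =>
    obtain ⟨a, ha, rfl⟩ := hx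
    obtain ⟨c, hc, rfl⟩ := hy
    exact ⟨a + c, add_mem ha hc, by rw [smul_add]⟩
  | smul p x _ hx =>
    obtain ⟨a, ha, rfl⟩ := hx
    exact ⟨p • a, sm_LL p ha, sm_q p a⟩

theorem LL_mem (hT : IsLusztigAuts D T) {w : List I} (hw : RedM D w) {x : Uq D} (hx : x ∈ LL T w) : x ∈ Uminus D := by
  unfold LL at hx
  induction hx using Submodule.span_induction with
  | mem x hx => obtain ⟨a, rfl⟩ := hx; exact pL_mem hT hw.1 _
  | zero => exact zero_mem _
  | add x y _ _ hx hy => exact add_mem hx hy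
  | smul p x _ hx => exact Subalgebra.smul_mem _ hx (p : 𝕂)

theorem LL_kap (hT : IsLusztigAuts D T) {w : List I} (hw : RedM D w) {x : Uq D} (hx : x ∈ LL T w) (f : ℕ → ℕ) :
    kap hT hw x f ∈ OO := by
  classical
  unfold LL at hx
  induction hx using Submodule.span_induction with
  | mem x hx =>
    obtain ⟨a, rfl⟩ := hx
    rw [kap_pL, Finsupp.single_apply]
    split
    · exact one_mem _
    · exact zero_mem _
  | zero => rw [map_zero]; exact zero_mem _
  | add x y _ _ hx hy => rw [map_add, Finsupp.add_apply]; exact add_mem hx hy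
  | smul p x _ hx =>
    change kap hT hw ((p : 𝕂) • x) f ∈ _
    rw [map_smul, Finsupp.smul_apply]; exact mul_mem p.2 hx

theorem b_ex (hT : IsLusztigAuts D T) {w w' : List I} (hw : RedM D w) (hw' : RedM D w')
    {b : (Fin w.length → ℕ) → Uq D} (hb : IsCanBasis T w bar b) (f : ℕ → ℕ) :
    ∃ a, ∃ z ∈ LL T w', b a = pL T w' f + qq • z := by
  obtain ⟨g, z, hz, e⟩ := QQ_redM hT hw' hw f
  obtain ⟨z', hz', e'⟩ := qlatt_LL (hb.2.1 (fun k => g k))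
  refine ⟨fun k => g k, z' - z, QQ_le (QQ_redM hT hw hw') (sub_mem hz' hz), ?_⟩
  rw [pbw_eq, sub_eq_iff_eq_add] at e'
  rw [e', e, smul_sub]
  abel

theorem span_main (hT : IsLusztigAuts D T) (hbar : IsBar D bar) {w : List I} (hw : RedM D w)
    {b : (Fin w.length → ℕ) → Uq D} (hb : IsCanBasis T w bar b) (J : Submodule 𝕂 (Uq D)) (i : I) (n : ℕ)
    (hJ : ∀ u ∈ Uminus D, u * FF D i ^ n ∈ J) :
    ∀ u ∈ Uminus D, u * FF D i ^ n ∈ Submodule.span 𝕂 (Set.range b ∩ J) := by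
  classical
  obtain ⟨l, hl⟩ := redM_start D hw i
  obtain ⟨k, hw', hk⟩ := rot_fwd hT hl
  intro u hu
  refine Submodule.span_le.2 ?_ (snoc_pow hT hw' hk n hu)
  rintro _ ⟨g, hg, hgn, rfl⟩
  by_contra hbad
  set Bad : Set (ℕ → ℕ) := {f | f ∈ XX (l ++ [k]).length ∧ wtL D (l ++ [k]) f = wtL D (l ++ [k]) g} ∩
    {f | n ≤ f l.length ∧ pL T (l ++ [k]) f ∉ Submodule.span 𝕂 (Set.range b ∩ (J : Set (Uq D)))} with hBad
  have hfin : Bad.Finite := (wt_fin hw'.1 _).subset Set.inter_subset_left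
  obtain ⟨a, ⟨⟨haX, hawt⟩, han, habad⟩, hmax⟩ := Set.exists_max_image Bad (fun f => toLex f) hfin ⟨g, ⟨hg, rfl⟩, hgn, hbad⟩
  obtain ⟨a0, z, hz, e⟩ := b_ex hT hw hw' hb a
  set x := b a0 with hx
  have hbx : bar x = x := hb.2.2 a0
  have hxU : x ∈ Uminus D := by
    rw [e]; exact add_mem (pL_mem hT hw'.1 _) (Subalgebra.smul_mem _ (LL_mem hT hw' hz) _)
  have hkx : ∀ f, kap hT hw' x f = (if a = f then 1 else 0) + qq * kap hT hw' z f := fun f => by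
    rw [e, map_add, map_smul, Finsupp.add_apply, Finsupp.smul_apply, kap_pL, tr_of_mem haX, Finsupp.single_apply, smul_eq_mul]
  have ho : ∀ S : Set (ℕ → ℕ), a ∉ S → ∀ f ∈ S, ∃ o ∈ OO, kap hT hw' x f = qq * o := fun S hS f hf =>
    ⟨_, LL_kap hT hw' hz f, by rw [hkx, if_neg (by rintro rfl; exact hS hf), zero_add]⟩
  have h1 : ∀ f, f l.length < n → kap hT hw' x f = 0 :=
    lexmin hT hbar hw' hxU hbx {f | f l.length < n}
      (fun f hf _ g _ hg => J_closed hT hbar hw' hk hf (not_lt.1 hg)) (ho _ (not_lt.2 han))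
  have h2 : ∀ f, wtL D (l ++ [k]) f ≠ wtL D (l ++ [k]) a → kap hT hw' x f = 0 :=
    lexmin hT hbar hw' hxU hbx {f | wtL D (l ++ [k]) f ≠ wtL D (l ++ [k]) a}
      (fun f hf _ g _ hg => by
        by_contra h0
        have := kap_wt hT hw' (bar_mem hbar (pL_mem hT hw'.1 _)) (bar_WW hbar (WW_pL hT _ g)) h0
        rw [Set.mem_setOf_eq, not_not] at hg
        exact hf (this.trans hg)) (ho _ (fun h => h rfl))
  have h3 : ∀ f, toLex f < toLex a → kap hT hw' x f = 0 :=
    lexmin hT hbar hw' hxU hbx {f | toLex f < toLex a}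
      (fun f hf hfX g hgX hg => by
        by_contra h0
        exact hg (lt_of_le_of_lt ((tri_aux hT hbar _ _ hw' le_rfl f hfX g hgX).1 h0) hf)) (ho _ (fun h => lt_irrefl (toLex a) h))
  have ha0 : kap hT hw' x a ≠ 0 := by
    rw [hkx, if_pos rfl]
    intro h0
    have : (-1 : 𝕂) = 0 := fix_zero hbar (LL_kap hT hw' hz a) (by linear_combination -h0) (by rw [map_neg, map_one])
    simp at this
  have hsum := kap_sum hT hw' hxU
  rw [Finsupp.linearCombination_apply, Finsupp.sum] at hsum
  have hxJ : x ∈ Submodule.span 𝕂 (Set.range b ∩ (J : Set (Uq D))) := by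
    refine Submodule.subset_span ⟨⟨a0, rfl⟩, ?_⟩
    rw [← hsum]
    refine Submodule.sum_mem _ fun f hf => Submodule.smul_mem _ _ ?_
    have hfn : n ≤ f l.length := by
      by_contra h
      exact Finsupp.mem_support_iff.1 hf (h1 f (not_le.1 h))
    obtain ⟨u, hu, e⟩ := pL_snoc_pow hT hw' hk hfn
    rw [e]; exact hJ u hu
  apply habad
  rw [← Submodule.smul_mem_iff _ ha0]
  rw [← Finset.add_sum_erase _ _ (Finsupp.mem_support_iff.2 ha0)] at hsum
  rw [eq_sub_of_add_eq hsum]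
  refine Submodule.sub_mem _ hxJ (Submodule.sum_mem _ fun f hf => Submodule.smul_mem _ _ ?_)
  rw [Finset.mem_erase, Finsupp.mem_support_iff] at hf
  by_contra hfbad
  have hle := hmax f ⟨⟨kap_supp hT hw' hxU f hf.2, ?_⟩, ?_, hfbad⟩
  · exact hf.2 (h3 f (lt_of_le_of_ne hle (fun h => hf.1 (toLex.injective h))))
  · rw [← hawt]
    by_contra h
    exact hf.2 (h2 f h)
  · by_contra h
    exact hf.2 (h1 f (not_le.1 h))

end fin
end CB

theorem canonical_basis_descends_to_module
    {I : Type} [Fintype I] [DecidableEq I] (D : ADEData I)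
    (T : I → (Uq D ≃ₐ[𝕂] Uq D)) (hT : IsLusztigAuts D T)
    (bar : Uq D →+* Uq D) (hbar : IsBar D bar)
    (w : List I) (hw : IsRedW0 D w)
    (b : (Fin w.length → ℕ) → Uq D) (hb : IsCanBasis T w bar b)
    (c : I → ℕ) :
    Submodule.span 𝕂 (Set.range b ∩
      ((⨆ i : I, Submodule.span 𝕂
        {x : Uq D | ∃ u ∈ Uminus D, x = u * (FF D i) ^ (c i + 1)}) :
          Submodule 𝕂 (Uq D))) =
    ⨆ i : I, Submodule.span 𝕂
      {x : Uq D | ∃ u ∈ Uminus D, x = u * (FF D i) ^ (c i + 1)} := by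
  refine le_antisymm (Submodule.span_le.2 Set.inter_subset_right) (iSup_le fun i => Submodule.span_le.2 ?_)
  rintro _ ⟨u, hu, rfl⟩
  refine CB.span_main hT hbar ((CB.redM_iff D w).1 hw) hb _ i (c i + 1) (fun v hv => ?_) u hu
  exact Submodule.mem_iSup_of_mem i (Submodule.subset_span ⟨v, hv, rfl⟩)
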